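/- arXiv:1705.02362 — 6 statements merged into one kernel-verified Lean document; each statement's English description precedes it below -/
import Mathlib

section
/- Assume hypotheses (A1) and (A2). Then the following four inequalities hold: (p₁) x F(x) > x₁ F(x_m) for every x < x₁; (p₂) x F(x) > x₁ F(x_M) for every x with x₁ < x < 0; (p₃) x F(x) > x₂ F(x_m) for every x with 0 < x < x₂; (p₄) x F(x) > x₂ F(x_M) for every x > x₂. -/
/-- A continuous function without zeros on an order-connected set that is positive at one point
of the set is positive on the whole set. -/
lemma pos_of_ne_zero_of_ordConnected {f : ℝ → ℝ} {s : Set ℝ} (hs : s.OrdConnected)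
    (hf : Continuous f) (h0 : ∀ x ∈ s, f x ≠ 0) {y : ℝ} (hy : y ∈ s) (hfy : 0 < f y) :
    ∀ x ∈ s, 0 < f x := by
  intro x hx
  by_contra! hfx
  obtain ⟨z, hz, hz0⟩ := intermediate_value_uIcc (a := x) (b := y) hf.continuousOn
    (Set.mem_uIcc.2 (Or.inl ⟨hfx, hfy.le⟩))
  exact h0 z (hs.uIcc_subset hx hy hz) hz0

open Filter Topology in
/-- At a zero with negative derivative, a function is positive on the left and negative on the
right. -/
lemma eventually_sign_of_deriv_neg {f : ℝ → ℝ} {a : ℝ} (hd : deriv f a < 0) (ha : f a = 0) :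
    (∀ᶠ x in 𝓝[<] a, 0 < f x) ∧ (∀ᶠ x in 𝓝[>] a, f x < 0) := by
  have h := eventually_nhdsWithin_sign_eq_of_deriv_neg hd ha
  constructor
  · filter_upwards [h.filter_mono nhdsWithin_le_nhds,
      self_mem_nhdsWithin] with x hx hxa
    rw [sign_pos (sub_pos.2 hxa)] at hx
    exact sign_eq_one_iff.1 hx
  · filter_upwards [h.filter_mono nhdsWithin_le_nhds,
      self_mem_nhdsWithin] with x hx hxa
    rw [sign_neg (sub_neg.2 hxa)] at hx
    exact sign_eq_neg_one_iff.1 hx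


theorem xF_estimates (f : ℝ → ℝ) (xM xm : ℝ)
    (hf : ContDiff ℝ 2 f)
    (hxM : xM < 0) (hxm : 0 < xm)
    (hfxM : f xM = 0) (hfxm : f xm = 0)
    (hzeros : ∀ x, f x = 0 → x = xM ∨ x = xm)
    (hdM : deriv f xM < 0) (hdm : 0 < deriv f xm)
    (F : ℝ → ℝ) (hF : ∀ x, F x = ∫ s in (0:ℝ)..x, f s)
    (x₁ x₂ : ℝ) (hx₁ : x₁ < xM) (hx₂ : xm < x₂)
    (hFx₁ : F x₁ = F xm) (hFx₂ : F x₂ = F xM) :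
    (∀ x, x < x₁ → x * F x > x₁ * F xm) ∧
    (∀ x, x₁ < x → x < 0 → x * F x > x₁ * F xM) ∧
    (∀ x, 0 < x → x < x₂ → x * F x > x₂ * F xm) ∧
    (∀ x, x₂ < x → x * F x > x₂ * F xM) := by
  have hc : Continuous f := hf.continuous
  have hF' : ∀ x, HasDerivAt F (f x) x := by
    rw [funext hF]
    exact fun x => hc.integral_hasStrictDerivAt 0 x |>.hasDerivAt
  have hFc : Continuous F := continuous_iff_continuousAt.2 fun x => (hF' x).continuousAt
  have hF0 : F 0 = 0 := by simp [hF]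
  obtain ⟨hleft, hright⟩ := eventually_sign_of_deriv_neg hdM hfxM
  have hright' : ∀ᶠ x in nhdsWithin xm (Set.Ioi xm), -f x < 0 :=
    (eventually_sign_of_deriv_neg (f := fun x => -f x) (a := xm)
      (by simpa using hdm) (by simp [hfxm])).2
  obtain ⟨u, hu, hfu⟩ := (Filter.Eventually.and
    (self_mem_nhdsWithin (s := Set.Iio xM)) hleft).exists
  obtain ⟨v, hv, hfv⟩ := (Filter.Eventually.and
    (Ioo_mem_nhdsGT (hxM.trans hxm)) hright).exists
  obtain ⟨w, hw, hfw⟩ := (Filter.Eventually.and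
    (self_mem_nhdsWithin (s := Set.Ioi xm)) hright').exists
  have hpos₁ : ∀ x ∈ Set.Iio xM, 0 < f x := by
    refine pos_of_ne_zero_of_ordConnected Set.ordConnected_Iio hc (fun x hx h => ?_) hu hfu
    rcases hzeros x h with rfl | rfl
    · exact (Set.mem_Iio.1 hx).false
    · exact lt_asymm (hxM.trans hxm) hx
  have hneg : ∀ x ∈ Set.Ioo xM xm, 0 < -f x := by
    refine pos_of_ne_zero_of_ordConnected Set.ordConnected_Ioo hc.neg (fun x hx h => ?_) hv
      (neg_pos.2 hfv)
    rcases hzeros x (neg_eq_zero.1 h) with rfl | rfl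
    · exact lt_irrefl _ hx.1
    · exact lt_irrefl _ hx.2
  have hpos₂ : ∀ x ∈ Set.Ioi xm, 0 < f x := by
    refine pos_of_ne_zero_of_ordConnected Set.ordConnected_Ioi hc (fun x hx h => ?_) hw
      (neg_lt_zero.1 hfw)
    rcases hzeros x h with rfl | rfl
    · exact lt_asymm (hxM.trans hxm) hx
    · exact (Set.mem_Ioi.1 hx).false
  have mono₁ : StrictMonoOn F (Set.Iic xM) :=
    strictMonoOn_of_deriv_pos (convex_Iic _) hFc.continuousOn fun x hx => by
      rw [(hF' x).deriv]; exact hpos₁ x (by simpa using hx)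
  have anti : StrictAntiOn F (Set.Icc xM xm) :=
    strictAntiOn_of_deriv_neg (convex_Icc _ _) hFc.continuousOn fun x hx => by
      rw [(hF' x).deriv]; exact neg_pos.1 (hneg x (by simpa using hx))
  have mono₂ : StrictMonoOn F (Set.Ici xm) :=
    strictMonoOn_of_deriv_pos (convex_Ici _) hFc.continuousOn fun x hx => by
      rw [(hF' x).deriv]; exact hpos₂ x (by simpa using hx)
  have hFM : 0 < F xM := hF0 ▸ anti ⟨le_rfl, by linarith⟩ ⟨hxM.le, hxm.le⟩ hxM
  have hFm : F xm < 0 := hF0 ▸ anti ⟨hxM.le, hxm.le⟩ ⟨by linarith, le_rfl⟩ hxm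
  refine ⟨fun x hx => ?_, fun x hx hx0 => ?_, fun x hx0 hx => ?_, fun x hx => ?_⟩
  · have h : F x < F x₁ := mono₁ (hx.trans hx₁).le hx₁.le hx
    nlinarith
  · have h : F x ≤ F xM := by
      rcases le_total x xM with h | h
      · exact mono₁.monotoneOn h Set.self_mem_Iic h
      · exact anti.antitoneOn ⟨le_rfl, by linarith⟩ ⟨h, by linarith⟩ h
    nlinarith
  · have h : F xm ≤ F x := by
      rcases le_total x xm with h | h
      · exact anti.antitoneOn ⟨by linarith, h⟩ ⟨by linarith, le_rfl⟩ h
      · exact mono₂.monotoneOn Set.self_mem_Ici h h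
    nlinarith
  · have h : F x₂ < F x := mono₂ hx₂.le (hx₂.trans hx).le hx
    nlinarith
end

section
/- Assume hypotheses (A1) and (A2). Then F̄(r) = ∫_{−1}^{1} √(1 − s²) f(r s) ds < 0 for every r with 0 < r ≤ x*; equivalently, the averaged function M₁(r) = −2 r F̄(r) is positive for every r ∈ (0, x*]. -/
/-- A continuous function that vanishes at `a` with positive derivative stays positive to the right
of `a` until its next zero. -/
theorem pos_of_deriv_pos_of_ne_zero {f : ℝ → ℝ} (hf : Continuous f) {a x : ℝ} (hfa : f a = 0)
    (hda : 0 < deriv f a) (hax : a < x) (hne : ∀ y ∈ Set.Ioc a x, f y ≠ 0) : 0 < f x := by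
  have hev := eventually_nhdsWithin_sign_eq_of_deriv_pos hda hfa
  obtain ⟨y, hy, hys, hyx⟩ : ∃ y, 0 < f y ∧ a < y ∧ y < x := by
    have h1 := (hev.filter_mono (nhdsWithin_le_nhds (s := Set.Ioi a))).and
      (Ioo_mem_nhdsGT hax)
    obtain ⟨y, hy, hya⟩ := h1.exists
    refine ⟨y, ?_, hya.1, hya.2⟩
    rw [sign_pos (sub_pos.2 hya.1)] at hy
    exact sign_eq_one_iff.1 hy
  by_contra! hx
  obtain ⟨z, hz, hz0⟩ := intermediate_value_Icc' hyx.le hf.continuousOn ⟨hx, hy.le⟩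
  exact hne z ⟨hys.trans_le hz.1, hz.2⟩ hz0

/-- If `g` is negative and then nonnegative on `[0, ∞)`, with zero integral over `[0, b]`, then its
average over `[0, r]` against the semicircle weight is negative for `0 < r ≤ b`. -/
theorem integral_sqrt_one_sub_sq_mul_neg {g : ℝ → ℝ} (hg : Continuous g) {a b r : ℝ} (ha : 0 < a)
    (hg0 : g 0 < 0) (hneg : ∀ x ∈ Set.Icc 0 a, g x ≤ 0) (hpos : ∀ x, a ≤ x → 0 ≤ g x)
    (hb : ∫ x in (0:ℝ)..b, g x = 0) (hr : 0 < r) (hrb : r ≤ b) :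
    ∫ s in (0:ℝ)..1, Real.sqrt (1 - s ^ 2) * g (r * s) < 0 := by
  have hint : ∫ x in (0:ℝ)..r, g x ≤ 0 := by
    rcases le_total r a with h | h
    · have := intervalIntegral.integral_nonneg (μ := MeasureTheory.volume)
        (f := fun x => -g x) hr.le fun x hx =>
        neg_nonneg.2 (hneg x ⟨hx.1, hx.2.trans h⟩)
      rw [intervalIntegral.integral_neg] at this
      linarith
    · have h1 := intervalIntegral.integral_add_adjacent_intervals
        (hg.intervalIntegrable (μ := MeasureTheory.volume) 0 r) (hg.intervalIntegrable r b)
      have h2 : 0 ≤ ∫ x in r..b, g x :=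
        intervalIntegral.integral_nonneg hrb fun x hx => hpos x (h.trans hx.1)
      linarith
  have hint' : ∫ s in (0:ℝ)..1, g (r * s) ≤ 0 := by
    rw [intervalIntegral.integral_comp_mul_left g hr.ne']
    simpa using mul_nonpos_of_nonneg_of_nonpos (inv_pos.2 hr).le hint
  set c := min (a / r) 1 with hc
  have hc0 : 0 < c := lt_min (div_pos ha hr) one_pos
  have hlt : ∫ s in (0:ℝ)..1, Real.sqrt (1 - s ^ 2) * g (r * s) <
      ∫ s in (0:ℝ)..1, Real.sqrt (1 - c ^ 2) * g (r * s) := by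
    apply intervalIntegral.integral_lt_integral_of_continuousOn_of_le_of_exists_lt one_pos
    · fun_prop
    · fun_prop
    · intro s hs
      rcases le_total s c with h | h
      · have hsa : r * s ≤ a := by
          have := (le_div_iff₀ hr).1 (h.trans (min_le_left _ _))
          linarith
        exact mul_le_mul_of_nonpos_right
          (Real.sqrt_le_sqrt (by nlinarith [hs.1])) (hneg _ ⟨(mul_pos hr hs.1).le, hsa⟩)
      · rcases le_total (a / r) 1 with h' | h'
        · have hsa : a ≤ r * s := by
            have := (div_le_iff₀ hr).1 ((min_eq_left h').symm.le.trans h)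
            linarith
          exact mul_le_mul_of_nonneg_right
            (Real.sqrt_le_sqrt (by nlinarith [hs.1])) (hpos _ hsa)
        · have : s = c := le_antisymm (hs.2.trans (by rw [hc, min_eq_right h'])) h
          rw [this]
    · refine ⟨0, by simp, ?_⟩
      have : Real.sqrt (1 - c ^ 2) < 1 := by
        rw [Real.sqrt_lt' one_pos]
        nlinarith
      simp only [mul_zero]
      exact mul_lt_mul_of_neg_right (by simpa using this) hg0
  rw [intervalIntegral.integral_const_mul] at hlt
  exact hlt.trans_le (mul_nonpos_of_nonneg_of_nonpos (Real.sqrt_nonneg _) hint')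


theorem Fbar_neg_on_small_r (f : ℝ → ℝ) (xM xm : ℝ)
    (hf : ContDiff ℝ 2 f)
    (hxM : xM < 0) (hxm : 0 < xm)
    (hfxM : f xM = 0) (hfxm : f xm = 0)
    (hzeros : ∀ x, f x = 0 → x = xM ∨ x = xm)
    (hdM : deriv f xM < 0) (hdm : 0 < deriv f xm)
    (F : ℝ → ℝ) (hF : ∀ x, F x = ∫ s in (0:ℝ)..x, f s)
    (x₁ x₂ : ℝ) (hx₁ : x₁ < xM) (hx₂ : xm < x₂)
    (hFx₁ : F x₁ = F xm) (hFx₂ : F x₂ = F xM)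
    (x₁s x₂s : ℝ) (hFx₁s : F x₁s = 0) (hFx₂s : F x₂s = 0)
    (h₁ : x₁ < x₁s) (h₁' : x₁s < xM) (h₂ : xm < x₂s) (h₂' : x₂s < x₂)
    (hFzeros : ∀ x, F x = 0 → x = 0 ∨ x = x₁s ∨ x = x₂s) :
    ∀ r : ℝ, 0 < r → r ≤ min (-x₁s) x₂s →
      (∫ s in (-1:ℝ)..1, Real.sqrt (1 - s ^ 2) * f (r * s)) < 0 := by
  intro r hr hr'
  have hc : Continuous f := hf.continuous
  have hcn : Continuous fun x => f (-x) := hc.comp continuous_neg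
  have hneg : ∀ x, xM < x → x < xm → f x < 0 := by
    intro x hx hx'
    have := pos_of_deriv_pos_of_ne_zero (f := fun y => -f y) hc.neg (a := xM) (x := x)
      (by simp [hfxM]) (by rw [deriv.fun_neg]; linarith) hx fun y hy h => by
        rcases hzeros y (neg_eq_zero.1 h) with rfl | rfl
        · exact lt_irrefl _ hy.1
        · exact hx'.not_ge hy.2
    linarith
  have hpos : ∀ x, xm ≤ x → 0 ≤ f x := by
    intro x hx
    rcases hx.eq_or_lt with rfl | hx
    · exact hfxm.ge
    · refine (pos_of_deriv_pos_of_ne_zero hc hfxm hdm hx fun y hy h => ?_).le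
      rcases hzeros y h with rfl | rfl <;> linarith [hy.1]
  have hpos' : ∀ x, -xM ≤ x → 0 ≤ f (-x) := by
    intro x hx
    rcases hx.eq_or_lt with rfl | hx
    · simp [hfxM]
    · refine (pos_of_deriv_pos_of_ne_zero (f := fun y => f (-y)) hcn (a := -xM) (by simpa using hfxM)
        (by rw [deriv_comp_neg, neg_neg]; linarith) hx fun y hy h => ?_).le
      rcases hzeros _ h with h | h <;> linarith [hy.1]
  have hright := integral_sqrt_one_sub_sq_mul_neg hc hxm (hneg 0 hxM hxm)
    (fun x hx => by
      rcases hx.2.eq_or_lt with rfl | h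
      · exact hfxm.le
      · exact (hneg x (hxM.trans_le hx.1) h).le)
    hpos ((hF x₂s).symm.trans hFx₂s) hr (hr'.trans (min_le_right _ _))
  have hleft := integral_sqrt_one_sub_sq_mul_neg (g := fun x => f (-x)) hcn (a := -xM) (b := -x₁s)
    (by linarith) (by simpa using hneg 0 hxM hxm)
    (fun x hx => by
      rcases hx.2.eq_or_lt with rfl | h
      · simp [hfxM]
      · exact (hneg (-x) (by linarith) (by linarith [hx.1])).le)
    hpos'
    (by
      rw [intervalIntegral.integral_comp_neg, intervalIntegral.integral_symm, neg_neg, neg_zero,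
        ← hF, hFx₁s, neg_zero])
    hr (hr'.trans (min_le_left _ _))
  have hcw : Continuous fun s : ℝ => Real.sqrt (1 - s ^ 2) * f (r * s) := by fun_prop
  have hreflect : ∫ s in (-1:ℝ)..0, Real.sqrt (1 - s ^ 2) * f (r * s) =
      ∫ s in (0:ℝ)..1, Real.sqrt (1 - s ^ 2) * f (-(r * s)) := by
    have := intervalIntegral.integral_comp_neg (a := 0) (b := 1)
      fun s : ℝ => Real.sqrt (1 - s ^ 2) * f (r * s)
    simpa using this.symm
  rw [← intervalIntegral.integral_add_adjacent_intervals (hcw.intervalIntegrable (-1) 0)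
    (hcw.intervalIntegrable 0 1), hreflect]
  exact add_neg hleft hright
end

section
/- Assume hypotheses (A1) and (A2). Then for every r > max{−x₁, x₂} one has −2 r F̄(r) ≤ (π/r²)·[(x₁² + x₂²)(F(x_M) − F(x_m)) − r (x₁ F(x_m) + x₂ F(x_M))], where F̄(r) = ∫_{−1}^{1} √(1 − s²) f(r s) ds (so the left-hand side is the averaged function M₁(r)). -/
open Real Set Filter Topology MeasureTheory

/-- A continuous function without zeros on a preconnected set that is positive somewhere on the set
is positive on the whole set. -/
lemma IsPreconnected.pos_of_forall_ne_zero {f : ℝ → ℝ} {s : Set ℝ} (hs : IsPreconnected s)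
    (hf : ContinuousOn f s) (h0 : ∀ x ∈ s, f x ≠ 0) {y : ℝ} (hy : y ∈ s) (hfy : 0 < f y)
    {x : ℝ} (hx : x ∈ s) : 0 < f x := by
  by_contra! h
  obtain ⟨z, hz, hfz⟩ := hs.intermediate_value hx hy hf ⟨h, hfy.le⟩
  exact h0 z hz hfz

/-- A function with positive derivative at a zero takes a negative value to the left of it and a
positive value to the right of it, arbitrarily close. -/
lemma exists_neg_pos_of_deriv_pos {g : ℝ → ℝ} {a b c : ℝ} (h : 0 < deriv g b) (hb : g b = 0)
    (hab : a < b) (hbc : b < c) : (∃ x ∈ Ioo a b, g x < 0) ∧ ∃ x ∈ Ioo b c, 0 < g x := by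
  have hs := eventually_nhdsWithin_sign_eq_of_deriv_pos h hb
  constructor
  · obtain ⟨x, hx, hxs⟩ :=
      (Filter.Eventually.and (Ioo_mem_nhdsLT hab) (hs.filter_mono nhdsWithin_le_nhds)).exists
    refine ⟨x, hx, ?_⟩
    rwa [sign_neg (sub_neg.2 hx.2), sign_eq_neg_one_iff] at hxs
  · obtain ⟨x, hx, hxs⟩ :=
      (Filter.Eventually.and (Ioo_mem_nhdsGT hbc) (hs.filter_mono nhdsWithin_le_nhds)).exists
    refine ⟨x, hx, ?_⟩
    rwa [sign_pos (sub_pos.2 hx.1), sign_eq_one_iff] at hxs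

/-- Signs of a function with exactly two zeros, crossing downwards at the first and upwards at the
second. -/
lemma signs_of_two_zeros {f : ℝ → ℝ} {a b : ℝ} (hf : Continuous f) (hab : a < b)
    (hfa : f a = 0) (hfb : f b = 0) (h0 : ∀ x, f x = 0 → x = a ∨ x = b)
    (ha : deriv f a < 0) (hb : 0 < deriv f b) :
    (∀ x ≤ a, 0 ≤ f x) ∧ (∀ x ∈ Icc a b, f x ≤ 0) ∧ ∀ x, b ≤ x → 0 ≤ f x := by
  have ha' : 0 < deriv (-f) a := by rw [deriv.neg]; linarith
  obtain ⟨⟨p, hp, hfp⟩, -⟩ :=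
    exists_neg_pos_of_deriv_pos ha' (by simp [hfa]) (sub_one_lt a) hab
  obtain ⟨⟨q, hq, hfq⟩, t, ht, hft⟩ := exists_neg_pos_of_deriv_pos hb hfb hab (lt_add_one b)
  refine ⟨fun x hx => ?_, fun x hx => ?_, fun x hx => ?_⟩
  · rcases hx.eq_or_lt with rfl | hx
    · exact hfa.ge
    · refine (isPreconnected_Iio.pos_of_forall_ne_zero hf.continuousOn (s := Iio a)
        (fun z hz h => ?_) hp.2 (by simpa using hfp) hx).le
      rcases h0 z h with rfl | rfl
      · exact lt_irrefl z hz
      · exact lt_asymm hz hab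
  · rcases hx.1.eq_or_lt with rfl | hxa
    · exact hfa.le
    rcases hx.2.eq_or_lt with rfl | hxb
    · exact hfb.le
    · have := isPreconnected_Ioo.pos_of_forall_ne_zero hf.neg.continuousOn (s := Ioo a b)
        (fun z hz h => ?_) hq (by simpa using hfq) ⟨hxa, hxb⟩
      · simpa using this.le
      rcases h0 z (by simpa using h) with rfl | rfl
      · exact lt_irrefl _ hz.1
      · exact lt_irrefl _ hz.2
  · rcases hx.eq_or_lt with rfl | hx
    · exact hfb.ge
    · refine (isPreconnected_Ioi.pos_of_forall_ne_zero hf.continuousOn (s := Ioi b)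
        (fun z hz h => ?_) ht.1 hft hx).le
      rcases h0 z h with rfl | rfl
      · exact lt_asymm hz hab
      · exact lt_irrefl z hz

/-- Substitution `s = sin θ` followed by an integration by parts. -/
lemma mul_integral_sqrt_one_sub_sq_mul {f F : ℝ → ℝ} (hf : Continuous f)
    (hF : ∀ x, HasDerivAt F (f x) x) (r : ℝ) :
    r * ∫ s in (-1 : ℝ)..1, √(1 - s ^ 2) * f (r * s) =
      ∫ θ in -(π / 2)..π / 2, sin θ * F (r * sin θ) := by
  have hFc : Continuous F := continuous_iff_continuousAt.2 fun x => (hF x).continuousAt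
  have hsub : ∫ s in (-1 : ℝ)..1, √(1 - s ^ 2) * f (r * s) =
      ∫ θ in -(π / 2)..π / 2, cos θ * f (r * sin θ) * cos θ := by
    have := intervalIntegral.integral_comp_mul_deriv (a := -(π / 2)) (b := π / 2)
      (g := fun s => √(1 - s ^ 2) * f (r * s))
      (fun x _ => hasDerivAt_sin x) continuous_cos.continuousOn (by fun_prop)
    simp only [Function.comp_apply, sin_neg, sin_pi_div_two] at this
    rw [← this]
    refine intervalIntegral.integral_congr fun θ hθ => ?_
    rw [uIcc_of_le (by linarith [pi_pos])] at hθ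
    simp only [← cos_eq_sqrt_one_sub_sin_sq hθ.1 hθ.2]
  have hder : ∀ θ, HasDerivAt (fun θ => cos θ * F (r * sin θ))
      (r * (cos θ * f (r * sin θ) * cos θ) - sin θ * F (r * sin θ)) θ := fun θ =>
    ((hasDerivAt_cos θ).mul
      ((hF (r * sin θ)).comp θ ((hasDerivAt_sin θ).const_mul r))).congr_deriv <| by
        simp only [Function.comp_apply]
        ring
  have hint := intervalIntegral.integral_eq_sub_of_hasDerivAt (a := -(π / 2)) (b := π / 2)
    (fun θ _ => hder θ) (Continuous.intervalIntegrable (by fun_prop) _ _)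
  rw [intervalIntegral.integral_sub (Continuous.intervalIntegrable (by fun_prop) _ _)
    (Continuous.intervalIntegrable (by fun_prop) _ _),
    intervalIntegral.integral_const_mul] at hint
  simp only [cos_neg, cos_pi_div_two, zero_mul, sub_zero] at hint
  rw [hsub]
  linarith

lemma mul_cos_sub_cos_le_integral {G : ℝ → ℝ} (hG : Continuous G) {a b c : ℝ} (hab : a ≤ b)
    (h : ∀ θ ∈ Icc a b, sin θ * c ≤ sin θ * G θ) :
    c * (cos a - cos b) ≤ ∫ θ in a..b, sin θ * G θ := by
  have := intervalIntegral.integral_mono_on (μ := volume) hab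
    (Continuous.intervalIntegrable (by fun_prop) _ _)
    (Continuous.intervalIntegrable (by fun_prop) _ _) h
  rwa [intervalIntegral.integral_mul_const, integral_sin, mul_comm] at this

/-- Lower bound of the averaged integral by replacing `F` with one-sided constant bounds. -/
lemma le_integral_sin_mul {F : ℝ → ℝ} (hF : Continuous F) {r a b M m : ℝ} (hr : 0 < r)
    (ha : 0 ≤ a) (har : a ≤ 1) (hb : 0 ≤ b) (hbr : b ≤ 1)
    (h₁ : ∀ x ≤ -(r * a), F x ≤ m) (h₂ : ∀ x ≤ 0, F x ≤ M)
    (h₃ : ∀ x, 0 ≤ x → m ≤ F x) (h₄ : ∀ x, r * b ≤ x → M ≤ F x) :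
    (M - m) * (√(1 - a ^ 2) + √(1 - b ^ 2) - 1) ≤
      ∫ θ in -(π / 2)..π / 2, sin θ * F (r * sin θ) := by
  have hG : Continuous fun θ => F (r * sin θ) := by fun_prop
  have hI : ∀ u v, IntervalIntegrable (fun θ => sin θ * F (r * sin θ)) volume u v := fun u v =>
    Continuous.intervalIntegrable (by fun_prop) _ _
  have hα := arcsin_nonneg.2 ha
  have hβ := arcsin_nonneg.2 hb
  have hα' := arcsin_le_pi_div_two a
  have hβ' := arcsin_le_pi_div_two b
  have hsa := sin_arcsin (by linarith) har
  have hsb := sin_arcsin (by linarith) hbr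
  have i₁ := mul_cos_sub_cos_le_integral hG (a := -(π / 2)) (b := -arcsin a) (c := m)
    (by linarith) fun θ hθ => by
      have hs : sin θ ≤ -a := by
        have := sin_le_sin_of_le_of_le_pi_div_two hθ.1 (by linarith) hθ.2
        rwa [sin_neg, hsa] at this
      exact mul_le_mul_of_nonpos_left (h₁ _ (by nlinarith)) (by linarith)
  have i₂ := mul_cos_sub_cos_le_integral hG (a := -arcsin a) (b := 0) (c := M)
    (by linarith) fun θ hθ => by
      have hs : sin θ ≤ 0 := sin_nonpos_of_nonpos_of_neg_pi_le hθ.2 (by linarith [hθ.1, pi_pos])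
      exact mul_le_mul_of_nonpos_left (h₂ _ (by nlinarith)) hs
  have i₃ := mul_cos_sub_cos_le_integral hG (a := 0) (b := arcsin b) (c := m)
    hβ fun θ hθ => by
      have hs : 0 ≤ sin θ := sin_nonneg_of_nonneg_of_le_pi hθ.1 (by linarith [hθ.2, pi_pos])
      exact mul_le_mul_of_nonneg_left (h₃ _ (by positivity)) hs
  have i₄ := mul_cos_sub_cos_le_integral hG (a := arcsin b) (b := π / 2) (c := M)
    hβ' fun θ hθ => by
      have hs : b ≤ sin θ := by
        have := sin_le_sin_of_le_of_le_pi_div_two (by linarith [pi_pos]) hθ.2 hθ.1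
        rwa [hsb] at this
      exact mul_le_mul_of_nonneg_left (h₄ _ (by nlinarith)) (by linarith)
  rw [← intervalIntegral.integral_add_adjacent_intervals (hI _ (-arcsin a)) (hI _ _),
    ← intervalIntegral.integral_add_adjacent_intervals (hI (-arcsin a) 0) (hI _ _),
    ← intervalIntegral.integral_add_adjacent_intervals (hI 0 (arcsin b)) (hI _ _)]
  simp only [cos_neg, cos_pi_div_two, cos_zero, cos_arcsin] at i₁ i₂ i₃ i₄
  linarith

lemma one_sub_sq_le_sqrt {a : ℝ} (ha : 0 ≤ a) (ha1 : a ≤ 1) : 1 - a ^ 2 ≤ √(1 - a ^ 2) :=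
  le_sqrt_of_sq_le (by nlinarith [mul_nonneg ha ha, mul_le_one₀ ha1 ha ha1])

lemma neg_two_mul_sqrt_add_sqrt_le {a b : ℝ} (ha : 0 ≤ a) (ha1 : a ≤ 1) (hb : 0 ≤ b)
    (hb1 : b ≤ 1) : -2 * (√(1 - a ^ 2) + √(1 - b ^ 2) - 1) ≤ π * (a ^ 2 + b ^ 2 - b) := by
  have h1 := one_sub_sq_le_sqrt ha ha1
  have h2 := one_sub_sq_le_sqrt hb hb1
  have h3 : 2 * a ^ 2 ≤ π * a ^ 2 := by gcongr; exact two_le_pi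
  have h4 : π * (b * (1 - b)) ≤ 4 * (b * (1 - b)) :=
    mul_le_mul_of_nonneg_right pi_le_four (mul_nonneg hb (by linarith))
  nlinarith [sq_nonneg (1 - b)]

theorem averaged_fn_upper_bound (f : ℝ → ℝ) (xM xm : ℝ)
    (hf : ContDiff ℝ 2 f)
    (hxM : xM < 0) (hxm : 0 < xm)
    (hfxM : f xM = 0) (hfxm : f xm = 0)
    (hzeros : ∀ x, f x = 0 → x = xM ∨ x = xm)
    (hdM : deriv f xM < 0) (hdm : 0 < deriv f xm)
    (F : ℝ → ℝ) (hF : ∀ x, F x = ∫ s in (0:ℝ)..x, f s)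
    (x₁ x₂ : ℝ) (hx₁ : x₁ < xM) (hx₂ : xm < x₂)
    (hFx₁ : F x₁ = F xm) (hFx₂ : F x₂ = F xM) :
    ∀ r : ℝ, max (-x₁) x₂ < r →
      -2 * r * (∫ s in (-1:ℝ)..1, Real.sqrt (1 - s ^ 2) * f (r * s)) ≤
        (Real.pi / r ^ 2) *
          ((x₁ ^ 2 + x₂ ^ 2) * (F xM - F xm) - r * (x₁ * F xm + x₂ * F xM)) := by
  intro r hr
  obtain ⟨hr₁, hr₂⟩ := max_lt_iff.1 hr
  have hr0 : 0 < r := by linarith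
  have hfc := hf.continuous
  have hFd : ∀ x, HasDerivAt F (f x) x := fun x => by
    rw [funext hF]
    exact intervalIntegral.integral_hasDerivAt_right (hfc.intervalIntegrable _ _)
      (hfc.stronglyMeasurableAtFilter _ _) hfc.continuousAt
  have hFc : Continuous F := continuous_iff_continuousAt.2 fun x => (hFd x).continuousAt
  have hF0 : F 0 = 0 := by simp [hF]
  obtain ⟨sl, sc, sr⟩ :=
    signs_of_two_zeros hfc (hxM.trans hxm) hfxM hfxm hzeros hdM hdm
  have ml : MonotoneOn F (Iic xM) := monotoneOn_of_hasDerivWithinAt_nonneg (convex_Iic _)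
    hFc.continuousOn (fun x _ => (hFd x).hasDerivWithinAt) fun x hx =>
      sl x (show x ∈ Iic xM from interior_subset hx)
  have mc : AntitoneOn F (Icc xM xm) := antitoneOn_of_hasDerivWithinAt_nonpos (convex_Icc _ _)
    hFc.continuousOn (fun x _ => (hFd x).hasDerivWithinAt) fun x hx => sc x (interior_subset hx)
  have mr : MonotoneOn F (Ici xm) := monotoneOn_of_hasDerivWithinAt_nonneg (convex_Ici _)
    hFc.continuousOn (fun x _ => (hFd x).hasDerivWithinAt) fun x hx =>
      sr x (show x ∈ Ici xm from interior_subset hx)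
  have hl : ∀ x ≤ 0, F x ≤ F xM := fun x hx => by
    rcases le_total x xM with h | h
    · exact ml h self_mem_Iic h
    · exact mc ⟨le_rfl, by linarith⟩ ⟨h, by linarith⟩ h
  have hrt : ∀ x, 0 ≤ x → F xm ≤ F x := fun x hx => by
    rcases le_total x xm with h | h
    · exact mc ⟨by linarith, h⟩ ⟨by linarith, le_rfl⟩ h
    · exact mr self_mem_Ici h h
  have hM := hl 0 le_rfl
  have hm := hrt 0 le_rfl
  rw [hF0] at hM hm
  obtain ⟨a, rfl⟩ : ∃ a, x₁ = -(r * a) := ⟨-x₁ / r, by field_simp⟩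
  obtain ⟨b, rfl⟩ : ∃ b, x₂ = r * b := ⟨x₂ / r, by field_simp⟩
  have ha : 0 ≤ a := nonneg_of_mul_nonneg_right (by linarith) hr0
  have hb : 0 ≤ b := nonneg_of_mul_nonneg_right (by linarith) hr0
  have ha1 : a ≤ 1 := by nlinarith
  have hb1 : b ≤ 1 := by nlinarith
  have key := le_integral_sin_mul hFc hr0 ha ha1 hb hb1 (M := F xM) (m := F xm)
    (fun x hx => hFx₁ ▸ ml (by simp only [mem_Iic]; linarith) hx₁.le hx) hl hrt
    (fun x hx => hFx₂ ▸ mr hx₂.le (by simp only [mem_Ici]; linarith) hx)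
  rw [← mul_integral_sqrt_one_sub_sq_mul hfc hFd] at key
  have eM := mul_le_mul_of_nonneg_left (neg_two_mul_sqrt_add_sqrt_le ha ha1 hb hb1) hM
  have em := mul_le_mul_of_nonneg_left (neg_two_mul_sqrt_add_sqrt_le hb hb1 ha ha1)
    (neg_nonneg.2 hm)
  have hR : π / r ^ 2 * (((-(r * a)) ^ 2 + (r * b) ^ 2) * (F xM - F xm) -
      r * (-(r * a) * F xm + r * b * F xM)) =
      π * ((a ^ 2 + b ^ 2) * (F xM - F xm) + a * F xm - b * F xM) := by
    field_simp
    ring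
  rw [hR]
  linarith
end

section
/- Assume hypotheses (A1) and (A2). Then for every λ > 0 the Liénard system (S1) x' = y, y' = −x − λ f(x) y admits at least one nonconstant periodic solution; that is, there exist T > 0 and a nonconstant C¹ map γ = (x, y) : ℝ → ℝ² with γ(t + T) = γ(t) for all t, x'(t) = y(t) and y'(t) = −x(t) − λ f(x(t)) y(t) for all t. -/
open Set Metric
open scoped NNReal Manifold Topology

/-- A `C¹` globally Lipschitz vector field is complete. -/
theorem exists_global_integralCurve {E : Type*} [NormedAddCommGroup E] [NormedSpace ℝ E]
    [CompleteSpace E] {v : E → E} {K : ℝ≥0} (hv : ContDiff ℝ 1 v) (hK : LipschitzWith K v)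
    (p : E) : ∃ γ : ℝ → E, γ 0 = p ∧ ∀ t, HasDerivAt γ (v (γ t)) t := by
  set ε : ℝ := 1 / (2 * (K + 1)) with hε
  have hε0 : 0 < ε := by positivity
  have hloc : ∀ q : E, ∃ γ : ℝ → E, γ 0 = q ∧
      ∀ t ∈ Ioo (-ε) ε, HasDerivAt γ (v (γ t)) t := by
    intro q
    have hpl : IsPicardLindelof (fun _ : ℝ ↦ v) (tmin := -ε) (tmax := ε)
        ⟨0, by constructor <;> linarith⟩ q ‖v q‖₊ 0 (‖v q‖₊ + K * ‖v q‖₊) K := by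
      refine ⟨fun _ _ ↦ hK.lipschitzOnWith, fun _ _ ↦ continuousOn_const, fun _ _ x hx ↦ ?_, ?_⟩
      · have h1 := hK.dist_le_mul x q
        have h2 : ‖v x‖ ≤ ‖v q‖ + dist (v x) (v q) := by
          rw [dist_eq_norm]; simpa using norm_add_le (v q) (v x - v q)
        have h3 : (K : ℝ) * dist x q ≤ K * ‖v q‖ := by
          gcongr; simpa using hx
        push_cast
        linarith
      · simp only [sub_zero, zero_sub, neg_neg, max_self]
        push_cast
        simp only [sub_zero]
        have : (‖v q‖ + K * ‖v q‖) * ε = ‖v q‖ / 2 := by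
          rw [hε]; field_simp; ring
        rw [this]
        linarith [norm_nonneg (v q)]
    obtain ⟨γ, h0, h⟩ := hpl.exists_eq_forall_mem_Icc_hasDerivWithinAt₀
    exact ⟨γ, h0, fun t ht ↦ (h t (Ioo_subset_Icc_self ht)).hasDerivAt (Icc_mem_nhds ht.1 ht.2)⟩
  have hv' : ContMDiff 𝓘(ℝ, E) 𝓘(ℝ, E).tangent 1
      (fun x ↦ (⟨x, v x⟩ : TangentBundle 𝓘(ℝ, E) E)) :=
    contMDiff_vectorSpace_iff_contDiff.2 hv
  obtain ⟨γ, h0, h⟩ := exists_isMIntegralCurve_of_isMIntegralCurveOn hv' hε0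
    (fun q ↦ (hloc q).imp fun γ hγ ↦
      ⟨hγ.1, fun t ht ↦ ((hγ.2 t ht).hasFDerivAt.hasMFDerivAt).hasMFDerivWithinAt⟩) p
  refine ⟨γ, h0, fun t ↦ ?_⟩
  have ht : HasFDerivAt γ ((1 : ℝ →L[ℝ] ℝ).smulRight (v (γ t))) t := (h t).hasFDerivAt
  simpa using ht.hasDerivAt

theorem antitoneOn_Icc_of_hasDerivAt_nonpos {u u' : ℝ → ℝ} {a b : ℝ}
    (hu : ∀ t, HasDerivAt u (u' t) t) (hu' : ∀ t ∈ Ioo a b, u' t ≤ 0) :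
    AntitoneOn u (Icc a b) :=
  antitoneOn_of_hasDerivWithinAt_nonpos (convex_Icc a b)
    (fun t _ ↦ (hu t).continuousAt.continuousWithinAt)
    (fun t _ ↦ (hu t).hasDerivWithinAt) (fun t ht ↦ hu' t (by simpa using ht))

theorem strictMonoOn_Icc_of_hasDerivAt_pos {u u' : ℝ → ℝ} {a b : ℝ}
    (hu : ∀ t, HasDerivAt u (u' t) t) (hu' : ∀ t ∈ Ioo a b, 0 < u' t) :
    StrictMonoOn u (Icc a b) :=
  strictMonoOn_of_hasDerivWithinAt_pos (convex_Icc a b)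
    (fun t _ ↦ (hu t).continuousAt.continuousWithinAt)
    (fun t _ ↦ (hu t).hasDerivWithinAt) (fun t ht ↦ hu' t (by simpa using ht))

/-- A damping primitive `G` which is negative near `0⁺`, positive near `0⁻`, bounded below by
`a > 0` far to the right and bounded above by `-a` far to the left. -/
structure IsDamping (G : ℝ → ℝ) (K : ℝ≥0) (δ a X M : ℝ) : Prop where
  contDiff : ContDiff ℝ 1 G
  lipschitz : LipschitzWith K G
  map_zero : G 0 = 0
  δ_pos : 0 < δ
  a_pos : 0 < a
  X_pos : 0 < X
  a_le : a ≤ M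
  neg_of_mem : ∀ x ∈ Ioo 0 δ, G x < 0
  pos_of_mem : ∀ x ∈ Ioo (-δ) 0, 0 < G x
  le_right : ∀ x, X ≤ x → a ≤ G x
  left_le : ∀ x, x ≤ -X → G x ≤ -a
  lower : ∀ x, 0 ≤ x → -M ≤ G x
  upper : ∀ x, x ≤ 0 → G x ≤ M

/-- Solutions of the system `x' = y - G(x)`, `y' = -x` in the Liénard plane. -/
structure IsLienardSol (G x y : ℝ → ℝ) : Prop where
  hasDerivAt_fst : ∀ t, HasDerivAt x (y t - G (x t)) t
  hasDerivAt_snd : ∀ t, HasDerivAt y (-x t) t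

/-- The vector field of the Liénard plane. -/
def lienardField (G : ℝ → ℝ) (p : ℝ × ℝ) : ℝ × ℝ := (p.2 - G p.1, -p.1)

section Lienard

variable {G x y x' y' : ℝ → ℝ} {K : ℝ≥0} {δ a X M R τ : ℝ}

theorem IsLienardSol.hasDerivAt_prod (S : IsLienardSol G x y) (t : ℝ) :
    HasDerivAt (fun t ↦ (x t, y t)) (lienardField G (x t, y t)) t :=
  (S.hasDerivAt_fst t).prodMk (S.hasDerivAt_snd t)

theorem IsLienardSol.continuous_fst (S : IsLienardSol G x y) : Continuous x :=
  continuous_iff_continuousAt.2 fun t ↦ (S.hasDerivAt_fst t).continuousAt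

theorem IsLienardSol.continuous_snd (S : IsLienardSol G x y) : Continuous y :=
  continuous_iff_continuousAt.2 fun t ↦ (S.hasDerivAt_snd t).continuousAt

theorem IsLienardSol.neg_reflect (S : IsLienardSol (fun s ↦ -G (-s)) x y) :
    IsLienardSol G (fun t ↦ -x t) (fun t ↦ -y t) where
  hasDerivAt_fst t := (S.hasDerivAt_fst t).neg.congr_deriv (by ring)
  hasDerivAt_snd t := (S.hasDerivAt_snd t).neg

theorem IsLienardSol.shift (S : IsLienardSol G x y) (c : ℝ) :
    IsLienardSol G (fun t ↦ x (t + c)) (fun t ↦ y (t + c)) where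
  hasDerivAt_fst t := (S.hasDerivAt_fst (t + c)).comp_add_const t c
  hasDerivAt_snd t := (S.hasDerivAt_snd (t + c)).comp_add_const t c

namespace IsDamping

theorem reflect (h : IsDamping G K δ a X M) : IsDamping (fun s ↦ -G (-s)) K δ a X M where
  contDiff := (h.contDiff.comp contDiff_neg).neg
  lipschitz := LipschitzWith.of_dist_le_mul fun s t ↦ by
    simpa only [dist_neg_neg] using h.lipschitz.dist_le_mul (-s) (-t)
  map_zero := by simp [h.map_zero]
  δ_pos := h.δ_pos
  a_pos := h.a_pos
  X_pos := h.X_pos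
  a_le := h.a_le
  neg_of_mem s hs := by
    have := h.pos_of_mem (-s) ⟨by linarith [hs.2], by linarith [hs.1]⟩
    linarith
  pos_of_mem s hs := by
    have := h.neg_of_mem (-s) ⟨by linarith [hs.2], by linarith [hs.1]⟩
    linarith
  le_right s hs := by linarith [h.left_le (-s) (by linarith)]
  left_le s hs := by linarith [h.le_right (-s) (by linarith)]
  lower s hs := by linarith [h.upper (-s) (by linarith)]
  upper s hs := by linarith [h.lower (-s) (by linarith)]

theorem abs_le (h : IsDamping G K δ a X M) (s : ℝ) : |G s| ≤ K * |s| := by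
  simpa [Real.dist_eq, h.map_zero] using h.lipschitz.dist_le_mul s 0

theorem lipschitzWith_field (h : IsDamping G K δ a X M) :
    LipschitzWith (K + 1) (lienardField G) := by
  refine LipschitzWith.of_dist_le_mul fun p q ↦ ?_
  have h1 : |p.1 - q.1| ≤ dist p q := by rw [Prod.dist_eq, ← Real.dist_eq]; exact le_max_left _ _
  have h2 : |p.2 - q.2| ≤ dist p q := by rw [Prod.dist_eq, ← Real.dist_eq]; exact le_max_right _ _
  have h3 : |G p.1 - G q.1| ≤ K * |p.1 - q.1| := h.lipschitz.dist_le_mul _ _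
  have h4 : (K : ℝ) * |p.1 - q.1| ≤ K * dist p q := by gcongr
  rw [Prod.dist_eq (x := lienardField G p), NNReal.coe_add, NNReal.coe_one]
  refine max_le ?_ ?_
  · simp only [lienardField, Real.dist_eq]
    calc |p.2 - G p.1 - (q.2 - G q.1)| = |(p.2 - q.2) - (G p.1 - G q.1)| := by ring_nf
      _ ≤ |p.2 - q.2| + |G p.1 - G q.1| := abs_sub _ _
      _ ≤ _ := by linarith
  · simp only [lienardField, dist_neg_neg]
    rw [Real.dist_eq]
    have : 0 ≤ (K : ℝ) * dist p q := by positivity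
    linarith

theorem exists_sol (h : IsDamping G K δ a X M) (p q : ℝ) :
    ∃ x y, IsLienardSol G x y ∧ x 0 = p ∧ y 0 = q := by
  have hc : ContDiff ℝ 1 (lienardField G) :=
    (contDiff_snd.sub (h.contDiff.comp contDiff_fst)).prodMk contDiff_fst.neg
  obtain ⟨γ, h0, hγ⟩ := exists_global_integralCurve hc h.lipschitzWith_field (p, q)
  refine ⟨fun t ↦ (γ t).1, fun t ↦ (γ t).2, ⟨fun t ↦ ?_, fun t ↦ ?_⟩, by simp [h0], by simp [h0]⟩
  · exact (hγ t).fst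
  · exact (hγ t).snd

theorem sol_unique (h : IsDamping G K δ a X M) (S : IsLienardSol G x y)
    (S' : IsLienardSol G x' y') {t₀ : ℝ} (hx : x t₀ = x' t₀) (hy : y t₀ = y' t₀) (t : ℝ) :
    x t = x' t ∧ y t = y' t := by
  have := ODE_solution_unique_univ (v := fun _ ↦ lienardField G) (s := fun _ ↦ univ) (t₀ := t₀)
    (fun _ ↦ h.lipschitzWith_field.lipschitzOnWith)
    (fun t ↦ ⟨S.hasDerivAt_prod t, trivial⟩) (fun t ↦ ⟨S'.hasDerivAt_prod t, trivial⟩)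
    (by simp [hx, hy])
  simpa using congrFun this t

theorem sol_close (h : IsDamping G K δ a X M) (S : IsLienardSol G x y)
    (S' : IsLienardSol G x' y') (hx : x 0 = x' 0) {T t : ℝ} (ht : t ∈ Icc 0 T) :
    |x t - x' t| ≤ |y 0 - y' 0| * Real.exp ((K + 1) * T) ∧
      |y t - y' t| ≤ |y 0 - y' 0| * Real.exp ((K + 1) * T) := by
  have key := dist_le_of_trajectories_ODE (v := fun _ ↦ lienardField G) (a := 0) (b := T)
    (δ := |y 0 - y' 0|) (fun _ ↦ h.lipschitzWith_field)
    (fun t _ ↦ (S.hasDerivAt_prod t).continuousAt.continuousWithinAt)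
    (fun t _ ↦ (S.hasDerivAt_prod t).hasDerivWithinAt)
    (fun t _ ↦ (S'.hasDerivAt_prod t).continuousAt.continuousWithinAt)
    (fun t _ ↦ (S'.hasDerivAt_prod t).hasDerivWithinAt)
    (by simp [Prod.dist_eq, hx, Real.dist_eq]) t ht
  have hexp : |y 0 - y' 0| * Real.exp (↑(K + 1) * (t - 0)) ≤
      |y 0 - y' 0| * Real.exp ((K + 1) * T) := by
    push_cast
    gcongr
    linarith [ht.2]
  have := key.trans hexp
  rw [Prod.dist_eq] at this
  exact ⟨(le_max_left _ _).trans this, (le_max_right _ _).trans this⟩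

/-- While `0 ≤ y`, the coordinate `x` cannot decrease below a level `c ∈ (0, δ)`. -/
theorem le_fst_of_snd_nonneg (h : IsDamping G K δ a X M) (S : IsLienardSol G x y) {s T c : ℝ}
    (hy : ∀ t ∈ Icc s T, 0 ≤ y t) (hc : c ∈ Ioo 0 δ) (hcs : c ≤ x s) :
    ∀ t ∈ Icc s T, c ≤ x t := by
  intro t ht
  have := image_le_of_deriv_right_lt_deriv_boundary (f := fun t ↦ -x t) (B := fun _ ↦ -c)
    (B' := fun _ ↦ 0) (a := s) (b := T) S.continuous_fst.neg.continuousOn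
    (fun t _ ↦ (S.hasDerivAt_fst t).neg.hasDerivWithinAt) (by simpa using hcs)
    (fun t ↦ hasDerivAt_const t _) (fun t ht hxt ↦ by
      have hxt' : x t = c := by simpa using hxt
      have h1 := h.neg_of_mem c hc
      have h2 := hy t (Ico_subset_Icc_self ht)
      rw [hxt']
      linarith) ht
  simpa using this

end IsDamping

/-- The orbit crosses the half plane `0 < x` during the time interval `(0, τ)`, entering it at
`(0, R)` and leaving it through the negative `y`-axis. -/
structure IsPassage (G x y : ℝ → ℝ) (R τ : ℝ) : Prop extends IsLienardSol G x y where
  R_pos : 0 < R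
  fst_zero : x 0 = 0
  snd_zero : y 0 = R
  τ_pos : 0 < τ
  pos : ∀ t ∈ Ioo 0 τ, 0 < x t
  fst_end : x τ = 0
  snd_end : y τ < 0

namespace IsDamping

theorem exists_pos_Ioc (h : IsDamping G K δ a X M) (S : IsLienardSol G x y)
    (hx : x 0 = 0) (hy : 0 < y 0) : ∃ η > 0, ∀ t ∈ Ioc 0 η, 0 < x t := by
  have hcont : Continuous fun t ↦ y t - G (x t) :=
    S.continuous_snd.sub (h.contDiff.continuous.comp S.continuous_fst)
  have h0 : 0 < y 0 - G (x 0) := by rw [hx, h.map_zero]; linarith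
  obtain ⟨η, hη, hball⟩ := Metric.eventually_nhds_iff.1
    (hcont.continuousAt.eventually (lt_mem_nhds h0))
  have hmono := strictMonoOn_Icc_of_hasDerivAt_pos (a := 0) (b := η / 2) S.hasDerivAt_fst
    (fun t ht ↦ hball (by rw [Real.dist_eq, abs_lt]; constructor <;> linarith [ht.1, ht.2]))
  refine ⟨η / 2, by positivity, fun t ht ↦ ?_⟩
  have := hmono ⟨le_rfl, by linarith⟩ ⟨ht.1.le, ht.2⟩ ht.1
  linarith

theorem exists_fst_nonpos (h : IsDamping G K δ a X M) (S : IsLienardSol G x y) :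
    ∃ t > 0, x t ≤ 0 := by
  by_contra! hpos
  have hy_anti (T : ℝ) : AntitoneOn y (Icc 0 T) :=
    antitoneOn_Icc_of_hasDerivAt_nonpos S.hasDerivAt_snd
      fun t ht ↦ by linarith [hpos t ht.1]
  obtain ⟨t₀, ht₀, hyt₀⟩ : ∃ t ≥ 0, y t < 0 := by
    by_contra! hy
    set c := min (x 1) (δ / 2)
    have hc : 0 < c := lt_min (hpos 1 one_pos) (half_pos h.δ_pos)
    have hcδ : c < δ := (min_le_right _ _).trans_lt (half_lt_self h.δ_pos)
    set T := 1 + y 1 / c + 1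
    have hT : 1 ≤ T := by
      have := div_nonneg (hy 1 zero_le_one) hc.le
      simp only [T]; linarith
    have hx := h.le_fst_of_snd_nonneg S (s := 1) (T := T)
      (fun t ht ↦ hy t (by linarith [ht.1])) ⟨hc, hcδ⟩ (min_le_left _ _)
    have hanti := antitoneOn_Icc_of_hasDerivAt_nonpos (u := fun t ↦ y t + c * t)
      (a := 1) (b := T) (fun t ↦ (S.hasDerivAt_snd t).add ((hasDerivAt_id t).const_mul c))
      (fun t ht ↦ by linarith [hx t (Ioo_subset_Icc_self ht)])
      ⟨le_rfl, hT⟩ ⟨hT, le_rfl⟩ hT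
    have hcT : c * T = c + y 1 + c := by simp only [T]; field_simp
    have := hy T (by linarith)
    simp only [hcT] at hanti
    linarith
  by_cases hlow : ∃ t ≥ 0, y t ≤ -(M + 1)
  · obtain ⟨t, ht, hyt⟩ := hlow
    set T := t + |x t| + 1 with hT
    have htT : t ≤ T := by linarith [abs_nonneg (x t)]
    have hanti := antitoneOn_Icc_of_hasDerivAt_nonpos (u := fun t ↦ x t + t)
      (a := t) (b := T) (fun t ↦ (S.hasDerivAt_fst t).add (hasDerivAt_id t))
      (fun s hs ↦ by
        have h1 := hy_anti s ⟨ht, hs.1.le⟩ ⟨ht.le.trans hs.1.le, le_rfl⟩ hs.1.le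
        have h2 := h.lower (x s) (hpos s (ht.trans_lt hs.1)).le
        linarith)
      ⟨le_rfl, htT⟩ ⟨htT, le_rfl⟩ htT
    have := hpos T (by linarith [abs_nonneg (x t)])
    simp only at hanti
    linarith [le_abs_self (x t)]
  · push Not at hlow
    set b := -y t₀
    have hb : 0 < b := by simp only [b]; linarith
    have hM : 0 < M := h.a_pos.trans_le h.a_le
    set T := t₀ + 1 + (|x t₀| + K * (M + 1)) / b
    have htT : t₀ < T := by
      have : 0 ≤ (|x t₀| + K * (M + 1)) / b := by positivity
      simp only [T]; linarith
    have hanti := antitoneOn_Icc_of_hasDerivAt_nonpos (u := fun t ↦ x t + K * y t + b * t)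
      (a := t₀) (b := T) (fun t ↦ ((S.hasDerivAt_fst t).add
        ((S.hasDerivAt_snd t).const_mul (K : ℝ))).add ((hasDerivAt_id t).const_mul b))
      (fun s hs ↦ by
        have h1 := hy_anti s ⟨ht₀, hs.1.le⟩ ⟨ht₀.le.trans hs.1.le, le_rfl⟩ hs.1.le
        have h2 := _root_.abs_le.1 (h.abs_le (x s))
        rw [abs_of_pos (hpos s (ht₀.trans_lt hs.1))] at h2
        simp only [b]
        linarith)
      ⟨le_rfl, htT.le⟩ ⟨htT.le, le_rfl⟩ htT.le
    have hxT := hpos T (ht₀.trans_lt htT)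
    have hyT := hlow T (ht₀.trans htT.le)
    have hbT : b * T = b * t₀ + b + (|x t₀| + K * (M + 1)) := by simp only [T]; field_simp
    have h3 : (K : ℝ) * -(M + 1) ≤ K * y T := by gcongr
    have h4 : (K : ℝ) * y t₀ ≤ 0 := mul_nonpos_of_nonneg_of_nonpos K.2 hyt₀.le
    simp only [hbT] at hanti
    linarith [le_abs_self (x t₀)]

theorem exists_passage (h : IsDamping G K δ a X M) (hR : 0 < R) :
    ∃ x y τ, IsPassage G x y R τ := by
  obtain ⟨x, y, S, hx0, hy0⟩ := h.exists_sol 0 R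
  obtain ⟨η, hη, hpos⟩ := h.exists_pos_Ioc S hx0 (hy0 ▸ hR)
  obtain ⟨t, ht, hxt⟩ := h.exists_fst_nonpos S
  have hηt : η < t := by
    by_contra! hle
    linarith [hpos t ⟨ht, hle⟩]
  have hcomp : IsCompact (Icc η t ∩ {s | x s ≤ 0}) :=
    isCompact_Icc.inter_right (isClosed_le S.continuous_fst continuous_const)
  obtain ⟨τ, ⟨hτm, hτx⟩, hleast⟩ := hcomp.exists_isLeast ⟨t, ⟨hηt.le, le_rfl⟩, hxt⟩
  have hητ : η < τ := hτm.1.lt_of_ne fun he ↦ by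
    have := hpos η ⟨hη, le_rfl⟩
    rw [he] at this
    exact absurd hτx (not_le.2 this)
  have hpos' : ∀ s ∈ Ioo 0 τ, 0 < x s := by
    intro s hs
    by_contra! hle
    rcases le_or_gt s η with hsη | hsη
    · linarith [hpos s ⟨hs.1, hsη⟩]
    · linarith [hleast ⟨⟨hsη.le, hs.2.le.trans hτm.2⟩, hle⟩, hs.2]
  have hτ0 : 0 < τ := hη.trans hητ
  have hxτ : x τ = 0 := by
    refine le_antisymm hτx ?_
    have : Icc 0 τ ⊆ {s | 0 ≤ x s} := by
      rw [← closure_Ioo hτ0.ne]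
      exact closure_minimal (fun s hs ↦ (hpos' s hs).le)
        (isClosed_le continuous_const S.continuous_fst)
    exact this ⟨hτ0.le, le_rfl⟩
  refine ⟨x, y, τ, S, hR, hx0, hy0, hτ0, hpos', hxτ, ?_⟩
  by_contra! hyτ
  have hanti := antitoneOn_Icc_of_hasDerivAt_nonpos (a := 0) (b := τ) S.hasDerivAt_snd
    fun s hs ↦ by linarith [hpos' s hs]
  have hc : 0 < min (x η) (δ / 2) := lt_min (hpos η ⟨hη, le_rfl⟩) (half_pos h.δ_pos)
  have := h.le_fst_of_snd_nonneg S (s := η) (T := τ)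
    (fun s hs ↦ hyτ.trans (hanti ⟨hη.le.trans hs.1, hs.2⟩ ⟨hτ0.le, le_rfl⟩ hs.2))
    ⟨hc, (min_le_right _ _).trans_lt (half_lt_self h.δ_pos)⟩ (min_le_left _ _) τ ⟨hητ.le, le_rfl⟩
  linarith

end IsDamping

/-- A primitive of the excess of `a` over `G`, weighted by the position. -/
noncomputable def excess (G : ℝ → ℝ) (a s : ℝ) : ℝ := ∫ r in (0 : ℝ)..s, r * max (a - G r) 0

theorem IsDamping.hasDerivAt_excess (h : IsDamping G K δ a X M) (s : ℝ) :
    HasDerivAt (excess G a) (s * max (a - G s) 0) s := by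
  have hc : Continuous fun r ↦ r * max (a - G r) 0 :=
    continuous_id.mul ((continuous_const.sub h.contDiff.continuous).max continuous_const)
  exact intervalIntegral.integral_hasDerivAt_right (hc.intervalIntegrable _ _)
    (hc.stronglyMeasurableAtFilter _ _) hc.continuousAt

theorem IsDamping.excess_le (h : IsDamping G K δ a X M) {s : ℝ} (hs : 0 ≤ s) :
    excess G a s ≤ X * (a + M) * X := by
  have hM := h.a_pos.trans_le h.a_le
  have hC : 0 < X * (a + M) := mul_pos h.X_pos (by linarith [h.a_pos])
  have hle : ∀ r, 0 ≤ r → r ≤ X → excess G a r ≤ X * (a + M) * X := by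
    intro r hr hrX
    have hanti := antitoneOn_Icc_of_hasDerivAt_nonpos
      (u := fun r ↦ excess G a r - X * (a + M) * r) (a := 0) (b := X)
      (fun r ↦ (h.hasDerivAt_excess r).sub ((hasDerivAt_id r).const_mul (X * (a + M))))
      (fun q hq ↦ by
        have h1 : max (a - G q) 0 ≤ a + M :=
          max_le (by linarith [h.lower q hq.1.le]) (by linarith [h.a_pos])
        have : q * max (a - G q) 0 ≤ X * (a + M) := by
          gcongr
          · exact h.X_pos.le
          · exact hq.2.le
        linarith)
      ⟨le_rfl, hr.trans hrX⟩ ⟨hr, hrX⟩ hr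
    have h0 : excess G a 0 = 0 := by simp [excess]
    simp only [h0] at hanti
    have : X * (a + M) * r ≤ X * (a + M) * X := by gcongr
    linarith
  rcases le_total s X with hsX | hsX
  · exact hle s hs hsX
  · refine le_trans ?_ (hle X h.X_pos.le le_rfl)
    refine antitoneOn_Icc_of_hasDerivAt_nonpos (a := X) (b := s) h.hasDerivAt_excess
      (fun q hq ↦ ?_) ⟨le_rfl, hsX⟩ ⟨hsX, le_rfl⟩ hsX
    rw [max_eq_right (by linarith [h.le_right q hq.1.le]), mul_zero]

/-- A height beyond which passages through the half plane do not gain energy. -/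
noncomputable def passageBound (a X M : ℝ) : ℝ :=
  2 * M + X + 2 * (M + 1) + X * (a + M) * X / a

namespace IsPassage

theorem fst_nonneg (P : IsPassage G x y R τ) {t : ℝ} (ht : t ∈ Icc 0 τ) : 0 ≤ x t := by
  rcases ht.1.eq_or_lt with rfl | h0
  · exact P.fst_zero.ge
  rcases ht.2.eq_or_lt with rfl | h1
  · exact P.fst_end.ge
  exact (P.pos t ⟨h0, h1⟩).le

theorem left_mem (P : IsPassage G x y R τ) : (0 : ℝ) ∈ Icc 0 τ := ⟨le_rfl, P.τ_pos.le⟩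

theorem right_mem (P : IsPassage G x y R τ) : τ ∈ Icc 0 τ := ⟨P.τ_pos.le, le_rfl⟩

theorem antitoneOn_snd (P : IsPassage G x y R τ) : AntitoneOn y (Icc 0 τ) :=
  antitoneOn_Icc_of_hasDerivAt_nonpos P.hasDerivAt_snd fun t ht ↦ by linarith [P.pos t ht]

theorem antitoneOn_shifted_energy (P : IsPassage G x y R τ) (h : IsDamping G K δ a X M) :
    AntitoneOn (fun t ↦ x t ^ 2 + (y t + M) ^ 2) (Icc 0 τ) := by
  refine antitoneOn_Icc_of_hasDerivAt_nonpos
    (fun t ↦ ((P.hasDerivAt_fst t).pow 2).add (((P.hasDerivAt_snd t).add_const M).pow 2))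
    fun t ht ↦ ?_
  have h1 := P.pos t ht
  have h2 := mul_nonneg h1.le (by linarith [h.lower _ h1.le] : 0 ≤ G (x t) + M)
  simp only [Nat.cast_ofNat, Nat.add_one_sub_one, pow_one]
  nlinarith

theorem sq_add_sq_le (P : IsPassage G x y R τ) (h : IsDamping G K δ a X M) {t : ℝ}
    (ht : t ∈ Icc 0 τ) : x t ^ 2 + (y t + M) ^ 2 ≤ (R + M) ^ 2 := by
  have := P.antitoneOn_shifted_energy h P.left_mem ht ht.1
  simpa [P.fst_zero, P.snd_zero] using this

theorem abs_fst_le (P : IsPassage G x y R τ) (h : IsDamping G K δ a X M) {t : ℝ}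
    (ht : t ∈ Icc 0 τ) : |x t| ≤ R + M :=
  abs_le_of_sq_le_sq (by nlinarith [P.sq_add_sq_le h ht])
    (by linarith [P.R_pos, h.a_pos.trans_le h.a_le])

theorem neg_snd_end_le_add (P : IsPassage G x y R τ) (h : IsDamping G K δ a X M) :
    -y τ ≤ R + 2 * M := by
  have := abs_le_of_sq_le_sq (a := y τ + M) (b := R + M)
    (by nlinarith [P.sq_add_sq_le h P.right_mem, sq_nonneg (x τ)])
    (by linarith [P.R_pos, h.a_pos.trans_le h.a_le])
  linarith [(abs_le.1 this).1]

theorem min_le_neg_snd_end (P : IsPassage G x y R τ) (h : IsDamping G K δ a X M) :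
    min R δ ≤ -y τ := by
  refine le_of_forall_lt_imp_le_of_dense fun m hm ↦ ?_
  rcases le_or_gt m 0 with hm0 | hm0
  · linarith [P.snd_end]
  obtain ⟨hmR, hmδ⟩ := lt_min_iff.1 hm
  have key := image_le_of_deriv_right_lt_deriv_boundary
    (f := fun t ↦ -(x t ^ 2 + y t ^ 2)) (B := fun _ ↦ -m ^ 2) (B' := fun _ ↦ 0) (a := 0) (b := τ)
    ((P.continuous_fst.pow 2).add (P.continuous_snd.pow 2)).neg.continuousOn
    (fun t _ ↦ (((P.hasDerivAt_fst t).pow 2).add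
      ((P.hasDerivAt_snd t).pow 2)).neg.hasDerivWithinAt)
    (by simp only [P.fst_zero, P.snd_zero]; nlinarith) (fun t ↦ hasDerivAt_const t _)
    (fun t ht he ↦ by
      have he' : x t ^ 2 + y t ^ 2 = m ^ 2 := by
        linarith [show -(x t ^ 2 + y t ^ 2) = -m ^ 2 from he]
      rcases ht.1.eq_or_lt with rfl | h0
      · rw [P.fst_zero, P.snd_zero] at he'
        nlinarith
      have hx := P.pos t ⟨h0, ht.2⟩
      have hxm : x t ≤ m := abs_le_of_sq_le_sq' (by nlinarith) hm0.le |>.2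
      have := mul_pos_of_neg_of_neg (h.neg_of_mem _ ⟨hx, hxm.trans_lt hmδ⟩) (neg_lt_zero.2 hx)
      simp only [Nat.cast_ofNat, Nat.add_one_sub_one, pow_one]
      nlinarith) P.right_mem
  have := P.snd_end
  have hsq : m ^ 2 ≤ y τ ^ 2 := by simpa [P.fst_end] using key
  nlinarith

theorem neg_snd_end_le (P : IsPassage G x y R τ) (h : IsDamping G K δ a X M)
    (hR : passageBound a X M ≤ R) : -y τ ≤ R := by
  by_contra! hlt
  have ha := h.a_pos
  have hM := ha.trans_le h.a_le
  have hX := h.X_pos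
  set Ψ := X * (a + M) * X
  have hΨ0 : 0 ≤ Ψ := by positivity
  have hΨa : 0 ≤ Ψ / a := by positivity
  have hR' : 2 * M + X + 2 * (M + 1) + Ψ / a ≤ R := hR
  have hcont := P.continuous_snd.continuousOn (s := Icc 0 τ)
  obtain ⟨t₁, ht₁, hy₁⟩ : M + 1 ∈ y '' Icc 0 τ := by
    refine intermediate_value_Icc' P.τ_pos.le hcont ⟨by linarith, ?_⟩
    rw [P.snd_zero]; linarith
  obtain ⟨t₂, ht₂, hy₂⟩ : -(M + 1) ∈ y '' Icc 0 τ := by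
    refine intermediate_value_Icc' P.τ_pos.le hcont ⟨by linarith, ?_⟩
    rw [P.snd_zero]; linarith
  have ht₁₂ : t₁ ≤ t₂ := by
    by_contra! hlt
    linarith [P.antitoneOn_snd ht₂ ht₁ hlt.le]
  have hV (t : ℝ) : HasDerivAt (fun t ↦ (x t ^ 2 + y t ^ 2) / 2 - a * y t)
      (-x t * (G (x t) - a)) t :=
    (((((P.hasDerivAt_fst t).pow 2).add ((P.hasDerivAt_snd t).pow 2)).div_const 2).sub
      ((P.hasDerivAt_snd t).const_mul a)).congr_deriv (by norm_num; ring)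
  have hψ (t : ℝ) : HasDerivAt (fun t ↦ excess G a (x t))
      (x t * max (a - G (x t)) 0 * (y t - G (x t))) t :=
    (h.hasDerivAt_excess (x t)).comp t (P.hasDerivAt_fst t)
  have hupper := antitoneOn_Icc_of_hasDerivAt_nonpos (a := 0) (b := t₁)
    (fun t ↦ (hV t).sub (hψ t)) (fun t ht ↦ by
      have hx := P.pos t ⟨ht.1, ht.2.trans_le ht₁.2⟩
      have hy : M + 1 ≤ y t := hy₁ ▸ P.antitoneOn_snd ⟨ht.1.le, ht.2.le.trans ht₁.2⟩ ht₁ ht.2.le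
      rcases le_total a (G (x t)) with hG | hG
      · rw [max_eq_right (by linarith)]
        nlinarith
      · rw [max_eq_left (by linarith)]
        have := mul_nonneg (mul_nonneg hx.le (by linarith : 0 ≤ a - G (x t)))
          (by linarith [h.a_le] : 0 ≤ y t - G (x t) - 1)
        linarith) ⟨le_rfl, ht₁.1⟩ ⟨ht₁.1, le_rfl⟩ ht₁.1
  have hlower := antitoneOn_Icc_of_hasDerivAt_nonpos (a := t₂) (b := τ)
    (fun t ↦ (hV t).add (hψ t)) (fun t ht ↦ by
      have hx := P.pos t ⟨ht₂.1.trans_lt ht.1, ht.2⟩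
      have hy : y t ≤ -(M + 1) :=
        hy₂ ▸ P.antitoneOn_snd ht₂ ⟨ht₂.1.trans ht.1.le, ht.2.le⟩ ht.1.le
      have hlow := h.lower _ hx.le
      rcases le_total a (G (x t)) with hG | hG
      · rw [max_eq_right (by linarith)]
        nlinarith
      · rw [max_eq_left (by linarith)]
        have := mul_nonneg (mul_nonneg hx.le (by linarith : 0 ≤ a - G (x t)))
          (by linarith : 0 ≤ -(y t - G (x t)) - 1)
        linarith) ⟨le_rfl, ht₂.2⟩ ⟨ht₂.2, le_rfl⟩ ht₂.2
  have hmid := antitoneOn_Icc_of_hasDerivAt_nonpos (a := t₁) (b := t₂) hV (fun t ht ↦ by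
      have htm : t ∈ Icc 0 τ := ⟨ht₁.1.trans ht.1.le, ht.2.le.trans ht₂.2⟩
      have hx := P.pos t ⟨ht₁.1.trans_lt ht.1, ht.2.trans_le ht₂.2⟩
      have hy1 : y t ≤ M + 1 := hy₁ ▸ P.antitoneOn_snd ht₁ htm ht.1.le
      have hy2 : -(M + 1) ≤ y t := hy₂ ▸ P.antitoneOn_snd htm ht₂ ht.2.le
      have hE : x τ ^ 2 + (y τ + M) ^ 2 ≤ x t ^ 2 + (y t + M) ^ 2 :=
        P.antitoneOn_shifted_energy h htm P.right_mem htm.2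
      have hXx : X ≤ x t := by
        by_contra! hxX
        have h1 : x t ^ 2 < X ^ 2 := by gcongr
        have h2 : (y t + M) ^ 2 ≤ (2 * M + 1) ^ 2 := sq_le_sq' (by linarith) (by linarith)
        have h3 : (X + 2 * M + 1) ^ 2 ≤ (y τ + M) ^ 2 := by
          rw [← neg_sq (y τ + M)]
          gcongr
          linarith
        rw [P.fst_end] at hE
        nlinarith [mul_pos hX hM]
      have := h.le_right _ hXx
      nlinarith) ⟨le_rfl, ht₁₂⟩ ⟨ht₁₂, le_rfl⟩ ht₁₂
  have he0 : excess G a 0 = 0 := by simp [excess]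
  have he1 := h.excess_le (P.fst_nonneg ht₁)
  have he2 := h.excess_le (P.fst_nonneg ht₂)
  simp only [Pi.sub_apply, Pi.add_apply, P.fst_zero, P.snd_zero, P.fst_end, he0]
    at hupper hlower hmid
  have hRΨ : Ψ ≤ a * R := by
    have : Ψ / a ≤ R := by linarith
    rwa [div_le_iff₀ ha, mul_comm] at this
  have hsq : R ^ 2 < y τ ^ 2 := by nlinarith [P.R_pos]
  nlinarith

end IsPassage

/-- The exit height of a passage depends continuously on its entrance height. -/
theorem IsPassage.exists_snd_end_close (P : IsPassage G x y R τ) (h : IsDamping G K δ a X M)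
    {ε : ℝ} (hε : 0 < ε) : ∃ d > 0, ∀ R' x' y' τ', |R' - R| < d → IsPassage G x' y' R' τ' →
      |y' τ' - y τ| < ε := by
  have hGx : Continuous fun t ↦ y t - G (x t) :=
    P.continuous_snd.sub (h.contDiff.continuous.comp P.continuous_fst)
  have hR := P.R_pos
  have hstart : ∀ᶠ t in 𝓝 (0 : ℝ), R / 2 < y t - G (x t) :=
    hGx.continuousAt.eventually_const_lt
      (by simp only [P.fst_zero, P.snd_zero, h.map_zero]; linarith)
  have hend : ∀ᶠ t in 𝓝 τ, y t - G (x t) < 0 ∧ |y t - y τ| < ε / 2 :=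
    (hGx.continuousAt.eventually_lt_const
      (by simpa [P.fst_end, h.map_zero] using P.snd_end)).and
      (Metric.tendsto_nhds.1 P.continuous_snd.continuousAt _ (half_pos hε))
  obtain ⟨η₁, hη₁, hstart⟩ := Metric.eventually_nhds_iff.1 hstart
  obtain ⟨η₂, hη₂, hend⟩ := Metric.eventually_nhds_iff.1 hend
  simp only [Real.dist_eq] at hstart hend
  set s := η₁ / 2 with hs
  set r := η₂ / 2 with hr
  have hs0 : 0 < s := half_pos hη₁
  have hr0 : 0 < r := half_pos hη₂
  have hτ := P.τ_pos
  have hneg : x (τ + r) < 0 := by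
    have := strictMonoOn_Icc_of_hasDerivAt_pos (a := τ) (b := τ + r)
      (fun t ↦ (P.hasDerivAt_fst t).neg) (fun t ht ↦ by
        have := (hend (y := t) (by rw [abs_of_pos] <;> linarith [ht.1, ht.2])).1
        linarith) ⟨le_rfl, by linarith⟩ ⟨by linarith, le_rfl⟩ (by linarith : τ < τ + r)
    simpa [P.fst_end] using this
  obtain ⟨m, hm0, hm⟩ := isCompact_Icc.exists_forall_le' (s := Icc s (τ - r))
    P.continuous_fst.continuousOn (a := 0)
    (fun t ht ↦ P.pos t ⟨hs0.trans_le ht.1, by linarith [ht.2]⟩)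
  set E := Real.exp ((K + 1) * (τ + r + s))
  have hK : (0 : ℝ) ≤ K := K.coe_nonneg
  set c := min (min (R / 2 / (1 + K)) m) (min (-x (τ + r)) (ε / 2)) with hc
  have hc0 : 0 < c := lt_min (lt_min (by positivity) hm0) (lt_min (by linarith) (half_pos hε))
  refine ⟨c / E, by positivity, fun R' x' y' τ' hRR P' ↦ ?_⟩
  rw [lt_div_iff₀ (Real.exp_pos _)] at hRR
  obtain ⟨⟨hc1, hc2⟩, hc3, hc4⟩ : ((|R' - R| * E < R / 2 / (1 + K) ∧ |R' - R| * E < m) ∧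
      |R' - R| * E < -x (τ + r) ∧ |R' - R| * E < ε / 2) := by
    simpa only [hc, lt_min_iff] using hRR
  have hclose {t : ℝ} (ht0 : 0 ≤ t) (ht : t ≤ τ + r + s) :
      |x' t - x t| ≤ |R' - R| * E ∧ |y' t - y t| ≤ |R' - R| * E := by
    simpa only [P.snd_zero, P'.snd_zero] using
      h.sol_close P'.toIsLienardSol P.toIsLienardSol (by rw [P.fst_zero, P'.fst_zero]) ⟨ht0, ht⟩
  have hpos : ∀ t ∈ Ioo 0 s, 0 < y' t - G (x' t) := by
    intro t ht
    obtain ⟨h1, h2⟩ := hclose ht.1.le (by linarith [ht.2])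
    have h3 : |G (x' t) - G (x t)| ≤ K * |x' t - x t| := h.lipschitz.dist_le_mul _ _
    have h4 : (K : ℝ) * |x' t - x t| ≤ K * (|R' - R| * E) := by gcongr
    have h5 := hstart (y := t) (by rw [sub_zero, abs_of_pos ht.1]; linarith [ht.2])
    rw [lt_div_iff₀ (by positivity)] at hc1
    linarith [neg_abs_le (y' t - y t), le_abs_self (G (x' t) - G (x t))]
  have hmono := strictMonoOn_Icc_of_hasDerivAt_pos P'.hasDerivAt_fst hpos
  have hsτ' : s < τ' := by
    by_contra! hle
    have := hmono ⟨le_rfl, hs0.le⟩ ⟨P'.τ_pos.le, hle⟩ P'.τ_pos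
    rw [P'.fst_zero, P'.fst_end] at this
    exact this.false
  have hτ'τ : τ' ≤ τ + r := by
    by_contra! hlt
    have h1 := P'.pos (τ + r) ⟨by linarith, hlt⟩
    have h2 := (hclose (t := τ + r) (by linarith) (by linarith)).1
    linarith [le_abs_self (x' (τ + r) - x (τ + r))]
  obtain ⟨h1, h2⟩ := hclose P'.τ_pos.le (by linarith)
  have hττ' : τ - r < τ' := by
    by_contra! hle
    have h3 := hm τ' ⟨hsτ'.le, hle⟩
    rw [P'.fst_end] at h1
    linarith [neg_abs_le (0 - x τ')]
  have h3 := (hend (y := τ') (abs_lt.2 ⟨by linarith, by linarith⟩)).2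
  linarith [abs_sub_le (y' τ') (y τ') (y τ)]

theorem IsDamping.exists_halfMap (h : IsDamping G K δ a X M) :
    ∃ H : ℝ → ℝ, ContinuousOn H (Ioi 0) ∧
      ∀ R > 0, ∃ x y τ, IsPassage G x y R τ ∧ y τ = -H R := by
  choose! x y τ hP using fun (R : ℝ) (hR : 0 < R) ↦ h.exists_passage hR
  refine ⟨fun R ↦ -y R (τ R), fun R hR ↦ ?_, fun R hR ↦ ⟨x R, y R, τ R, hP R hR, by simp⟩⟩
  refine ContinuousWithinAt.neg (Metric.continuousWithinAt_iff.2 fun ε hε ↦ ?_)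
  obtain ⟨d, hd, hclose⟩ := (hP R hR).exists_snd_end_close h hε
  exact ⟨d, hd, fun r hr hrd ↦ hclose _ _ _ _ hrd (hP r hr)⟩

/-- A damping admits a periodic orbit, with an explicit bound on its extension. -/
theorem IsDamping.exists_periodic (h : IsDamping G K δ a X M) :
    ∃ x y T, IsLienardSol G x y ∧ 0 < T ∧ (∀ t, x (t + T) = x t ∧ y (t + T) = y t) ∧
      (∀ t, |x t| ≤ passageBound a X M + 5 * M + δ) ∧
      ∃ t₁ t₂, x t₁ = 0 ∧ x t₂ = 0 ∧ y t₁ ≠ y t₂ := by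
  obtain ⟨H, hH, hHP⟩ := h.exists_halfMap
  obtain ⟨H', hH', hHP'⟩ := h.reflect.exists_halfMap
  have hδ := h.δ_pos
  have hM := h.a_pos.trans_le h.a_le
  have ha := h.a_pos
  have hX := h.X_pos
  set R₀ := passageBound a X M + 2 * M + δ
  have hpb : 0 < passageBound a X M := by unfold passageBound; positivity
  have hδR₀ : δ ≤ R₀ := by linarith
  have hbounds (R : ℝ) (hR : 0 < R) :
      min R δ ≤ H R ∧ H R ≤ R + 2 * M ∧ (passageBound a X M ≤ R → H R ≤ R) := by
    obtain ⟨x, y, τ, P, hy⟩ := hHP R hR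
    rw [← neg_eq_iff_eq_neg] at hy
    rw [← hy]
    exact ⟨P.min_le_neg_snd_end h, P.neg_snd_end_le_add h, P.neg_snd_end_le h⟩
  have hbounds' (R : ℝ) (hR : 0 < R) :
      min R δ ≤ H' R ∧ H' R ≤ R + 2 * M ∧ (passageBound a X M ≤ R → H' R ≤ R) := by
    obtain ⟨x, y, τ, P, hy⟩ := hHP' R hR
    rw [← neg_eq_iff_eq_neg] at hy
    rw [← hy]
    exact ⟨P.min_le_neg_snd_end h.reflect, P.neg_snd_end_le_add h.reflect,
      P.neg_snd_end_le h.reflect⟩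
  have hHδ (R : ℝ) (hR : δ ≤ R) : δ ≤ H R := by
    simpa [hR] using (hbounds R (hδ.trans_le hR)).1
  have hHδ' (R : ℝ) (hR : δ ≤ R) : δ ≤ H' R := by
    simpa [hR] using (hbounds' R (hδ.trans_le hR)).1
  have hpos : ∀ R ∈ Icc δ R₀, R ∈ Ioi (0 : ℝ) := fun R hR ↦ hδ.trans_le hR.1
  have hcont : ContinuousOn (fun R ↦ H' (H R)) (Icc δ R₀) :=
    hH'.comp (hH.mono hpos) fun R hR ↦ hδ.trans_le (hHδ R hR.1)
  have hΦR₀ : H' (H R₀) ≤ R₀ := by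
    have h1 := hHδ R₀ hδR₀
    have h2 := (hbounds R₀ (by linarith)).2.2 (by linarith)
    obtain ⟨-, h3, h4⟩ := hbounds' (H R₀) (by linarith)
    rcases le_total (passageBound a X M) (H R₀) with hle | hle
    · exact (h4 hle).trans h2
    · linarith
  obtain ⟨R, hRmem, hfix⟩ : ∃ R ∈ Icc δ R₀, H' (H R) - R = 0 :=
    intermediate_value_Icc' hδR₀ (hcont.sub continuousOn_id)
      ⟨by simpa using hΦR₀, by simpa using hHδ' _ (hHδ δ le_rfl)⟩
  have hR : 0 < R := hpos R hRmem
  have hr : 0 < H R := hδ.trans_le (hHδ R hRmem.1)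
  obtain ⟨x, y, τ, P, hy⟩ := hHP R hR
  obtain ⟨u, v, σ, Q, hv⟩ := hHP' (H R) hr
  have hglue (t : ℝ) : x (t + τ) = -u t ∧ y (t + τ) = -v t :=
    h.sol_unique (P.toIsLienardSol.shift τ) Q.toIsLienardSol.neg_reflect (t₀ := 0)
      (by simp [P.fst_end, Q.fst_zero]) (by simp [hy, Q.snd_zero]) t
  have hper (t : ℝ) : x (t + (σ + τ)) = x t ∧ y (t + (σ + τ)) = y t :=
    h.sol_unique (P.toIsLienardSol.shift (σ + τ)) P.toIsLienardSol (t₀ := 0)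
      (by simp [(hglue σ).1, P.fst_zero, Q.fst_end])
      (by simp only [zero_add, (hglue σ).2, P.snd_zero, hv]; linarith) t
  have hσ := Q.τ_pos
  have hτ := P.τ_pos
  refine ⟨x, y, σ + τ, P.toIsLienardSol, by linarith, hper, fun t ↦ ?_, 0, τ, P.fst_zero,
    P.fst_end, ?_⟩
  · obtain ⟨s, hs, hst⟩ := Function.Periodic.exists_mem_Ico₀ (f := x) (fun t ↦ (hper t).1)
      (by linarith : 0 < σ + τ) t
    rw [hst]
    rcases le_total s τ with hsτ | hsτ
    · linarith [P.abs_fst_le h ⟨hs.1, hsτ⟩, hRmem.2]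
    · have := Q.abs_fst_le h.reflect (t := s - τ) ⟨by linarith, by linarith [hs.2]⟩
      have hxs := (hglue (s - τ)).1
      rw [sub_add_cancel] at hxs
      rw [hxs, abs_neg]
      linarith [(hbounds R hR).2.1, hRmem.2]
  · rw [P.snd_zero]
    exact (P.snd_end.trans hR).ne'

theorem neg_of_isPreconnected {f : ℝ → ℝ} {s : Set ℝ} (hs : IsPreconnected s)
    (hf : Continuous f) (h0 : ∀ x ∈ s, f x ≠ 0) {c : ℝ} (hc : c ∈ s) (hfc : f c < 0) :
    ∀ x ∈ s, f x < 0 := by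
  intro x hx
  by_contra! hle
  obtain ⟨z, hz, hfz⟩ := hs.intermediate_value hc hx hf.continuousOn ⟨hfc.le, hle⟩
  exact h0 z hz hfz

/-- A primitive of a function with the sign pattern `+ - +` and suitable levels is a damping. -/
theorem isDamping_of_hasDerivAt {G g : ℝ → ℝ} {K : ℝ≥0} {xM xm x₁ x₂ p q : ℝ}
    (hG : ∀ x, HasDerivAt G (g x) x) (hg : Continuous g) (hK : ∀ x, |g x| ≤ K) (hG0 : G 0 = 0)
    (hxM : xM < 0) (hxm : 0 < xm) (hx₁ : x₁ < xM) (hx₂ : xm < x₂)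
    (hmid : ∀ x ∈ Ioo xM xm, g x < 0) (hleft : ∀ x < xM, 0 < g x) (hright : ∀ x > xm, 0 < g x)
    (hp : G xM = p) (hp₂ : G x₂ = p) (hq : G xm = q) (hq₁ : G x₁ = q) :
    IsDamping G K (min (-xM) xm) (min p (-q)) (max x₂ (-x₁)) (max p (-q)) := by
  have hder : deriv G = g := funext fun x ↦ (hG x).deriv
  have hanti : StrictMonoOn (fun x ↦ -G x) (Icc xM xm) :=
    strictMonoOn_Icc_of_hasDerivAt_pos (fun t ↦ (hG t).neg) fun t ht ↦ by linarith [hmid t ht]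
  have hanti {s t : ℝ} (hs : xM ≤ s) (hst : s < t) (ht : t ≤ xm) : G t < G s :=
    neg_lt_neg_iff.1 (hanti ⟨hs, hst.le.trans ht⟩ ⟨hs.trans hst.le, ht⟩ hst)
  have hmonoL {s t : ℝ} (hst : s ≤ t) (ht : t ≤ xM) : G s ≤ G t :=
    (strictMonoOn_Icc_of_hasDerivAt_pos hG fun r hr ↦ hleft r (hr.2.trans_le ht)).monotoneOn
      ⟨le_rfl, hst⟩ ⟨hst, le_rfl⟩ hst
  have hmonoR {s t : ℝ} (hs : xm ≤ s) (hst : s ≤ t) : G s ≤ G t :=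
    (strictMonoOn_Icc_of_hasDerivAt_pos hG fun r hr ↦ hright r (hs.trans_lt hr.1)).monotoneOn
      ⟨le_rfl, hst⟩ ⟨hst, le_rfl⟩ hst
  have hp0 : 0 < p := by linarith [hanti le_rfl hxM hxm.le]
  have hq0 : q < 0 := by linarith [hanti hxM.le hxm le_rfl]
  refine ⟨contDiff_one_iff_deriv.2 ⟨fun x ↦ (hG x).differentiableAt, hder ▸ hg⟩,
    lipschitzWith_of_nnnorm_deriv_le (fun x ↦ (hG x).differentiableAt) fun x ↦ ?_, hG0,
    by simp [hxM, hxm], by simp [hp0, hq0], by simp [hxm.trans hx₂],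
    min_le_max, fun x hx ↦ ?_, fun x hx ↦ ?_, fun x hx ↦ ?_, fun x hx ↦ ?_, fun x hx ↦ ?_,
    fun x hx ↦ ?_⟩
  · rw [hder, ← NNReal.coe_le_coe]
    exact hK x
  · linarith [hanti hxM.le hx.1 (hx.2.le.trans (min_le_right _ _))]
  · linarith [hanti (by linarith [hx.1, min_le_left (-xM) xm]) hx.2 hxm.le]
  · exact (min_le_left _ _).trans (hp₂ ▸ hmonoR hx₂.le ((le_max_left _ _).trans hx))
  · have := hmonoL (s := x) (t := x₁) (by linarith [le_max_right x₂ (-x₁)]) hx₁.le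
    linarith [min_le_right p (-q)]
  · have : q ≤ G x := by
      rcases lt_or_ge x xm with h | h
      · exact hq ▸ (hanti (hxM.le.trans hx) h le_rfl).le
      · exact hq ▸ hmonoR le_rfl h
    linarith [le_max_right p (-q)]
  · have : G x ≤ p := by
      rcases lt_or_ge xM x with h | h
      · exact hp ▸ (hanti le_rfl h (hx.trans hxm.le)).le
      · exact hp ▸ hmonoL h le_rfl
    exact this.trans (le_max_left _ _)

end Lienard

theorem lienard_periodic_exists (f : ℝ → ℝ) (xM xm : ℝ)
    (hf : ContDiff ℝ 2 f)
    (hxM : xM < 0) (hxm : 0 < xm)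
    (hfxM : f xM = 0) (hfxm : f xm = 0)
    (hzeros : ∀ x, f x = 0 → x = xM ∨ x = xm)
    (hdM : deriv f xM < 0) (hdm : 0 < deriv f xm)
    (F : ℝ → ℝ) (hF : ∀ x, F x = ∫ s in (0:ℝ)..x, f s)
    (x₁ x₂ : ℝ) (hx₁ : x₁ < xM) (hx₂ : xm < x₂)
    (hFx₁ : F x₁ = F xm) (hFx₂ : F x₂ = F xM) :
    ∀ lam : ℝ, 0 < lam →
      ∃ (x y : ℝ → ℝ) (T : ℝ), 0 < T ∧
        (∀ t, x (t + T) = x t ∧ y (t + T) = y t) ∧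
        (∀ t, HasDerivAt x (y t) t) ∧
        (∀ t, HasDerivAt y (-(x t) - lam * f (x t) * y t) t) ∧
        (∃ t₁ t₂, (x t₁, y t₁) ≠ (x t₂, y t₂)) := by
  intro lam hlam
  have hfc : Continuous f := hf.continuous
  have hleft : ∀ x < xM, 0 < f x := by
    obtain ⟨c, hc, hc'⟩ := ((eventually_nhdsWithin_sign_eq_of_deriv_neg hdM hfxM).filter_mono
      nhdsWithin_le_nhds |>.and (self_mem_nhdsWithin (a := xM) (s := Iio xM))).exists
    have := neg_of_isPreconnected isPreconnected_Iio hfc.neg (fun x (hx : x < xM) h0 ↦ by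
      rcases hzeros x (neg_eq_zero.1 h0) with rfl | rfl <;> linarith) hc'
      (neg_lt_zero.2 (by
        rwa [sign_pos (sub_pos.2 hc'), sign_eq_one_iff] at hc))
    exact fun x hx ↦ neg_lt_zero.1 (this x hx)
  have hmid : ∀ x ∈ Ioo xM xm, f x < 0 := by
    obtain ⟨c, hc, hc'⟩ := ((eventually_nhdsWithin_sign_eq_of_deriv_neg hdM hfxM).filter_mono
      nhdsWithin_le_nhds |>.and (Ioo_mem_nhdsGT (hxM.trans hxm))).exists
    refine neg_of_isPreconnected isPreconnected_Ioo hfc (fun x hx h0 ↦ by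
      rcases hzeros x h0 with rfl | rfl <;> linarith [hx.1, hx.2]) hc' ?_
    rwa [sign_neg (sub_neg.2 hc'.1), sign_eq_neg_one_iff] at hc
  have hright : ∀ x > xm, 0 < f x := by
    obtain ⟨c, hc, hc'⟩ := ((eventually_nhdsWithin_sign_eq_of_deriv_pos hdm hfxm).filter_mono
      nhdsWithin_le_nhds |>.and (self_mem_nhdsWithin (a := xm) (s := Ioi xm))).exists
    have := neg_of_isPreconnected isPreconnected_Ioi hfc.neg (fun x (hx : xm < x) h0 ↦ by
      rcases hzeros x (neg_eq_zero.1 h0) with rfl | rfl <;> linarith) hc'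
      (neg_lt_zero.2 (by
        rwa [sign_pos (sub_pos.2 hc'), sign_eq_one_iff] at hc))
    exact fun x hx ↦ neg_lt_zero.1 (this x hx)
  set a := min (lam * F xM) (-(lam * F xm))
  set M := max (lam * F xM) (-(lam * F xm))
  set X := max x₂ (-x₁)
  set δ := min (-xM) xm
  set C := max (passageBound a X M + 5 * M + δ) X
  have hXC : X ≤ C := le_max_right _ _
  have hx₂C : x₂ ≤ C := (le_max_left _ _).trans hXC
  have hx₁C : -x₁ ≤ C := (le_max_right _ _).trans hXC
  set g : ℝ → ℝ := fun s ↦ lam * f (max (-C) (min s C)) with hg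
  have hgc : Continuous g := by fun_prop
  have hgeq {s : ℝ} (hs : |s| ≤ C) : g s = lam * f s := by
    obtain ⟨h1, h2⟩ := abs_le.1 hs
    simp [hg, h1, h2]
  set G : ℝ → ℝ := fun x ↦ ∫ s in (0:ℝ)..x, g s with hG
  have hGd (x : ℝ) : HasDerivAt G (g x) x := hgc.integral_hasStrictDerivAt 0 x |>.hasDerivAt
  have hGeq {x : ℝ} (hx : |x| ≤ C) : G x = lam * F x := by
    rw [hF, ← intervalIntegral.integral_const_mul]
    refine intervalIntegral.integral_congr fun s hs ↦ hgeq ?_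
    have := abs_sub_left_of_mem_uIcc hs
    simp only [sub_zero] at this
    exact this.trans hx
  obtain ⟨K, hK⟩ := (isCompact_Icc (a := -C) (b := C)).exists_bound_of_continuousOn
    (hfc.const_mul lam).continuousOn
  have hC0 : 0 < C := by linarith
  have hcl (s : ℝ) : max (-C) (min s C) ∈ Icc (-C) C :=
    ⟨le_max_left _ _, max_le (by linarith) (min_le_right _ _)⟩
  have hD : IsDamping G K.toNNReal δ a X M := by
    refine isDamping_of_hasDerivAt hGd hgc (fun s ↦ (hK _ (hcl s)).trans (Real.le_coe_toNNReal K))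
      (by simp [hG]) hxM hxm hx₁ hx₂ (fun s hs ↦ mul_neg_of_pos_of_neg hlam (hmid _ ?_))
      (fun s hs ↦ mul_pos hlam (hleft _ ?_)) (fun s hs ↦ mul_pos hlam (hright _ ?_))
      (hGeq (abs_le.2 ⟨?_, ?_⟩)) (hFx₂ ▸ hGeq (abs_le.2 ⟨?_, ?_⟩)) (hGeq (abs_le.2 ⟨?_, ?_⟩))
      (hFx₁ ▸ hGeq (abs_le.2 ⟨?_, ?_⟩))
    · rw [min_eq_left (by linarith [hs.2]), max_eq_right (by linarith [hs.1])]
      exact hs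
    · exact max_lt (by linarith) ((min_le_left _ _).trans_lt hs)
    · exact (lt_min hs (by linarith)).trans_le (le_max_right _ _)
    all_goals linarith
  obtain ⟨x, y, T, S, hT, hper, hbd, t₁, t₂, h1, h2, hne⟩ := hD.exists_periodic
  refine ⟨x, fun t ↦ y t - G (x t), T, hT, fun t ↦ ?_, S.hasDerivAt_fst, fun t ↦ ?_, t₁, t₂, ?_⟩
  · simp [(hper t).1, (hper t).2]
  · have := (S.hasDerivAt_snd t).sub ((hGd (x t)).comp t (S.hasDerivAt_fst t))
    rwa [hgeq ((hbd t).trans (le_max_left _ _))] at this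
  · simpa [h1, h2] using hne
end

section
/- (Dragilëv's theorem.) Let f, g : ℝ → ℝ with f continuous and g locally Lipschitz, and set F(x) = ∫₀ˣ f(s) ds and G(x) = ∫₀ˣ g(s) ds. Suppose: (B2) x g(x) > 0 for every x ≠ 0, and G(x) → +∞ as x → +∞ and as x → −∞; (B3) there exist a₁ < 0 < a₂ such that F(x) > 0 for a₁ ≤ x < 0 and F(x) < 0 for 0 < x ≤ a₂; (B4) there exist k > max{−a₁, a₂} and b₁ < b₂ such that F(x) ≤ b₁ for all x < −k and F(x) ≥ b₂ for all x > k. Then the system x' = y, y' = −g(x) − f(x) y has at least one nonconstant periodic solution, i.e., there exist T > 0 and a nonconstant C¹ map γ = (x, y) : ℝ → ℝ² with γ(t + T) = γ(t), x'(t) = y(t) and y'(t) = −g(x(t)) − f(x(t)) y(t) for all t. -/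
open Filter

open Set Topology

/-- The retraction of `ℝ` onto `[-R, R]`. -/
def clamp (R x : ℝ) : ℝ := max (-R) (min R x)

lemma lipschitzWith_clamp (R : ℝ) : LipschitzWith 1 (clamp R) :=
  (LipschitzWith.id.const_min R).const_max (-R)

lemma clamp_mem {R : ℝ} (hR : 0 ≤ R) (x : ℝ) : clamp R x ∈ Icc (-R) R :=
  ⟨le_max_left _ _, max_le (by linarith) (min_le_left _ _)⟩

lemma clamp_of_mem {R x : ℝ} (hx : x ∈ Icc (-R) R) : clamp R x = x := by
  simp [clamp, hx.1, hx.2]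

lemma clamp_of_le {R x : ℝ} (hR : 0 ≤ R) (hx : R ≤ x) : clamp R x = R := by
  rw [clamp, min_eq_left hx, max_eq_right (by linarith)]

lemma clamp_neg {R : ℝ} (hR : 0 ≤ R) (x : ℝ) : clamp R (-x) = -clamp R x := by
  unfold clamp
  rcases le_total R x with h | h <;> rcases le_total (-R) x with h' | h' <;> grind

/-- The pair `(x, y)` solves the Liénard system `x' = y - F x`, `y' = -g x` on `ℝ`. -/
def IsLienardSol_s10 (F g x y : ℝ → ℝ) : Prop :=
  ∀ t, HasDerivAt x (y t - F (x t)) t ∧ HasDerivAt y (-g (x t)) t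

namespace IsLienardSol_s10

variable {F g x y : ℝ → ℝ}

lemma continuous_fst_s10 (h : IsLienardSol_s10 F g x y) : Continuous x :=
  continuous_iff_continuousAt.2 fun t ↦ (h t).1.continuousAt

lemma continuous_snd_s10 (h : IsLienardSol_s10 F g x y) : Continuous y :=
  continuous_iff_continuousAt.2 fun t ↦ (h t).2.continuousAt

lemma comp_add (h : IsLienardSol_s10 F g x y) (s : ℝ) :
    IsLienardSol_s10 F g (fun t ↦ x (t + s)) (fun t ↦ y (t + s)) :=
  fun t ↦ ⟨(h (t + s)).1.comp_add_const t s, (h (t + s)).2.comp_add_const t s⟩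

lemma neg (h : IsLienardSol_s10 (fun s ↦ -F (-s)) (fun s ↦ -g (-s)) x y) :
    IsLienardSol_s10 F g (fun t ↦ -x t) (fun t ↦ -y t) :=
  fun t ↦ ⟨(h t).1.fun_neg.congr_deriv (by ring), (h t).2.fun_neg.congr_deriv (by ring)⟩

end IsLienardSol_s10

lemma lipschitzWith_lienard {F g : ℝ → ℝ} {KF Kg : NNReal} (hF : LipschitzWith KF F)
    (hg : LipschitzWith Kg g) {h : ℝ → ℝ} (hh : LipschitzWith 1 h) :
    LipschitzWith (max (1 * 1 + KF * 1) (Kg * 1))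
      (fun p : ℝ × ℝ ↦ (h p.2 - F p.1, -g p.1)) :=
  ((hh.comp LipschitzWith.prod_snd).sub (hF.comp LipschitzWith.prod_fst)).prodMk
    (hg.comp LipschitzWith.prod_fst).neg

lemma IsLienardSol_s10.unique {F g x y x' y' : ℝ → ℝ} {KF Kg : NNReal} (hF : LipschitzWith KF F)
    (hg : LipschitzWith Kg g) (h : IsLienardSol_s10 F g x y) (h' : IsLienardSol_s10 F g x' y') {s : ℝ}
    (hx : x s = x' s) (hy : y s = y' s) : x = x' ∧ y = y' := by
  have := ODE_solution_unique_univ (v := fun _ (p : ℝ × ℝ) ↦ (p.2 - F p.1, -g p.1))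
    (s := fun _ ↦ univ) (f := fun t ↦ (x t, y t)) (g := fun t ↦ (x' t, y' t)) (t₀ := s)
    (fun _ ↦ (lipschitzWith_lienard hF hg LipschitzWith.id).lipschitzOnWith)
    (fun t ↦ ⟨(h t).1.prodMk (h t).2, trivial⟩) (fun t ↦ ⟨(h' t).1.prodMk (h' t).2, trivial⟩)
    (by simp [hx, hy])
  exact ⟨funext fun t ↦ congrArg Prod.fst (congrFun this t),
    funext fun t ↦ congrArg Prod.snd (congrFun this t)⟩

/-- Solutions on `[0, ∞)` depend on the initial point in a Lipschitz way, locally uniformly in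
time. -/
lemma IsLienardSol_s10.exists_dist_le {F g : ℝ → ℝ} {KF Kg : NNReal} (hF : LipschitzWith KF F)
    (hg : LipschitzWith Kg g) : ∃ K : ℝ, ∀ x y x' y' : ℝ → ℝ, IsLienardSol_s10 F g x y →
      IsLienardSol_s10 F g x' y' → ∀ t, 0 ≤ t →
      dist (x t, y t) (x' t, y' t) ≤ dist (x 0, y 0) (x' 0, y' 0) * Real.exp (K * t) := by
  refine ⟨(max (1 * 1 + KF * 1) (Kg * 1) : NNReal), fun x y x' y' h h' t ht ↦ ?_⟩
  have := dist_le_of_trajectories_ODE (v := fun _ (p : ℝ × ℝ) ↦ (p.2 - F p.1, -g p.1))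
    (f := fun t ↦ (x t, y t)) (g := fun t ↦ (x' t, y' t)) (a := 0) (b := t)
    (fun _ ↦ lipschitzWith_lienard hF hg LipschitzWith.id)
    (h.continuous_fst_s10.prodMk h.continuous_snd_s10).continuousOn
    (fun t _ ↦ ((h t).1.prodMk (h t).2).hasDerivWithinAt)
    (h'.continuous_fst_s10.prodMk h'.continuous_snd_s10).continuousOn
    (fun t _ ↦ ((h' t).1.prodMk (h' t).2).hasDerivWithinAt) le_rfl t ⟨ht, le_rfl⟩
  rwa [sub_zero] at this

/-- Solutions on bounded intervals, for bounded Lipschitz `F` and `g`. -/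
lemma exists_lienard_local {F g : ℝ → ℝ} {KF Kg : NNReal} {C : ℝ} (hF : LipschitzWith KF F)
    (hg : LipschitzWith Kg g) (hFC : ∀ x, |F x| ≤ C) (hgC : ∀ x, |g x| ≤ C) (p : ℝ × ℝ) {N : ℝ}
    (hN : 0 < N) : ∃ γ : ℝ → ℝ × ℝ, γ 0 = p ∧
      ∀ t ∈ Ioo (-N) N, HasDerivAt γ ((γ t).2 - F (γ t).1, -g (γ t).1) t := by
  have hC : 0 ≤ C := (abs_nonneg _).trans (hFC 0)
  set R : ℝ := |p.2| + C * N with hRdef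
  have hR : 0 ≤ R := by positivity
  set v : ℝ × ℝ → ℝ × ℝ := fun q ↦ (clamp R q.2 - F q.1, -g q.1)
  have hv := lipschitzWith_lienard hF hg (lipschitzWith_clamp R)
  set L : NNReal := ⟨R + C, by positivity⟩
  have hL : ∀ q, ‖v q‖ ≤ L := by
    intro q
    have h1 := clamp_mem hR q.2
    have h2 := abs_le.1 (hFC q.1)
    have h3 := hgC q.1
    refine norm_prod_le_iff.2 ⟨?_, ?_⟩
    · change |clamp R q.2 - F q.1| ≤ R + C
      exact abs_le.2 ⟨by linarith [h1.1], by linarith [h1.2]⟩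
    · change |-g q.1| ≤ R + C
      rw [abs_neg]; linarith
  have hpl : IsPicardLindelof (fun _ ↦ v) (tmin := -N) (tmax := N) ⟨0, by simp [hN.le]⟩ p
      (L * N.toNNReal) 0 L _ :=
    IsPicardLindelof.of_time_independent (fun q _ ↦ hL q) hv.lipschitzOnWith
      (by simp [hN.le])
  obtain ⟨γ, hγ0, hγ⟩ := hpl.exists_eq_forall_mem_Icc_hasDerivWithinAt₀
  have h0 : (0 : ℝ) ∈ Icc (-N) N := by simp [hN.le]
  refine ⟨γ, hγ0, fun t ht ↦ ?_⟩
  have hy : |(γ t).2 - p.2| ≤ C * |t| := by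
    have := (convex_Icc (-N) N).norm_image_sub_le_of_norm_hasDerivWithin_le
      (f := fun s ↦ (γ s).2) (f' := fun s ↦ -g (γ s).1) (C := C)
      (fun s hs ↦ (hγ s hs).snd)
      (fun s _ ↦ by simpa using hgC _) h0 (Ioo_subset_Icc_self ht)
    simpa [hγ0] using this
  have hR' : (γ t).2 ∈ Icc (-R) R := by
    have h1 : C * |t| ≤ C * N := by gcongr; exact abs_le.2 ⟨ht.1.le, ht.2.le⟩
    have h2 := abs_le.1 (hy.trans h1)
    have h3 := abs_le.1 (le_refl |p.2|)
    exact ⟨by linarith, by linarith⟩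
  have := (hγ t (Ioo_subset_Icc_self ht)).hasDerivAt (Icc_mem_nhds ht.1 ht.2)
  simpa [v, clamp_of_mem hR'] using this

lemma exists_isLienardSol {F g : ℝ → ℝ} {KF Kg : NNReal} {C : ℝ} (hF : LipschitzWith KF F)
    (hg : LipschitzWith Kg g) (hFC : ∀ x, |F x| ≤ C) (hgC : ∀ x, |g x| ≤ C) (a b : ℝ) :
    ∃ x y, IsLienardSol_s10 F g x y ∧ x 0 = a ∧ y 0 = b := by
  choose γ hγ0 hγ using fun n : ℕ ↦ exists_lienard_local hF hg hFC hgC (a, b)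
    (N := n + 1) (by positivity)
  have key : ∀ m n : ℕ, m ≤ n → EqOn (γ m) (γ n) (Ioo (-(m + 1)) (m + 1)) := by
    intro m n hmn
    have hmn' : (m : ℝ) ≤ n := by exact_mod_cast hmn
    refine ODE_solution_unique_of_mem_Ioo (v := fun _ (p : ℝ × ℝ) ↦ (p.2 - F p.1, -g p.1))
      (s := fun _ ↦ univ)
      (fun _ _ ↦ (lipschitzWith_lienard hF hg LipschitzWith.id).lipschitzOnWith)
      (t₀ := 0) ⟨by linarith [m.cast_nonneg (α := ℝ)], by positivity⟩
      (fun t ht ↦ ⟨hγ m t ht, trivial⟩)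
      (fun t ht ↦ ⟨hγ n t ⟨by linarith [ht.1], by linarith [ht.2]⟩, trivial⟩) ?_
    rw [hγ0, hγ0]
  set Γ : ℝ → ℝ × ℝ := fun t ↦ γ ⌈|t|⌉₊ t
  have hΓ : ∀ n : ℕ, EqOn Γ (γ n) (Ioo (-(n + 1)) (n + 1)) := by
    intro n t ht
    have h1 := Nat.le_ceil |t|
    have h2 := abs_le.1 h1
    rcases le_total ⌈|t|⌉₊ n with h | h
    · exact key _ _ h ⟨by linarith, by linarith⟩
    · exact (key _ _ h ht).symm
  have hd : ∀ t, HasDerivAt Γ ((Γ t).2 - F (Γ t).1, -g (Γ t).1) t := by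
    intro t
    have h2 := abs_le.1 (Nat.le_ceil |t|)
    have ht : t ∈ Ioo (-((⌈|t|⌉₊ : ℝ) + 1)) (⌈|t|⌉₊ + 1) := ⟨by linarith, by linarith⟩
    exact (hγ ⌈|t|⌉₊ t ht).congr_of_eventuallyEq
      ((hΓ ⌈|t|⌉₊).eventuallyEq_of_mem (Ioo_mem_nhds ht.1 ht.2))
  have h00 : Γ 0 = (a, b) := hγ0 _
  exact ⟨fun t ↦ (Γ t).1, fun t ↦ (Γ t).2,
    fun t ↦ ⟨(hd t).fst, (hd t).snd⟩,
    by simp [h00], by simp [h00]⟩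

lemma le_of_hasDerivAt_nonpos {φ φ' : ℝ → ℝ} {s t : ℝ} (hst : s ≤ t)
    (h : ∀ τ, HasDerivAt φ (φ' τ) τ) (hn : ∀ τ ∈ Ioo s t, φ' τ ≤ 0) : φ t ≤ φ s := by
  refine antitoneOn_of_deriv_nonpos (convex_Icc s t)
    (fun τ _ ↦ (h τ).continuousAt.continuousWithinAt)
    (fun τ _ ↦ (h τ).differentiableAt.differentiableWithinAt) (fun τ hτ ↦ ?_)
    (left_mem_Icc.2 hst) (right_mem_Icc.2 hst) hst
  rw [interior_Icc] at hτ
  rw [(h τ).deriv]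
  exact hn τ hτ

lemma exists_first_zero {φ : ℝ → ℝ} (hφ : Continuous φ) {s t : ℝ} (hst : s < t) (hs : 0 < φ s)
    (ht : φ t ≤ 0) : ∃ T ∈ Ioc s t, φ T = 0 ∧ ∀ τ ∈ Ico s T, 0 < φ τ := by
  have hne : (Icc s t ∩ φ ⁻¹' {0}).Nonempty := by
    obtain ⟨r, hr, hr'⟩ := intermediate_value_Icc' hst.le hφ.continuousOn ⟨ht, hs.le⟩
    exact ⟨r, hr, hr'⟩
  obtain ⟨T, ⟨hT, hT0⟩, hmin⟩ :=
    (isCompact_Icc.inter_right (isClosed_singleton.preimage hφ)).exists_isLeast hne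
  have hT0 : φ T = 0 := hT0
  have hsT : s < T := lt_of_le_of_ne hT.1 fun h ↦ by rw [← h] at hT0; exact hs.ne' hT0
  refine ⟨T, ⟨hsT, hT.2⟩, hT0, fun τ hτ ↦ ?_⟩
  by_contra! hc
  obtain ⟨r, hr, hr'⟩ := intermediate_value_Icc' hτ.1 hφ.continuousOn ⟨hc, hs.le⟩
  have := hmin ⟨⟨hr.1, hr.2.trans (hτ.2.le.trans hT.2)⟩, hr'⟩
  linarith [hr.2, hτ.2]

lemma hasDerivAt_primitive {g : ℝ → ℝ} (hg : Continuous g) (x : ℝ) :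
    HasDerivAt (fun u ↦ ∫ s in (0 : ℝ)..u, g s) (g x) x :=
  intervalIntegral.integral_hasDerivAt_right (hg.intervalIntegrable _ _)
    (hg.stronglyMeasurableAtFilter _ _) hg.continuousAt

/-- The primitive of a function that is nonnegative on `[0, ∞)` is monotone there. -/
lemma primitive_mono {g : ℝ → ℝ} (hg : Continuous g) (hg0 : ∀ x, 0 < x → 0 ≤ g x) {u v : ℝ}
    (hu : 0 ≤ u) (huv : u ≤ v) : ∫ s in (0 : ℝ)..u, g s ≤ ∫ s in (0 : ℝ)..v, g s := by
  have := le_of_hasDerivAt_nonpos (φ := fun u ↦ -∫ s in (0 : ℝ)..u, g s) huv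
    (fun τ ↦ (hasDerivAt_primitive hg τ).neg)
    (fun τ hτ ↦ by linarith [hg0 τ (hu.trans_lt hτ.1)])
  simpa using this

lemma primitive_nonneg {g : ℝ → ℝ} (hg : Continuous g) (hg0 : ∀ x, 0 < x → 0 ≤ g x) {u : ℝ}
    (hu : 0 ≤ u) : 0 ≤ ∫ s in (0 : ℝ)..u, g s := by
  simpa using primitive_mono hg hg0 le_rfl hu

lemma IsLienardSol_s10.hasDerivAt_energy {F g x y : ℝ → ℝ} (h : IsLienardSol_s10 F g x y)
    (hg : Continuous g) (c t : ℝ) :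
    HasDerivAt (fun t ↦ (y t - c) ^ 2 / 2 + ∫ s in (0 : ℝ)..x t, g s)
      (-(g (x t) * (F (x t) - c))) t := by
  have h1 := (((h t).2.sub_const c).fun_pow 2).div_const 2
  have h2 := (hasDerivAt_primitive hg (x t)).comp t (h t).1
  exact (h1.fun_add h2).congr_deriv (by push_cast; ring)

lemma IsLienardSol_s10.antitone_snd {F g x y : ℝ → ℝ} (h : IsLienardSol_s10 F g x y)
    {s t : ℝ} (hst : s ≤ t) (hn : ∀ τ ∈ Ioo s t, 0 ≤ g (x τ)) : y t ≤ y s :=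
  le_of_hasDerivAt_nonpos hst (fun τ ↦ (h τ).2) fun τ hτ ↦ neg_nonpos.2 (hn τ hτ)

/-- A solution that starts on the positive `y`-axis, runs through the right half-plane and is back
on the `y`-axis at time `T`. -/
structure IsHalfOrbit (F g x y : ℝ → ℝ) (T : ℝ) : Prop where
  sol : IsLienardSol_s10 F g x y
  pos : 0 < T
  fst_zero : x 0 = 0
  fst_end : x T = 0
  fst_pos : ∀ t ∈ Ioo 0 T, 0 < x t
  snd_zero : 0 < y 0
  snd_end : y T < 0

namespace IsHalfOrbit

variable {F g x y : ℝ → ℝ} {T : ℝ}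

lemma fst_nonneg (h : IsHalfOrbit F g x y T) {t : ℝ} (ht : t ∈ Icc 0 T) : 0 ≤ x t := by
  rcases ht.1.eq_or_lt with h0 | h0
  · rw [← h0, h.fst_zero]
  rcases ht.2.eq_or_lt with h1 | h1
  · rw [h1, h.fst_end]
  exact (h.fst_pos t ⟨h0, h1⟩).le

lemma energy_le (h : IsHalfOrbit F g x y T) (hg : Continuous g) (hg0 : ∀ x, 0 < x → 0 < g x)
    {m : ℝ} (hm : ∀ x, 0 ≤ x → m ≤ F x) {t : ℝ} (ht : t ∈ Icc 0 T) :
    (y t - m) ^ 2 / 2 + ∫ s in (0 : ℝ)..x t, g s ≤ (y 0 - m) ^ 2 / 2 := by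
  have := le_of_hasDerivAt_nonpos ht.1 (h.sol.hasDerivAt_energy hg m) fun τ hτ ↦ by
    have hx := h.fst_pos τ ⟨hτ.1, hτ.2.trans_le ht.2⟩
    exact neg_nonpos.2 (mul_nonneg (hg0 _ hx).le (sub_nonneg.2 (hm _ hx.le)))
  simpa [h.fst_zero] using this

lemma neg_snd_end_le (h : IsHalfOrbit F g x y T) (hg : Continuous g)
    (hg0 : ∀ x, 0 < x → 0 < g x) {m : ℝ} (hm0 : m ≤ 0) (hm : ∀ x, 0 ≤ x → m ≤ F x) :
    -y T ≤ y 0 - 2 * m := by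
  have := h.energy_le hg hg0 hm (right_mem_Icc.2 h.pos.le)
  rw [h.fst_end, intervalIntegral.integral_same, add_zero] at this
  have h0 := h.snd_zero
  have := abs_le_of_sq_le_sq (a := y T - m) (b := y 0 - m) (by linarith) (by linarith)
  linarith [(abs_le.1 this).1]

lemma le_neg_snd_end (h : IsHalfOrbit F g x y T) (hg : Continuous g)
    (hg0 : ∀ x, 0 < x → 0 < g x) {a e : ℝ} (ha : 0 < a) (hFa : ∀ x, 0 < x → x ≤ a → F x < 0)
    (he : 0 < e) (hea : e ^ 2 / 2 ≤ ∫ s in (0 : ℝ)..a, g s) (hey : e ≤ y 0) : e ≤ -y T := by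
  by_contra! hlt
  set V : ℝ → ℝ := fun t ↦ (y t - 0) ^ 2 / 2 + ∫ s in (0 : ℝ)..x t, g s with hV
  have hVd := h.sol.hasDerivAt_energy hg 0
  have hVc : Continuous V := continuous_iff_continuousAt.2 fun t ↦ (hVd t).continuousAt
  have hVT : V T < e ^ 2 / 2 := by
    simp only [hV, h.fst_end, intervalIntegral.integral_same]
    nlinarith [h.snd_end]
  have hV0 : e ^ 2 / 2 ≤ V 0 := by
    simp only [hV, h.fst_zero, intervalIntegral.integral_same]
    nlinarith
  obtain ⟨S, hS, hS0, hSpos⟩ := exists_first_zero (φ := fun t ↦ e ^ 2 / 2 - V (T - t))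
    (by fun_prop) h.pos (by simpa using hVT) (by simpa using hV0)
  have := le_of_hasDerivAt_nonpos (φ := fun t ↦ -V t) (s := T - S) (t := T) (by linarith [hS.1])
    (fun τ ↦ (hVd τ).neg) fun τ hτ ↦ by
      have hx := h.fst_pos τ ⟨by linarith [hτ.1, hS.2], hτ.2⟩
      have h1 := hSpos (T - τ) ⟨by linarith [hτ.2], by linarith [hτ.1]⟩
      rw [sub_sub_cancel] at h1
      have hxa : x τ ≤ a := by
        by_contra! hxa
        have := primitive_mono hg (fun x hx ↦ (hg0 x hx).le) ha.le hxa.le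
        simp only [hV] at h1
        nlinarith [sq_nonneg (y τ - 0)]
      nlinarith [hg0 _ hx, hFa _ hx hxa]
  have hVS : e ^ 2 / 2 - V (T - S) = 0 := hS0
  linarith

/-- Large half-orbits lose energy. -/
lemma neg_snd_end_le_sub (h : IsHalfOrbit F g x y T) (hF : Continuous F) (hg : Continuous g)
    (hg0 : ∀ x, 0 < x → 0 < g x) {m c b D : ℝ} (hm : ∀ x, 0 ≤ x → m ≤ F x) (hmc : m ≤ c)
    (hcb : c < b) (hD : ∀ x, 0 ≤ x → ∫ s in (0 : ℝ)..x, g s * max (b - F s) 0 ≤ D)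
    (hy1 : b + 1 ≤ y 0) (hy2 : 1 - m + 2 * c ≤ y 0)
    (hy3 : (b - c) * (b + 1) + 2 * D + (c - m) * (b + 2 - m) ≤ (b - c) * y 0) :
    -y T ≤ y 0 - 2 * c := by
  rcases le_total (m - 1) (y T) with hyT | hyT
  · linarith
  have hanti : ∀ s t, 0 ≤ s → s ≤ t → t ≤ T → y t ≤ y s := fun s t hs hst ht ↦
    h.sol.antitone_snd hst fun τ hτ ↦
      (hg0 _ (h.fst_pos τ ⟨hs.trans_lt hτ.1, hτ.2.trans_le ht⟩)).le
  obtain ⟨t₁, ht₁, hyt₁⟩ : b + 1 ∈ y '' Icc 0 T :=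
    intermediate_value_Icc' h.pos.le h.sol.continuous_snd_s10.continuousOn ⟨by linarith, hy1⟩
  obtain ⟨t₂, ht₂, hyt₂⟩ : m - 1 ∈ y '' Icc t₁ T :=
    intermediate_value_Icc' ht₁.2 h.sol.continuous_snd_s10.continuousOn ⟨hyT, by linarith⟩
  have hpc : Continuous fun s ↦ g s * max (b - F s) 0 := by fun_prop
  set Θ : ℝ → ℝ := fun u ↦ ∫ s in (0 : ℝ)..u, g s * max (b - F s) 0 with hΘ
  have hΘd : ∀ t, HasDerivAt (fun t ↦ Θ (x t))
      (g (x t) * max (b - F (x t)) 0 * (y t - F (x t))) t :=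
    fun t ↦ (hasDerivAt_primitive hpc (x t)).comp t (h.sol t).1
  set V : ℝ → ℝ := fun t ↦ (y t - c) ^ 2 / 2 + ∫ s in (0 : ℝ)..x t, g s with hV
  have hVd := h.sol.hasDerivAt_energy hg c
  have hΘD : ∀ t ∈ Icc 0 T, Θ (x t) ≤ D := fun t ht ↦ hD _ (h.fst_nonneg ht)
  have e1 := le_of_hasDerivAt_nonpos (φ := fun t ↦ V t - (b - c) * y t - Θ (x t)) ht₁.1
    (fun τ ↦ ((hVd τ).sub ((h.sol τ).2.const_mul (b - c))).sub (hΘd τ)) fun τ hτ ↦ by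
      have hg' := hg0 _ (h.fst_pos τ ⟨hτ.1, hτ.2.trans_le ht₁.2⟩)
      have hy := hanti τ t₁ hτ.1.le hτ.2.le ht₁.2
      rcases le_total (b - F (x τ)) 0 with hb | hb
      · rw [max_eq_right hb]; nlinarith
      · rw [max_eq_left hb]
        nlinarith [mul_nonneg (mul_nonneg hg'.le hb) (by linarith : 0 ≤ y τ - F (x τ) - 1)]
  have e2 := le_of_hasDerivAt_nonpos (φ := fun t ↦ V t + (c - m) * y t) ht₂.1
    (fun τ ↦ (hVd τ).add ((h.sol τ).2.const_mul (c - m))) fun τ hτ ↦ by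
      have hx := h.fst_pos τ ⟨ht₁.1.trans_lt hτ.1, hτ.2.trans_le ht₂.2⟩
      nlinarith [hg0 _ hx, hm _ hx.le]
  have e3 := le_of_hasDerivAt_nonpos (φ := fun t ↦ V t - (b - c) * y t + Θ (x t)) ht₂.2
    (fun τ ↦ ((hVd τ).sub ((h.sol τ).2.const_mul (b - c))).add (hΘd τ)) fun τ hτ ↦ by
      have h0 : 0 < τ := (ht₁.1.trans ht₂.1).trans_lt hτ.1
      have hx := h.fst_pos τ ⟨h0, hτ.2⟩
      have hg' := hg0 _ hx
      have hF' := hm _ hx.le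
      have hy := hanti t₂ τ (ht₁.1.trans ht₂.1) hτ.1.le hτ.2.le
      rcases le_total (b - F (x τ)) 0 with hb | hb
      · rw [max_eq_right hb]; nlinarith
      · rw [max_eq_left hb]
        nlinarith [mul_nonneg (mul_nonneg hg'.le hb) (by linarith : 0 ≤ -(y τ - F (x τ)) - 1)]
  have d1 := hΘD t₁ ht₁
  have d2 := hΘD t₂ ⟨ht₁.1.trans ht₂.1, ht₂.2⟩
  have hΘ0 : Θ 0 = 0 := intervalIntegral.integral_same
  have hVT : V T = (y T - c) ^ 2 / 2 := by simp [hV, h.fst_end]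
  have hV0 : V 0 = (y 0 - c) ^ 2 / 2 := by simp [hV, h.fst_zero]
  simp only [h.fst_zero, h.fst_end, hΘ0, hyt₁, hyt₂] at e1 e2 e3
  have hfin : (y T - c) ^ 2 ≤ (y 0 - c) ^ 2 := by
    nlinarith [mul_nonneg (sub_nonneg.2 hcb.le) (sub_nonneg.2 hyT)]
  have := abs_le_of_sq_le_sq hfin (by linarith)
  linarith [(abs_le.1 this).1]

end IsHalfOrbit

lemma eventually_pos_mul_of_hasDerivAt {φ : ℝ → ℝ} {d T : ℝ} (h : HasDerivAt φ d T) (hd : 0 < d)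
    (hT : φ T = 0) : ∀ᶠ t in 𝓝[≠] T, 0 < (t - T) * φ t := by
  filter_upwards [(hasDerivAt_iff_tendsto_slope.1 h).eventually (lt_mem_nhds hd),
    self_mem_nhdsWithin] with t ht hne
  have hne : t - T ≠ 0 := sub_ne_zero.2 hne
  rw [slope_def_field, hT, sub_zero] at ht
  have : (t - T) * φ t = φ t / (t - T) * (t - T) ^ 2 := by field_simp
  rw [this]
  positivity

/-- The assumptions on a Liénard system that make every solution starting on the positive `y`-axis
run through the right half-plane in finite time. -/
structure IsRightLienard (F g : ℝ → ℝ) : Prop where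
  lipschitz_F : ∃ K, LipschitzWith K F
  lipschitz_g : ∃ K, LipschitzWith K g
  bounded_F : ∃ C, ∀ x, |F x| ≤ C
  bounded_g : ∃ C, ∀ x, |g x| ≤ C
  F_zero : F 0 = 0
  g_zero : g 0 = 0
  g_pos : ∀ ε > 0, ∃ η > 0, ∀ x, ε ≤ x → η ≤ g x
  F_neg : ∃ a > 0, ∀ x, 0 < x → x ≤ a → F x < 0

namespace IsRightLienard

variable {F g x y : ℝ → ℝ}

lemma continuous_F (H : IsRightLienard F g) : Continuous F := H.lipschitz_F.choose_spec.continuous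

lemma continuous_g (H : IsRightLienard F g) : Continuous g := H.lipschitz_g.choose_spec.continuous

lemma pos_g (H : IsRightLienard F g) {x : ℝ} (hx : 0 < x) : 0 < g x := by
  obtain ⟨η, hη, h⟩ := H.g_pos x hx
  exact hη.trans_le (h x le_rfl)

/-- Along a solution that stays in the right half-plane forever, `x → 0` as soon as `x'` is bounded
and `y` converges. -/
lemma tendsto_fst_zero (H : IsRightLienard F g) (h : IsLienardSol_s10 F g x y)
    (hx : ∀ t, 0 < t → 0 < x t) {A l : ℝ} (hA : 0 < A) (hxA : ∀ t, 0 ≤ t → |y t - F (x t)| ≤ A)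
    (hl : Tendsto y atTop (𝓝 l)) : Tendsto x atTop (𝓝 0) := by
  refine tendsto_order.2 ⟨fun r hr ↦ ?_, fun ε hε ↦ ?_⟩
  · filter_upwards [eventually_gt_atTop 0] with t ht using hr.trans (hx t ht)
  obtain ⟨η, hη, hgη⟩ := H.g_pos (ε / 2) (by positivity)
  set δ := ε / (2 * A) with hδ
  have hδ0 : 0 < δ := by positivity
  have hδA : A * δ = ε / 2 := by rw [hδ]; field_simp
  have hlim : Tendsto (fun t ↦ y t - y (t + δ)) atTop (𝓝 0) := by
    simpa using hl.sub (hl.comp (tendsto_atTop_add_const_right _ δ tendsto_id))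
  filter_upwards [eventually_gt_atTop 0, hlim.eventually (gt_mem_nhds (mul_pos hη hδ0))]
    with t ht hyt
  by_contra! hxt
  have hbig : ∀ τ ∈ Ioo t (t + δ), ε / 2 ≤ x τ := by
    intro τ hτ
    have := le_of_hasDerivAt_nonpos (φ := fun τ ↦ -x τ - A * τ) hτ.1.le
      (fun σ ↦ (h σ).1.neg.sub ((hasDerivAt_id σ).const_mul A)) fun σ hσ ↦ by
        have := abs_le.1 (hxA σ (ht.trans hσ.1).le)
        linarith [this.1]
    nlinarith [hτ.2]
  have := le_of_hasDerivAt_nonpos (φ := fun τ ↦ y τ + η * τ) (by linarith : t ≤ t + δ)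
    (fun σ ↦ (h σ).2.add ((hasDerivAt_id σ).const_mul η)) fun σ hσ ↦ by
      linarith [hgη _ (hbig σ hσ)]
  nlinarith

lemma exists_fst_nonpos (H : IsRightLienard F g) (h : IsLienardSol_s10 F g x y) (hx0 : x 0 = 0)
    (hy0 : 0 < y 0) : ∃ t, 0 < t ∧ x t ≤ 0 := by
  by_contra! hx
  obtain ⟨C, hC⟩ := H.bounded_F
  obtain ⟨a, ha, hFa⟩ := H.F_neg
  have hg := H.continuous_g
  have hC0 : 0 ≤ C := (abs_nonneg _).trans (hC 0)
  have hanti : ∀ s t, 0 ≤ s → s ≤ t → y t ≤ y s := fun s t hs hst ↦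
    h.antitone_snd hst fun τ hτ ↦ (H.pos_g (hx τ (hs.trans_lt hτ.1))).le
  have hprim : ∀ {u : ℝ}, 0 ≤ u → 0 ≤ ∫ s in (0 : ℝ)..u, g s :=
    primitive_nonneg hg fun x hx ↦ (H.pos_g hx).le
  have hx' : ∀ t, 0 ≤ t → 0 ≤ x t := fun t ht ↦ by
    rcases ht.eq_or_lt with h0 | h0
    · rw [← h0, hx0]
    · exact (hx t h0).le
  have hyb : ∀ t, 0 ≤ t → |y t + C| ≤ y 0 + C := by
    intro t ht
    have := le_of_hasDerivAt_nonpos ht (h.hasDerivAt_energy hg (-C)) fun τ hτ ↦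
      neg_nonpos.2 (mul_nonneg (H.pos_g (hx τ hτ.1)).le (by linarith [(abs_le.1 (hC (x τ))).1]))
    simp only [hx0, intervalIntegral.integral_same, sub_neg_eq_add] at this
    exact abs_le_of_sq_le_sq (by linarith [hprim (hx' t ht)]) (by linarith)
  have hxA : ∀ t, 0 ≤ t → |y t - F (x t)| ≤ y 0 + 3 * C := by
    intro t ht
    have h1 := abs_le.1 (hyb t ht)
    have h2 := abs_le.1 (hC (x t))
    exact abs_le.2 ⟨by linarith, by linarith⟩
  obtain ⟨l, hl⟩ : ∃ l, Tendsto y atTop (𝓝 l) := by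
    have hmono : Antitone fun t ↦ y (max t 0) := fun s t hst ↦
      hanti _ _ (le_max_right _ _) (max_le_max_right 0 hst)
    have hbdd : BddBelow (range fun t ↦ y (max t 0)) := ⟨-(y 0 + 2 * C), by
      rintro _ ⟨t, rfl⟩
      linarith [(abs_le.1 (hyb _ (le_max_right t 0))).1]⟩
    refine ⟨_, (tendsto_atTop_ciInf hmono hbdd).congr' ?_⟩
    filter_upwards [eventually_ge_atTop 0] with t ht
    rw [max_eq_left ht]
  have hxlim := H.tendsto_fst_zero h hx (by linarith) hxA hl
  have hl0 : l = 0 := by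
    choose c hc hc' using fun t : ℝ ↦ exists_hasDerivAt_eq_slope x (fun t ↦ y t - F (x t))
      (lt_add_one t) h.continuous_fst_s10.continuousOn fun s _ ↦ (h s).1
    have hcT : Tendsto c atTop atTop := tendsto_atTop_mono (fun t ↦ (hc t).1.le) tendsto_id
    have h1 : Tendsto (fun t ↦ y (c t) - F (x (c t))) atTop (𝓝 (l - F 0)) :=
      (hl.sub ((H.continuous_F.tendsto 0).comp hxlim)).comp hcT
    have h2 : Tendsto (fun t ↦ y (c t) - F (x (c t))) atTop (𝓝 (0 - 0)) :=
      ((hxlim.comp (tendsto_atTop_add_const_right _ 1 tendsto_id)).sub hxlim).congr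
        fun t ↦ by simp [hc' t]
    simpa [H.F_zero] using tendsto_nhds_unique h1 h2
  subst hl0
  have hVlim : Tendsto (fun t ↦ (y t - 0) ^ 2 / 2 + ∫ s in (0 : ℝ)..x t, g s) atTop (𝓝 0) := by
    have h1 := ((hasDerivAt_primitive hg 0).continuousAt.tendsto).comp hxlim
    simpa using (((hl.sub_const 0).pow 2).div_const 2).add h1
  obtain ⟨t₀, ht₀⟩ := eventually_atTop.1
    ((eventually_gt_atTop 0).and (hxlim.eventually (gt_mem_nhds ha)))
  have hV := ge_of_tendsto hVlim (b := (y t₀ - 0) ^ 2 / 2 + ∫ s in (0 : ℝ)..x t₀, g s) (by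
    filter_upwards [eventually_ge_atTop t₀] with t ht
    have := le_of_hasDerivAt_nonpos
      (φ := fun t ↦ -((y t - 0) ^ 2 / 2 + ∫ s in (0 : ℝ)..x t, g s)) ht
      (fun τ ↦ (h.hasDerivAt_energy hg 0 τ).neg) fun τ hτ ↦ by
        have hτ' := ht₀ τ hτ.1.le
        have hxτ := hx τ hτ'.1
        nlinarith [H.pos_g hxτ, hFa _ hxτ hτ'.2.le]
    linarith)
  have hpos := intervalIntegral.intervalIntegral_pos_of_pos_on (hg.intervalIntegrable _ _)
    (fun u hu ↦ H.pos_g hu.1) (hx t₀ (ht₀ t₀ le_rfl).1)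
  nlinarith [sq_nonneg (y t₀ - 0)]

lemma exists_isHalfOrbit (H : IsRightLienard F g) (h : IsLienardSol_s10 F g x y) (hx0 : x 0 = 0)
    (hy0 : 0 < y 0) : ∃ T, IsHalfOrbit F g x y T := by
  obtain ⟨t, ht, hxt⟩ := H.exists_fst_nonpos h hx0 hy0
  have hd : HasDerivAt x (y 0) 0 := by simpa [hx0, H.F_zero] using (h 0).1
  have hev := (eventually_pos_mul_of_hasDerivAt hd hy0 hx0).filter_mono
    (nhdsWithin_mono 0 fun u (hu : u ∈ Ioi 0) ↦ ne_of_gt hu)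
  obtain ⟨s, hs, hs'⟩ := (mem_nhdsGT_iff_exists_Ioc_subset).1 hev
  have hsmall : ∀ u ∈ Ioc 0 s, 0 < x u := fun u hu ↦ by
    have : 0 < (u - 0) * x u := hs' hu
    rw [sub_zero] at this
    exact (pos_iff_pos_of_mul_pos this).1 hu.1
  have hst : s < t := by
    by_contra! hc
    linarith [hsmall t ⟨ht, hc⟩]
  obtain ⟨T, hT, hxT, hpos⟩ := exists_first_zero h.continuous_fst_s10 hst (hsmall s ⟨hs, le_rfl⟩) hxt
  have hT0 : 0 < T := lt_trans hs hT.1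
  refine ⟨T, h, hT0, hx0, hxT, fun u hu ↦ ?_, hy0, ?_⟩
  · rcases le_total u s with hus | hus
    · exact hsmall u ⟨hu.1, hus⟩
    · exact hpos u ⟨hus, hu.2⟩
  · by_contra! hyT
    rcases hyT.eq_or_lt with hyT | hyT
    · obtain ⟨KF, hF⟩ := H.lipschitz_F
      obtain ⟨Kg, hg⟩ := H.lipschitz_g
      have h00 : IsLienardSol_s10 F g (fun _ ↦ 0) (fun _ ↦ 0) := fun t ↦ by
        simpa [H.F_zero, H.g_zero] using hasDerivAt_const t (0 : ℝ)
      have := (h.unique hF hg h00 (s := T) hxT hyT.symm).2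
      rw [this] at hy0
      exact lt_irrefl _ hy0
    · have hd : HasDerivAt x (y T) T := by simpa [hxT, H.F_zero] using (h T).1
      have hev := (eventually_pos_mul_of_hasDerivAt hd hyT hxT).filter_mono
        (nhdsWithin_mono T fun u (hu : u ∈ Iio T) ↦ ne_of_lt hu)
      obtain ⟨u, hu, hu'⟩ := (hev.and (Ioo_mem_nhdsLT hT.1)).exists
      nlinarith [hpos u ⟨hu'.1.le, hu'.2⟩, hu'.2]

/-- The half-return map from the positive to the negative `y`-axis is defined everywhere and
continuous. -/
lemma exists_halfReturn (H : IsRightLienard F g) : ∃ ρ : ℝ → ℝ, ContinuousOn ρ (Ioi 0) ∧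
    ∀ b, 0 < b → ∃ x y T, IsHalfOrbit F g x y T ∧ y 0 = b ∧ y T = -ρ b := by
  obtain ⟨KF, hF⟩ := H.lipschitz_F
  obtain ⟨Kg, hg⟩ := H.lipschitz_g
  obtain ⟨CF, hCF⟩ := H.bounded_F
  obtain ⟨Cg, hCg⟩ := H.bounded_g
  choose X Y hsol hX0 hY0 using fun b ↦ exists_isLienardSol hF hg
    (fun x ↦ (hCF x).trans (le_max_left CF Cg)) (fun x ↦ (hCg x).trans (le_max_right CF Cg)) 0 b
  choose! T hT using fun b (hb : 0 < b) ↦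
    H.exists_isHalfOrbit (hsol b) (hX0 b) ((hY0 b).symm ▸ hb)
  refine ⟨fun b ↦ -Y b (T b), ?_, fun b hb ↦ ⟨X b, Y b, T b, hT b hb, hY0 b, (neg_neg _).symm⟩⟩
  obtain ⟨K, hK⟩ := IsLienardSol_s10.exists_dist_le hF hg
  have hΨ : Continuous fun z : ℝ × ℝ ↦ (X z.1 (max z.2 0), Y z.1 (max z.2 0)) := by
    refine continuous_iff_continuousAt.2 fun z ↦ tendsto_iff_dist_tendsto_zero.2 ?_
    have hXz := (hsol z.1).continuous_fst_s10
    have hYz := (hsol z.1).continuous_snd_s10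
    have hlim : Tendsto (fun w : ℝ × ℝ ↦
        dist ((0 : ℝ), w.1) (0, z.1) * Real.exp (K * max w.2 0) +
        dist (X z.1 (max w.2 0), Y z.1 (max w.2 0)) (X z.1 (max z.2 0), Y z.1 (max z.2 0)))
        (𝓝 z) (𝓝 0) := by
      refine (Continuous.tendsto' ?_ _ _ ?_)
      · fun_prop
      · simp
    refine squeeze_zero (fun _ ↦ dist_nonneg) (fun w ↦ (dist_triangle _ _ _).trans
      (add_le_add_left ?_ _)) hlim
    simpa [hX0, hY0] using hK _ _ _ _ (hsol w.1) (hsol z.1) (max w.2 0) (le_max_right _ _)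
  have hTcont : ∀ b, 0 < b → ContinuousAt T b := by
    intro b hb
    have hTb := hT b hb
    refine tendsto_order.2 ⟨fun r hr ↦ ?_, fun r hr ↦ ?_⟩
    · have hev : ∀ᶠ c in 𝓝 b, ∀ t ∈ Icc 0 r, 0 < t → 0 < X c t := by
        refine isCompact_Icc.eventually_forall_of_forall_eventually fun t ht ↦ ?_
        rcases ht.1.eq_or_lt with h0 | h0
        · subst h0
          have hu : Continuous fun z : ℝ × ℝ ↦ Y z.1 (max z.2 0) - F (X z.1 (max z.2 0)) :=
            hΨ.snd.sub (H.continuous_F.comp hΨ.fst)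
          have hu0 : 0 < Y b (max 0 0) - F (X b (max 0 0)) := by
            simpa [hX0, hY0, H.F_zero] using hb
          obtain ⟨ε, hε, hball⟩ := Metric.eventually_nhds_iff.1
            ((hu.tendsto (b, 0)).eventually (lt_mem_nhds hu0))
          refine Metric.eventually_nhds_iff.2 ⟨ε, hε, fun z hz hz0 ↦ ?_⟩
          have hmono : StrictMonoOn (X z.1) (Icc 0 z.2) :=
            strictMonoOn_of_deriv_pos (convex_Icc _ _) (hsol z.1).continuous_fst_s10.continuousOn
              fun τ hτ ↦ by
                rw [interior_Icc] at hτ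
                rw [(hsol z.1 τ).1.deriv]
                have hd : dist (z.1, τ) (b, 0) < ε := by
                  rw [Prod.dist_eq, max_lt_iff] at hz ⊢
                  refine ⟨hz.1, lt_of_le_of_lt ?_ hz.2⟩
                  simp only [Real.dist_eq, sub_zero]
                  rw [abs_of_pos hτ.1, abs_of_pos hz0]
                  exact hτ.2.le
                simpa [max_eq_left hτ.1.le] using hball hd
          have := hmono (left_mem_Icc.2 hz0.le) (right_mem_Icc.2 hz0.le) hz0
          rwa [hX0] at this
        · have hpos : 0 < X b (max t 0) := by
            rw [max_eq_left h0.le]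
            exact hTb.fst_pos t ⟨h0, ht.2.trans_lt hr⟩
          filter_upwards [(hΨ.fst.tendsto (b, t)).eventually (lt_mem_nhds hpos)] with z hz hz0
          simpa [max_eq_left hz0.le] using hz
      filter_upwards [hev, lt_mem_nhds hb] with c hc hc0
      by_contra! hle
      have := hc (T c) ⟨(hT c hc0).pos.le, hle⟩ (hT c hc0).pos
      exact this.ne' (hT c hc0).fst_end
    · have hd : HasDerivAt (fun t ↦ -X b t) (-Y b (T b)) (T b) := by
        simpa [hTb.fst_end, H.F_zero] using (hsol b (T b)).1.fun_neg
      have hev := (eventually_pos_mul_of_hasDerivAt hd (neg_pos.2 hTb.snd_end)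
        (by simp [hTb.fst_end])).filter_mono
        (nhdsWithin_mono (T b) fun u (hu : u ∈ Ioi (T b)) ↦ ne_of_gt hu)
      obtain ⟨t, ht, ht'⟩ := (hev.and (Ioo_mem_nhdsGT hr)).exists
      have ht0 : 0 < t := hTb.pos.trans ht'.1
      have hneg : X b (max t 0) < 0 := by
        rw [max_eq_left ht0.le]
        nlinarith [ht'.1]
      filter_upwards [((hΨ.fst.comp (Continuous.prodMk_left t)).tendsto b).eventually
        (gt_mem_nhds hneg), lt_mem_nhds hb] with c hc hc0
      have hc : X c (max t 0) < 0 := hc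
      rw [max_eq_left ht0.le] at hc
      by_contra! hle
      linarith [(hT c hc0).fst_nonneg ⟨ht0.le, ht'.2.le.trans hle⟩]
  intro b hb
  have hcomp : ContinuousAt (fun b ↦ -Y b (max (T b) 0)) b :=
    (hΨ.snd.continuousAt.comp (continuousAt_id.prodMk (hTcont b hb))).neg
  refine (hcomp.congr ?_).continuousWithinAt
  filter_upwards [lt_mem_nhds hb] with c hc
  rw [max_eq_left (hT c hc).pos.le]

end IsRightLienard

lemma clamp_nonneg {R x : ℝ} (hR : 0 ≤ R) (hx : 0 ≤ x) : 0 ≤ clamp R x :=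
  le_max_of_le_right (le_min hR hx)

lemma integral_comp_clamp {R : ℝ} (hR : 0 ≤ R) (g : ℝ → ℝ) {x : ℝ} (hx : x ∈ Icc 0 R) :
    ∫ s in (0 : ℝ)..x, (g ∘ clamp R) s = ∫ s in (0 : ℝ)..x, g s := by
  refine intervalIntegral.integral_congr fun s hs ↦ ?_
  rw [uIcc_of_le hx.1] at hs
  simp only [Function.comp_apply]
  rw [clamp_of_mem ⟨by linarith [hs.1], hs.2.trans hx.2⟩]

lemma pos_comp_clamp {R : ℝ} (hR : 0 < R) {g : ℝ → ℝ} (hg0 : ∀ x, 0 < x → 0 < g x) (x : ℝ)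
    (hx : 0 < x) : 0 < (g ∘ clamp R) x :=
  hg0 _ (lt_max_of_lt_right (lt_min hR hx))

lemma isRightLienard_clamp {F g : ℝ → ℝ} {R a : ℝ} (hF : Continuous F) (hg : Continuous g)
    (hFL : ∃ K, LipschitzWith K (F ∘ clamp R)) (hgL : ∃ K, LipschitzWith K (g ∘ clamp R))
    (hF0 : F 0 = 0) (hg00 : g 0 = 0) (hg0 : ∀ x, 0 < x → 0 < g x) (ha : 0 < a) (haR : a ≤ R)
    (hFa : ∀ x, 0 < x → x ≤ a → F x < 0) : IsRightLienard (F ∘ clamp R) (g ∘ clamp R) := by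
  have hR : 0 < R := ha.trans_le haR
  have hb : ∀ φ : ℝ → ℝ, Continuous φ → ∃ C, ∀ x, |(φ ∘ clamp R) x| ≤ C := fun φ hφ ↦ by
    obtain ⟨C, hC⟩ := (isCompact_Icc (a := -R) (b := R)).exists_bound_of_continuousOn
      hφ.continuousOn
    exact ⟨C, fun x ↦ hC _ (clamp_mem hR.le x)⟩
  have h0 : clamp R 0 = 0 := clamp_of_mem ⟨by linarith, hR.le⟩
  refine ⟨hFL, hgL, hb F hF, hb g hg, by simp [h0, hF0], by simp [h0, hg00], fun ε hε ↦ ?_,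
    a, ha, fun x hx hxa ↦ ?_⟩
  · obtain ⟨z, hz, hmin⟩ := (isCompact_Icc (a := min ε R) (b := R)).exists_isMinOn
      ⟨R, min_le_right _ _, le_rfl⟩ hg.continuousOn
    refine ⟨g z, hg0 z ((lt_min hε hR).trans_le hz.1), fun x hx ↦ hmin ⟨?_, ?_⟩⟩
    · exact le_max_of_le_right (le_min (min_le_right _ _) ((min_le_left _ _).trans hx))
    · exact (clamp_mem hR.le x).2
  · rw [Function.comp_apply, clamp_of_mem ⟨by linarith, hxa.trans haR⟩]
    exact hFa x hx hxa

lemma IsHalfOrbit.fst_le_of_clamp {F g x y : ℝ → ℝ} {T R m : ℝ} (hR : 0 < R)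
    (h : IsHalfOrbit (F ∘ clamp R) (g ∘ clamp R) x y T) (hg : Continuous g)
    (hg0 : ∀ x, 0 < x → 0 < g x) (hm : ∀ x, 0 ≤ x → m ≤ F x)
    (hy : (y 0 - m) ^ 2 / 2 < ∫ s in (0 : ℝ)..R, g s) {t : ℝ} (ht : t ∈ Icc 0 T) : x t ≤ R := by
  by_contra! hlt
  have hgc : Continuous (g ∘ clamp R) := hg.comp (lipschitzWith_clamp R).continuous
  have h1 := h.energy_le hgc (pos_comp_clamp hR hg0) (m := m)
    (fun x hx ↦ hm _ (clamp_nonneg hR.le hx)) ht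
  have h2 := primitive_mono hgc (fun x hx ↦ (pos_comp_clamp hR hg0 x hx).le) hR.le hlt.le
  rw [integral_comp_clamp hR.le g ⟨hR.le, le_rfl⟩] at h2
  nlinarith [sq_nonneg (y t - m)]

/-- Large right half-orbits lose at least `2 * c` in height, uniformly in the truncation. -/
lemma exists_outer {F g : ℝ → ℝ} {k b c : ℝ} (hF : Continuous F) (hg : Continuous g)
    (hg0 : ∀ x, 0 < x → 0 < g x) (hk : 0 < k) (hFb : ∀ x, k < x → b ≤ F x)
    (hcb : c < b) :
    ∃ m β : ℝ, m ≤ 0 ∧ (∀ x, 0 ≤ x → m ≤ F x) ∧ ∀ R, k < R → ∀ x y T,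
      IsHalfOrbit (F ∘ clamp R) (g ∘ clamp R) x y T → β ≤ y 0 → -y T ≤ y 0 - 2 * c := by
  obtain ⟨z, -, hmin⟩ := (isCompact_Icc (a := 0) (b := k)).exists_isMinOn
    ⟨0, le_rfl, hk.le⟩ hF.continuousOn
  set m := min (min (F z) c) 0 with hm_def
  have hm0 : m ≤ 0 := min_le_right _ _
  have hmc : m ≤ c := (min_le_left _ _).trans (min_le_right _ _)
  have hm : ∀ x, 0 ≤ x → m ≤ F x := fun x hx ↦ by
    rcases le_or_gt x k with h | h
    · exact ((min_le_left _ _).trans (min_le_left _ _)).trans (hmin ⟨hx, h⟩)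
    · exact hmc.trans (hcb.le.trans (hFb x h))
  set p : ℝ → ℝ := fun s ↦ g s * max (b - F s) 0 with hp_def
  have hp : Continuous p := hg.mul ((continuous_const.sub hF).max continuous_const)
  have hp0 : ∀ x, 0 < x → 0 ≤ p x := fun x hx ↦ mul_nonneg (hg0 x hx).le (le_max_right _ _)
  set D := ∫ s in (0 : ℝ)..k, p s with hD_def
  have hD : ∀ x, 0 ≤ x → ∫ s in (0 : ℝ)..x, p s ≤ D := fun x hx ↦ by
    rcases le_total x k with h | h
    · exact primitive_mono hp hp0 hx h
    · refine le_of_hasDerivAt_nonpos h (fun τ ↦ hasDerivAt_primitive hp τ) fun τ hτ ↦ ?_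
      have : max (b - F τ) 0 = 0 := max_eq_right (by linarith [hFb τ hτ.1])
      simp [hp_def, this]
  refine ⟨m, max (b + 1) (max (1 - m + 2 * c)
    (b + 1 + (2 * D + (c - m) * (b + 2 - m)) / (b - c))), hm0, hm, ?_⟩
  intro R hR x y T h hy
  have hR0 : 0 < R := hk.trans hR
  have hcl := (lipschitzWith_clamp R).continuous
  have hbc : 0 < b - c := sub_pos.2 hcb
  obtain ⟨hy1, hy2, hy3⟩ := by simpa only [max_le_iff] using hy
  refine h.neg_snd_end_le_sub (hF.comp hcl) (hg.comp hcl) (pos_comp_clamp hR0 hg0)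
    (fun x hx ↦ hm _ (clamp_nonneg hR0.le hx)) hmc hcb (D := D) (fun x hx ↦ ?_) hy1 hy2 ?_
  · refine le_trans (le_of_eq ?_) (hD x hx)
    refine intervalIntegral.integral_congr fun s hs ↦ ?_
    rw [uIcc_of_le hx] at hs
    rcases le_total s R with h | h
    · simp only [Function.comp_apply, hp_def]
      rw [clamp_of_mem ⟨by linarith [hs.1], h⟩]
    · simp only [Function.comp_apply, hp_def]
      rw [clamp_of_le hR0.le h, max_eq_right (by linarith [hFb R hR]),
        max_eq_right (by linarith [hFb s (hR.trans_le h)])]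
      simp
  · have : (b - c) * ((2 * D + (c - m) * (b + 2 - m)) / (b - c)) =
      2 * D + (c - m) * (b + 2 - m) := mul_div_cancel₀ _ hbc.ne'
    nlinarith [mul_le_mul_of_nonneg_left hy3 hbc.le]

/-- A right and a left half-orbit with matching ends form a closed orbit. -/
lemma IsHalfOrbit.periodic {F g x y x' y' : ℝ → ℝ} {T T' : ℝ} {KF Kg : NNReal}
    (hF : LipschitzWith KF F) (hg : LipschitzWith Kg g) (h : IsHalfOrbit F g x y T)
    (h' : IsHalfOrbit (fun s ↦ -F (-s)) (fun s ↦ -g (-s)) x' y' T')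
    (hyT : y T = -y' 0) (hyT' : y' T' = -y 0) :
    (∀ t, x (t + T) = -x' t) ∧ Function.Periodic x (T + T') ∧ Function.Periodic y (T + T') := by
  have e := (h.sol.comp_add T).unique hF hg h'.sol.neg (s := 0)
    (by simp [h.fst_end, h'.fst_zero]) (by simp [hyT])
  have e1 : ∀ t, x (t + T) = -x' t := fun t ↦ congrFun e.1 t
  have e2 : ∀ t, y (t + T) = -y' t := fun t ↦ congrFun e.2 t
  have p := (h.sol.comp_add (T + T')).unique hF hg h.sol (s := 0)
    (by rw [zero_add, add_comm T, e1, h'.fst_end, h.fst_zero, neg_zero])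
    (by rw [zero_add, add_comm T, e2, hyT', neg_neg])
  exact ⟨e1, fun t ↦ congrFun p.1 t, fun t ↦ congrFun p.2 t⟩

lemma IsHalfOrbit.mem_Icc_of_periodic {F g F' g' x y x' y' : ℝ → ℝ} {T T' R : ℝ}
    (h : IsHalfOrbit F g x y T) (h' : IsHalfOrbit F' g' x' y' T')
    (e : ∀ t, x (t + T) = -x' t) (hp : Function.Periodic x (T + T'))
    (hx : ∀ t ∈ Icc 0 T, x t ≤ R) (hx' : ∀ t ∈ Icc 0 T', x' t ≤ R) (t : ℝ) :
    x t ∈ Icc (-R) R := by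
  have hT := h.pos
  have hT' := h'.pos
  have h0 := hx 0 ⟨le_rfl, hT.le⟩
  rw [h.fst_zero] at h0
  obtain ⟨s, hs, hst⟩ := hp.exists_mem_Ico₀ (add_pos hT hT') t
  rw [hst]
  rcases le_total s T with hsT | hsT
  · have hs' : s ∈ Icc 0 T := ⟨hs.1, hsT⟩
    exact ⟨by linarith [h.fst_nonneg hs'], hx s hs'⟩
  · have hs' : s - T ∈ Icc 0 T' := ⟨by linarith, by linarith [hs.2]⟩
    have := e (s - T)
    rw [sub_add_cancel] at this
    rw [this]
    exact ⟨by linarith [hx' _ hs'], by linarith [h'.fst_nonneg hs']⟩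

lemma exists_lipschitzWith_comp_clamp {φ : ℝ → ℝ} (hφ : LocallyLipschitz φ) {R : ℝ}
    (hR : 0 ≤ R) : ∃ K, LipschitzWith K (φ ∘ clamp R) := by
  obtain ⟨K, hK⟩ := (hφ.locallyLipschitzOn (s := Icc (-R) R)).exists_lipschitzOnWith_of_compact
    isCompact_Icc
  refine ⟨K * 1, ?_⟩
  rw [← lipschitzOnWith_univ] at *
  exact hK.comp (lipschitzWith_clamp R).lipschitzOnWith fun x _ ↦ clamp_mem hR x

/-- Dragilëv's theorem in the Liénard plane. -/
lemma exists_periodic_lienard {F g : ℝ → ℝ} (hFl : LocallyLipschitz F) (hgl : LocallyLipschitz g)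
    (hF0 : F 0 = 0) (hg00 : g 0 = 0) (hg0 : ∀ x, 0 < x → 0 < g x) (hg0' : ∀ x, x < 0 → g x < 0)
    (hG : Tendsto (fun x ↦ ∫ s in (0 : ℝ)..x, g s) atTop atTop)
    (hG' : Tendsto (fun x ↦ ∫ s in (0 : ℝ)..x, g s) atBot atTop)
    {a₁ a₂ k b₁ b₂ : ℝ} (ha₁ : a₁ < 0) (ha₂ : 0 < a₂) (hFa₁ : ∀ x, a₁ ≤ x → x < 0 → 0 < F x)
    (hFa₂ : ∀ x, 0 < x → x ≤ a₂ → F x < 0) (hk₁ : -a₁ < k) (hk₂ : a₂ < k) (hb : b₁ < b₂)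
    (hFb₁ : ∀ x, x < -k → F x ≤ b₁) (hFb₂ : ∀ x, k < x → b₂ ≤ F x) :
    ∃ (x y : ℝ → ℝ) (T T₁ : ℝ), 0 < T ∧ Function.Periodic x T ∧ Function.Periodic y T ∧
      IsLienardSol_s10 F g x y ∧ x 0 = 0 ∧ 0 < y 0 ∧ x T₁ = 0 ∧ y T₁ < 0 := by
  set Fm : ℝ → ℝ := fun s ↦ -F (-s) with hFm_def
  set gm : ℝ → ℝ := fun s ↦ -g (-s) with hgm_def
  have hF : Continuous F := hFl.continuous
  have hg : Continuous g := hgl.continuous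
  have hFm : Continuous Fm := (hF.comp continuous_neg).neg
  have hgm : Continuous gm := (hg.comp continuous_neg).neg
  have hgm0 : ∀ x, 0 < x → 0 < gm x := fun x hx ↦ neg_pos.2 (hg0' _ (neg_lt_zero.2 hx))
  have hFma : ∀ x, 0 < x → x ≤ -a₁ → Fm x < 0 := fun x hx hxa ↦
    neg_lt_zero.2 (hFa₁ _ (by linarith) (by linarith))
  have hGm : ∀ x, ∫ s in (0 : ℝ)..x, gm s = ∫ s in (0 : ℝ)..(-x), g s := fun x ↦ by
    simp only [hgm_def]
    rw [intervalIntegral.integral_neg, intervalIntegral.integral_comp_neg, neg_zero,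
      ← intervalIntegral.integral_symm]
  have hk : 0 < k := ha₂.trans hk₂
  have ha₁' : 0 < -a₁ := neg_pos.2 ha₁
  set c := (b₁ + b₂) / 2 with hc
  obtain ⟨m, β₁, hm0, hm, hout⟩ := exists_outer hF hg hg0 hk hFb₂ (c := c) (by linarith)
  obtain ⟨n, β₂, hn0, hn, hout'⟩ := exists_outer hFm hgm hgm0 hk (b := -b₁) (c := -c)
    (fun x hx ↦ neg_le_neg (hFb₁ _ (by linarith))) (by linarith)
  have hpos : ∀ φ : ℝ → ℝ, Continuous φ → (∀ x, 0 < x → 0 < φ x) → ∀ a, 0 < a →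
      0 < ∫ s in (0 : ℝ)..a, φ s := fun φ hφ h a ha ↦
    intervalIntegral.intervalIntegral_pos_of_pos_on (hφ.intervalIntegrable _ _)
      (fun x hx ↦ h x hx.1) ha
  obtain ⟨e, he, hea₂, hea₁⟩ : ∃ e : ℝ, 0 < e ∧ e ^ 2 / 2 ≤ ∫ s in (0 : ℝ)..a₂, g s ∧
      e ^ 2 / 2 ≤ ∫ s in (0 : ℝ)..(-a₁), gm s := by
    have hμ := lt_min (hpos g hg hg0 a₂ ha₂) (hpos gm hgm hgm0 _ ha₁')
    refine ⟨√(min (∫ s in (0 : ℝ)..a₂, g s) (∫ s in (0 : ℝ)..(-a₁), gm s)),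
      Real.sqrt_pos.2 hμ, ?_, ?_⟩ <;> rw [Real.sq_sqrt hμ.le]
    · linarith [min_le_left (∫ s in (0 : ℝ)..a₂, g s) (∫ s in (0 : ℝ)..(-a₁), gm s)]
    · linarith [min_le_right (∫ s in (0 : ℝ)..a₂, g s) (∫ s in (0 : ℝ)..(-a₁), gm s)]
  set β := max e (max β₁ (β₂ - 2 * n)) with hβ
  have hβe : e ≤ β := le_max_left _ _
  have hβ₁ : β₁ ≤ β := (le_max_left _ _).trans (le_max_right _ _)
  have hβ₂ : β₂ - 2 * n ≤ β := (le_max_right _ _).trans (le_max_right _ _)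
  obtain ⟨R, hRk, hGR, hGR'⟩ := ((eventually_gt_atTop k).and
    ((hG.eventually_gt_atTop ((β - m) ^ 2 / 2)).and
      ((hG'.comp tendsto_neg_atTop_atBot).eventually_gt_atTop
        ((β - 2 * m - n) ^ 2 / 2)))).exists
  simp only [Function.comp_apply] at hGR'
  rw [← hGm] at hGR'
  have hR : 0 < R := hk.trans hRk
  have hcl := (lipschitzWith_clamp R).continuous
  have hFR := exists_lipschitzWith_comp_clamp hFl hR.le
  have hgR := exists_lipschitzWith_comp_clamp hgl hR.le
  have hneg : ∀ φ : ℝ → ℝ, (fun s ↦ -φ (-s)) ∘ clamp R = fun s ↦ -(φ ∘ clamp R) (-s) :=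
    fun φ ↦ by
      ext s
      simp [clamp_neg hR.le]
  have hnegL : ∀ φ : ℝ → ℝ, (∃ K, LipschitzWith K φ) →
      ∃ K, LipschitzWith K (fun s ↦ -φ (-s)) := fun φ ⟨K, hK⟩ ↦
    ⟨_, (hK.comp LipschitzWith.id.neg).neg⟩
  have H := isRightLienard_clamp (R := R) hF hg hFR hgR hF0 hg00 hg0 ha₂ (by linarith) hFa₂
  have H' := isRightLienard_clamp (R := R) hFm hgm
    (by rw [hFm_def, hneg]; exact hnegL _ hFR) (by rw [hgm_def, hneg]; exact hnegL _ hgR)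
    (by simp [hFm_def, hF0]) (by simp [hgm_def, hg00]) hgm0 ha₁' (by linarith) hFma
  obtain ⟨ρ, hρc, hρ⟩ := H.exists_halfReturn
  obtain ⟨σ, hσc, hσ⟩ := H'.exists_halfReturn
  have hmR : ∀ x, 0 ≤ x → m ≤ (F ∘ clamp R) x := fun x hx ↦ hm _ (clamp_nonneg hR.le hx)
  have hnR : ∀ x, 0 ≤ x → n ≤ (Fm ∘ clamp R) x := fun x hx ↦ hn _ (clamp_nonneg hR.le hx)
  have hinner : ∀ φ : ℝ → ℝ, ∀ a, a ≤ R → (∀ x, 0 < x → x ≤ a → φ x < 0) →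
      ∀ x, 0 < x → x ≤ a → (φ ∘ clamp R) x < 0 := fun φ a ha h x hx hxa ↦ by
    rw [Function.comp_apply, clamp_of_mem ⟨by linarith, hxa.trans ha⟩]
    exact h x hx hxa
  have hρe : ∀ v, e ≤ v → e ≤ ρ v := fun v hv ↦ by
    obtain ⟨x, y, T, h, h0, hT⟩ := hρ v (he.trans_le hv)
    have := h.le_neg_snd_end H.continuous_g (fun x hx ↦ H.pos_g hx) ha₂
      (hinner F a₂ (by linarith) hFa₂) he
      (by rwa [integral_comp_clamp hR.le g ⟨ha₂.le, by linarith⟩]) (by rwa [h0])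
    linarith
  have hσe : ∀ v, e ≤ v → e ≤ σ v := fun v hv ↦ by
    obtain ⟨x, y, T, h, h0, hT⟩ := hσ v (he.trans_le hv)
    have := h.le_neg_snd_end H'.continuous_g (fun x hx ↦ H'.pos_g hx) ha₁'
      (hinner Fm (-a₁) (by linarith) hFma) he
      (by rwa [integral_comp_clamp hR.le gm ⟨ha₁'.le, by linarith⟩]) (by rwa [h0])
    linarith
  have hρle : ∀ v, 0 < v → ρ v ≤ v - 2 * m := fun v hv ↦ by
    obtain ⟨x, y, T, h, h0, hT⟩ := hρ v hv
    have := h.neg_snd_end_le H.continuous_g (fun x hx ↦ H.pos_g hx) hm0 hmR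
    linarith
  have hσle : ∀ v, 0 < v → σ v ≤ v - 2 * n := fun v hv ↦ by
    obtain ⟨x, y, T, h, h0, hT⟩ := hσ v hv
    have := h.neg_snd_end_le H'.continuous_g (fun x hx ↦ H'.pos_g hx) hn0 hnR
    linarith
  have hρβ : ∀ v, 0 < v → β₁ ≤ v → ρ v ≤ v - 2 * c := fun v hv hβv ↦ by
    obtain ⟨x, y, T, h, h0, hT⟩ := hρ v hv
    have := hout R hRk x y T h (by rwa [h0])
    linarith
  have hσβ : ∀ v, 0 < v → β₂ ≤ v → σ v ≤ v + 2 * c := fun v hv hβv ↦ by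
    obtain ⟨x, y, T, h, h0, hT⟩ := hσ v hv
    have := hout' R hRk x y T h (by rwa [h0])
    linarith
  have hβ0 : 0 < β := he.trans_le hβe
  obtain ⟨v, hv, hfix⟩ := exists_mem_Icc_isFixedPt (f := σ ∘ ρ) (a := e) (b := β)
    (hσc.comp (hρc.mono fun v hv ↦ he.trans_le hv.1) fun v hv ↦ he.trans_le (hρe v hv.1))
    hβe (hσe _ (hρe _ le_rfl)) (by
      have hρ0 : 0 < ρ β := he.trans_le (hρe _ hβe)
      rw [Function.comp_apply]
      rcases le_total β₂ (ρ β) with h | h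
      · linarith [hσβ _ hρ0 h, hρβ _ hβ0 hβ₁]
      · linarith [hσle _ hρ0])
  have hv0 : 0 < v := he.trans_le hv.1
  have hρv : 0 < ρ v := he.trans_le (hρe v hv.1)
  have hfix' : σ (ρ v) = v := hfix
  obtain ⟨x, y, T, h, h0, hT⟩ := hρ v hv0
  obtain ⟨x', y', T', h', h0', hT'⟩ := hσ (ρ v) hρv
  have hxR : ∀ t ∈ Icc 0 T, x t ≤ R := fun t ht ↦ h.fst_le_of_clamp hR hg hg0 hm
    (by rw [h0]; nlinarith [hv.2]) ht
  have hxR' : ∀ t ∈ Icc 0 T', x' t ≤ R := fun t ht ↦ h'.fst_le_of_clamp hR hgm hgm0 hn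
    (by rw [h0']; nlinarith [hv.2, hρle v hv0]) ht
  obtain ⟨K, hK⟩ := hFR
  obtain ⟨L, hL⟩ := hgR
  rw [hFm_def, hgm_def, hneg, hneg] at h'
  obtain ⟨hx, hpx, hpy⟩ := h.periodic hK hL h' (by rw [hT, h0']) (by rw [hT', hfix', h0])
  have hmem := h.mem_Icc_of_periodic h' hx hpx hxR hxR'
  refine ⟨x, y, T + T', T, add_pos h.pos h'.pos, hpx, hpy, fun t ↦ ?_, h.fst_zero, h.snd_zero,
    h.fst_end, h.snd_end⟩
  have := h.sol t
  simpa only [Function.comp_apply, clamp_of_mem (hmem t)] using this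

theorem dragilev (f g : ℝ → ℝ) (hf : Continuous f) (hg : LocallyLipschitz g)
    (F G : ℝ → ℝ)
    (hF : ∀ x, F x = ∫ s in (0:ℝ)..x, f s)
    (hG : ∀ x, G x = ∫ s in (0:ℝ)..x, g s)
    (hB2 : ∀ x : ℝ, x ≠ 0 → 0 < x * g x)
    (hB2' : Tendsto G atTop atTop) (hB2'' : Tendsto G atBot atTop)
    (a₁ a₂ : ℝ) (ha₁ : a₁ < 0) (ha₂ : 0 < a₂)
    (hB3 : ∀ x, a₁ ≤ x → x < 0 → 0 < F x)
    (hB3' : ∀ x, 0 < x → x ≤ a₂ → F x < 0)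
    (k b₁ b₂ : ℝ) (hk : max (-a₁) a₂ < k) (hb : b₁ < b₂)
    (hB4 : ∀ x, x < -k → F x ≤ b₁)
    (hB4' : ∀ x, k < x → b₂ ≤ F x) :
    ∃ (x y : ℝ → ℝ) (T : ℝ), 0 < T ∧
      (∀ t, x (t + T) = x t ∧ y (t + T) = y t) ∧
      (∀ t, HasDerivAt x (y t) t) ∧
      (∀ t, HasDerivAt y (-g (x t) - f (x t) * y t) t) ∧
      (∃ t₁ t₂, (x t₁, y t₁) ≠ (x t₂, y t₂)) := by
  have hFd : ∀ x, HasDerivAt F (f x) x := fun x ↦ by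
    rw [funext hF]
    exact hasDerivAt_primitive hf x
  have hFl : LocallyLipschitz F := ContDiff.locallyLipschitz (𝕂 := ℝ) (contDiff_one_iff_deriv.2
    ⟨fun x ↦ (hFd x).differentiableAt, by rwa [funext fun x ↦ (hFd x).deriv]⟩)
  have hg0 : ∀ x, 0 < x → 0 < g x := fun x hx ↦ (mul_pos_iff_of_pos_left hx).1 (hB2 x hx.ne')
  have hg0' : ∀ x, x < 0 → g x < 0 := fun x hx ↦ by
    by_contra! h
    exact (hB2 x hx.ne).not_ge (mul_nonpos_of_nonpos_of_nonneg hx.le h)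
  have hg00 : g 0 = 0 := by
    refine le_antisymm ?_ ?_
    · exact le_of_tendsto (hg.continuous.continuousWithinAt (s := Set.Iio 0) (x := 0))
        (eventually_nhdsWithin_of_forall fun x hx ↦ (hg0' x hx).le)
    · exact ge_of_tendsto (hg.continuous.continuousWithinAt (s := Set.Ioi 0) (x := 0))
        (eventually_nhdsWithin_of_forall fun x hx ↦ (hg0 x hx).le)
  have hF0 : F 0 = 0 := by simp [hF]
  rw [funext hG] at hB2' hB2''
  obtain ⟨x, y, T, T₁, hT, hx, hy, hsol, hx0, hy0, hx1, hy1⟩ :=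
    exists_periodic_lienard hFl hg hF0 hg00 hg0 hg0' hB2' hB2'' ha₁ ha₂ hB3 hB3'
      ((le_max_left _ _).trans_lt hk) ((le_max_right _ _).trans_lt hk) hb hB4 hB4'
  refine ⟨x, fun t ↦ y t - F (x t), T, hT, fun t ↦ ⟨hx t, by simp only [hx t, hy t]⟩,
    fun t ↦ (hsol t).1, fun t ↦ ?_, 0, T₁, fun h ↦ ?_⟩
  · exact (hsol t).2.sub ((hFd (x t)).comp t (hsol t).1)
  · have := congrArg Prod.snd h
    simp only [hx0, hx1, hF0, sub_zero] at this
    linarith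
end

section
/- (One-dimensional averaging theorem.) Fix r̄ > 0 and ε₀ > 0. Let F₁ : ℝ × (0, r̄) → ℝ and R : ℝ × (0, r̄) × (−ε₀, ε₀) → ℝ be continuous, 2π-periodic in the first variable, and locally Lipschitz in the second variable, and consider the equation dr/dθ = ε F₁(θ, r) + ε² R(θ, r, ε). Define M₁ : (0, r̄) → ℝ by M₁(r) = ∫₀^{2π} F₁(θ, r) dθ. Suppose ρ ∈ (0, r̄) satisfies M₁(ρ) = 0, and there exist a, b with 0 < a < ρ < b < r̄, M₁(r) ≠ 0 for every r ∈ [a, b] \ {ρ}, and M₁(a)·M₁(b) < 0 (which is the nonvanishing of the Brouwer degree of M₁ on (a, b) at 0). Then for every η > 0 there exists ε₁ ∈ (0, ε₀) such that for every ε with 0 < |ε| < ε₁ the equation has a 2π-periodic C¹ solution φ(·; ε) : ℝ → (0, r̄) with |φ(0; ε) − ρ| < η. -/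
open Set Metric Function MeasureTheory
open scoped NNReal

/-- A solution on one period with equal boundary values extends to a periodic solution on `ℝ`. -/
theorem exists_periodic_extension_of_solution {T : ℝ} (hT : 0 < T) {g : ℝ → ℝ → ℝ}
    (hg : Continuous (uncurry g)) (hper : ∀ x, Periodic (g · x) T) {α : ℝ → ℝ}
    (hα : ∀ t ∈ Icc 0 T, HasDerivWithinAt α (g t (α t)) (Icc 0 T) t) (hαT : α 0 = α T) :
    ∃ φ : ℝ → ℝ, Periodic φ T ∧ EqOn φ α (Ico 0 T) ∧ ∀ t, HasDerivAt φ (g t (φ t)) t := by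
  have : Fact (0 < T) := ⟨hT⟩
  have hαc : ContinuousOn α (Icc 0 T) := fun t ht => (hα t ht).continuousWithinAt
  set φ : ℝ → ℝ := fun t => AddCircle.liftIco T 0 α (t : AddCircle T) with hφ
  have hφc : Continuous φ :=
    (AddCircle.liftIco_zero_continuous hαT hαc).comp (AddCircle.continuous_mk' T)
  have hφper : Periodic φ T := fun t => by simp [hφ]
  have hφα : EqOn φ α (Ico 0 T) := fun t ht => AddCircle.liftIco_zero_coe_apply ht
  have hφα' : EqOn φ α (Icc 0 T) := fun t ht => by
    rcases ht.2.lt_or_eq with h | rfl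
    · exact hφα ⟨ht.1, h⟩
    · rw [← hαT, ← hφα ⟨le_rfl, hT⟩, ← hφper 0, zero_add]
  set h : ℝ → ℝ := fun t => g t (φ t) with hh
  have hhc : Continuous h := hg.comp (continuous_id.prodMk hφc)
  have hhper : Periodic h T := fun t => by
    simp only [hh]
    rw [hφper t]
    exact hper _ t
  set ψ : ℝ → ℝ := fun t => α 0 + ∫ s in (0 : ℝ)..t, h s with hψ
  have hψd (t : ℝ) : HasDerivAt ψ (h t) t :=
    ((hhc.integral_hasStrictDerivAt 0 t).hasDerivAt).const_add _
  have hψα : EqOn ψ α (Icc 0 T) := by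
    intro t ht
    have key : ∫ s in (0 : ℝ)..t, h s = α t - α 0 := by
      apply intervalIntegral.integral_eq_sub_of_hasDeriv_right_of_le ht.1
        (hαc.mono (Icc_subset_Icc_right ht.2)) _ (hhc.intervalIntegrable _ _)
      intro s hs
      have hs' : s ∈ Icc 0 T := ⟨hs.1.le, hs.2.le.trans ht.2⟩
      have := (hα s hs').hasDerivAt (Icc_mem_nhds hs.1 (hs.2.trans_le ht.2))
      simp only [hh]
      rw [hφα' hs']
      exact this.hasDerivWithinAt
    simp only [hψ, key]
    ring
  have hψper : Periodic ψ T := by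
    intro t
    have h0 : ∫ s in (0 : ℝ)..T, h s = 0 := by
      have h1 := hψα ⟨hT.le, le_rfl⟩
      simp only [hψ] at h1
      linarith
    have h1 := hhper.intervalIntegral_add_eq t 0
    rw [zero_add, h0] at h1
    have h2 := intervalIntegral.integral_add_adjacent_intervals
      (hhc.intervalIntegrable (μ := volume) 0 t) (hhc.intervalIntegrable t (t + T))
    simp only [hψ]
    linarith
  have hψφ : ψ = φ := by
    funext t
    obtain ⟨s, hs, hts⟩ := (hψper.sub hφper).exists_mem_Ico₀ hT t
    rwa [Pi.sub_apply, Pi.sub_apply, hψα (Ico_subset_Icc_self hs), hφα hs, sub_self,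
      sub_eq_zero] at hts
  refine ⟨φ, hφper, hφα, fun t => ?_⟩
  have := hψd t
  rwa [hψφ] at this

theorem exists_flow_of_lipschitz_of_bounded {T : ℝ} (hT : 0 ≤ T) {g : ℝ → ℝ → ℝ} {K L : ℝ≥0}
    (hg : Continuous (uncurry g)) (hlip : ∀ t, LipschitzWith K (g t))
    (hL : ∀ t ∈ Icc 0 T, ∀ x, |g t x| ≤ L) (x₀ : ℝ) (r : ℝ≥0) :
    ∃ α : ℝ → ℝ → ℝ, (∀ x ∈ closedBall x₀ r, α x 0 = x ∧
      ∀ t ∈ Icc 0 T, HasDerivWithinAt (α x) (g t (α x t)) (Icc 0 T) t) ∧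
      ContinuousOn (α · T) (closedBall x₀ r) := by
  have hPL : IsPicardLindelof g (⟨0, le_rfl, hT⟩ : Icc 0 T) x₀ (r + L * .mk T hT) r L K :=
    { lipschitzOnWith := fun t _ => (hlip t).lipschitzOnWith
      continuousOn := fun x _ =>
        (hg.comp (continuous_id.prodMk continuous_const)).continuousOn
      norm_le := fun t ht x _ => hL t ht x
      mul_max_le := by
        simp [hT] }
  obtain ⟨α, hα, L', hL'⟩ := hPL.exists_forall_mem_closedBall_eq_hasDerivWithinAt_lipschitzOnWith
  exact ⟨α, hα, (hL' T ⟨hT, le_rfl⟩).continuousOn⟩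

/-- Over one period, a solution of `x' = ε F(t, x) + ε² G(t, x)` is displaced by
`ε ∫ F(t, x(0)) dt` up to an error of order `ε²`. -/
theorem abs_displacement_sub_average_le {T : ℝ} (hT : 0 ≤ T) {F G : ℝ → ℝ → ℝ} {K C : ℝ≥0}
    (hF : Continuous (uncurry F)) (hFlip : ∀ t, LipschitzWith K (F t))
    (hFC : ∀ t ∈ Icc 0 T, ∀ x, |F t x| ≤ C) (hGC : ∀ t ∈ Icc 0 T, ∀ x, |G t x| ≤ C)
    {ε : ℝ} (hε : |ε| ≤ 1) {α : ℝ → ℝ}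
    (hα : ∀ t ∈ Icc 0 T,
      HasDerivWithinAt α (ε * F t (α t) + ε ^ 2 * G t (α t)) (Icc 0 T) t) :
    (∀ t ∈ Icc 0 T, |α t - α 0| ≤ 2 * C * |ε| * T) ∧
      |α T - α 0 - ε * ∫ t in (0 : ℝ)..T, F t (α 0)| ≤ ε ^ 2 * ((2 * K * C * T + C) * T) := by
  have hε0 := abs_nonneg ε
  have hC0 : (0 : ℝ) ≤ C := C.2
  have hK0 : (0 : ℝ) ≤ K := K.2
  have hsq : ε ^ 2 = |ε| * |ε| := by rw [← sq, sq_abs]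
  have hdist : ∀ t ∈ Icc 0 T, |α t - α 0| ≤ 2 * C * |ε| * T := by
    intro t ht
    have h := norm_image_sub_le_of_norm_deriv_le_segment' hα (C := 2 * C * |ε|) (fun s hs => by
      have hs' := Ico_subset_Icc_self hs
      refine (norm_add_le _ _).trans ?_
      rw [Real.norm_eq_abs, Real.norm_eq_abs, abs_mul, abs_mul, abs_of_nonneg (sq_nonneg ε), hsq]
      have h1 := mul_le_mul_of_nonneg_left (hFC s hs' (α s)) hε0
      have h2 := mul_le_mul_of_nonneg_left (hGC s hs' (α s)) (mul_nonneg hε0 hε0)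
      have h3 := mul_le_mul_of_nonneg_right hε (mul_nonneg hε0 hC0)
      linarith) t ht
    rw [Real.norm_eq_abs, sub_zero] at h
    exact h.trans (mul_le_mul_of_nonneg_left ht.2 (by positivity))
  refine ⟨hdist, ?_⟩
  have hFc : Continuous fun t => F t (α 0) := hF.comp (continuous_id.prodMk continuous_const)
  have hder : ∀ t ∈ Icc 0 T,
      HasDerivWithinAt (fun t => α t - ε * ∫ s in (0 : ℝ)..t, F s (α 0))
        (ε * F t (α t) + ε ^ 2 * G t (α t) - ε * F t (α 0)) (Icc 0 T) t := fun t ht =>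
    (hα t ht).sub
      (((hFc.integral_hasStrictDerivAt 0 t).hasDerivAt.const_mul ε).hasDerivWithinAt)
  have h := norm_image_sub_le_of_norm_deriv_le_segment' hder
    (C := ε ^ 2 * (2 * K * C * T + C)) (fun s hs => by
      have hs' := Ico_subset_Icc_self hs
      have hlip := (hFlip s).dist_le_mul (α s) (α 0)
      rw [Real.dist_eq, Real.dist_eq] at hlip
      have h1 : |F s (α s) - F s (α 0)| ≤ K * (2 * C * |ε| * T) :=
        hlip.trans (mul_le_mul_of_nonneg_left (hdist s hs') hK0)
      have h2 := mul_le_mul_of_nonneg_left h1 hε0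
      have h3 := mul_le_mul_of_nonneg_left (hGC s hs' (α s)) (sq_nonneg ε)
      have h4 : ε * F s (α s) + ε ^ 2 * G s (α s) - ε * F s (α 0) =
        ε * (F s (α s) - F s (α 0)) + ε ^ 2 * G s (α s) := by ring
      rw [h4]
      refine (norm_add_le _ _).trans ?_
      rw [Real.norm_eq_abs, Real.norm_eq_abs, abs_mul, abs_mul, abs_of_nonneg (sq_nonneg ε)]
      rw [hsq] at h3 ⊢
      linarith) T ⟨hT, le_rfl⟩
  simp only [intervalIntegral.integral_same, mul_zero, sub_zero, Real.norm_eq_abs] at h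
  rw [show α T - α 0 - ε * ∫ t in (0 : ℝ)..T, F t (α 0) =
    α T - ε * (∫ t in (0 : ℝ)..T, F t (α 0)) - α 0 by ring, ← mul_assoc]
  exact h

theorem exists_periodic_solution_of_average_mul_neg {T : ℝ} (hT : 0 < T) {F G : ℝ → ℝ → ℝ}
    {K C : ℝ≥0} (hF : Continuous (uncurry F)) (hG : Continuous (uncurry G))
    (hFper : ∀ x, Periodic (F · x) T) (hGper : ∀ x, Periodic (G · x) T)
    (hFlip : ∀ t, LipschitzWith K (F t)) (hGlip : ∀ t, LipschitzWith K (G t))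
    (hFC : ∀ t ∈ Icc 0 T, ∀ x, |F t x| ≤ C) (hGC : ∀ t ∈ Icc 0 T, ∀ x, |G t x| ≤ C)
    {ε : ℝ} (hε0 : 0 < |ε|) (hε : |ε| ≤ 1) {x₀ : ℝ} {r : ℝ≥0}
    (hneg : (∫ t in (0 : ℝ)..T, F t (x₀ - r)) * (∫ t in (0 : ℝ)..T, F t (x₀ + r)) < 0)
    (hl : |ε| * ((2 * K * C * T + C) * T) < |∫ t in (0 : ℝ)..T, F t (x₀ - r)|)
    (hr : |ε| * ((2 * K * C * T + C) * T) < |∫ t in (0 : ℝ)..T, F t (x₀ + r)|) :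
    ∃ φ : ℝ → ℝ, Periodic φ T ∧ (∀ t, HasDerivAt φ (ε * F t (φ t) + ε ^ 2 * G t (φ t)) t) ∧
      |φ 0 - x₀| ≤ r ∧ ∀ t, |φ t - φ 0| ≤ 2 * C * |ε| * T := by
  have hr0 : (0 : ℝ) ≤ r := r.2
  have hC0 : (0 : ℝ) ≤ C := C.2
  set g : ℝ → ℝ → ℝ := fun t x => ε * F t x + ε ^ 2 * G t x with hgdef
  have hg : Continuous (uncurry g) := (hF.const_mul ε).add (hG.const_mul (ε ^ 2))
  have hglip (t : ℝ) : LipschitzWith (‖ε‖₊ * K + ‖ε ^ 2‖₊ * K) (g t) := by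
    refine LipschitzWith.add ?_ ?_
    · exact (lipschitzWith_smul ε).comp (hFlip t)
    · exact (lipschitzWith_smul (ε ^ 2)).comp (hGlip t)
  have hgC : ∀ t ∈ Icc 0 T, ∀ x, |g t x| ≤ (‖ε‖₊ * C + ‖ε ^ 2‖₊ * C : ℝ≥0) := by
    intro t ht x
    refine (abs_add_le _ _).trans ?_
    rw [abs_mul, abs_mul]
    push_cast
    exact add_le_add (mul_le_mul_of_nonneg_left (hFC t ht x) (abs_nonneg _))
      (mul_le_mul_of_nonneg_left (hGC t ht x) (abs_nonneg _))
  obtain ⟨α, hα, hαc⟩ := exists_flow_of_lipschitz_of_bounded hT.le hg hglip hgC x₀ r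
  rw [Real.closedBall_eq_Icc] at hα hαc
  have hle : x₀ - r ≤ x₀ + r := by linarith
  have hdisp : ∀ x ∈ Icc (x₀ - r) (x₀ + (r : ℝ)),
      |α x T - x - ε * ∫ t in (0 : ℝ)..T, F t x| ≤ |ε| * (|ε| * ((2 * K * C * T + C) * T)) := by
    intro x hx
    have h := (abs_displacement_sub_average_le hT.le hF hFlip hFC hGC hε (hα x hx).2).2
    rw [(hα x hx).1, ← sq_abs ε] at h
    rw [← mul_assoc, ← sq]
    exact h
  have hsign : ∀ x ∈ Icc (x₀ - r) (x₀ + (r : ℝ)),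
      |ε| * ((2 * K * C * T + C) * T) < |∫ t in (0 : ℝ)..T, F t x| →
      0 < (α x T - x) * (ε * ∫ t in (0 : ℝ)..T, F t x) := by
    intro x hx hlt
    have h1 := (hdisp x hx).trans_lt (mul_lt_mul_of_pos_left hlt hε0)
    rw [← abs_mul] at h1
    generalize (ε * ∫ t in (0 : ℝ)..T, F t x) = m at h1 ⊢
    rcases abs_cases m with ⟨h2, h3⟩ | ⟨h2, h3⟩ <;> rw [h2, abs_lt] at h1
    · exact mul_pos (by linarith) (by linarith)
    · exact mul_pos_of_neg_of_neg (by linarith) (by linarith)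
  have hsl := hsign _ ⟨le_rfl, hle⟩ hl
  have hsr := hsign _ ⟨hle, le_rfl⟩ hr
  have hε2 : 0 < ε ^ 2 := by rw [← sq_abs]; positivity
  have hPneg : (α (x₀ - r) T - (x₀ - r)) * (α (x₀ + r) T - (x₀ + r)) < 0 := by
    by_contra! hcon
    have h1 := mul_pos hsl hsr
    have h2 := mul_nonpos_of_nonneg_of_nonpos hcon
      (mul_neg_of_pos_of_neg hε2 hneg).le
    linarith
  have hPc : ContinuousOn (fun x => α x T - x) (uIcc (x₀ - r) (x₀ + (r : ℝ))) := by
    rw [uIcc_of_le hle]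
    exact hαc.sub continuousOn_id
  obtain ⟨x, hx, hPx⟩ : ∃ x ∈ Icc (x₀ - r) (x₀ + (r : ℝ)), α x T - x = 0 := by
    have := intermediate_value_uIcc hPc (show (0 : ℝ) ∈ _ by
      rw [mem_uIcc]
      rcases mul_neg_iff.1 hPneg with h | h
      · exact Or.inr ⟨h.2.le, h.1.le⟩
      · exact Or.inl ⟨h.1.le, h.2.le⟩)
    rwa [uIcc_of_le hle] at this
  obtain ⟨hx0, hxd⟩ := hα x hx
  obtain ⟨φ, hφper, hφα, hφ⟩ := exists_periodic_extension_of_solution hT hg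
    (fun y => ((hFper y).smul ε).add ((hGper y).smul (ε ^ 2))) hxd (by linarith)
  have hφ0 : φ 0 = α x 0 := hφα ⟨le_rfl, hT⟩
  refine ⟨φ, hφper, hφ, ?_, fun t => ?_⟩
  · rw [hφ0, hx0, abs_le]
    constructor <;> linarith [hx.1, hx.2]
  · obtain ⟨s, hs, hts⟩ := hφper.exists_mem_Ico₀ hT t
    rw [hts, hφα hs, hφ0]
    exact (abs_displacement_sub_average_le hT.le hF hFlip hFC hGC hε hxd).1 s
      (Ico_subset_Icc_self hs)

theorem mul_pos_of_continuousOn_of_forall_ne_zero {f : ℝ → ℝ} {u v : ℝ} (huv : u ≤ v)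
    (hf : ContinuousOn f (Icc u v)) (hne : ∀ x ∈ Icc u v, f x ≠ 0) : 0 < f u * f v := by
  by_contra! hcon
  rw [← uIcc_of_le huv] at hf
  obtain ⟨x, hx, hfx⟩ := intermediate_value_uIcc hf (show (0 : ℝ) ∈ _ by
    rw [mem_uIcc]
    rcases mul_nonpos_iff.1 hcon with h | h
    · exact Or.inr ⟨h.2, h.1⟩
    · exact Or.inl h)
  rw [uIcc_of_le huv] at hx
  exact hne x hx hfx

theorem continuous_uncurry_comp_projIcc {F : ℝ → ℝ → ℝ} {u v : ℝ} (huv : u ≤ v)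
    (hF : ContinuousOn (uncurry F) (univ ×ˢ Icc u v)) :
    Continuous (uncurry fun t x => F t (projIcc u v huv x)) :=
  hF.comp_continuous (f := fun p : ℝ × ℝ => (p.1, (projIcc u v huv p.2 : ℝ)))
    (continuous_fst.prodMk (continuous_subtype_val.comp (continuous_projIcc.comp continuous_snd)))
    fun p => ⟨mem_univ _, (projIcc u v huv p.2).2⟩

theorem LipschitzOnWith.comp_projIcc {f : ℝ → ℝ} {u v : ℝ} {K : ℝ≥0} (huv : u ≤ v)
    (hf : LipschitzOnWith K f (Icc u v)) : LipschitzWith K fun x => f (projIcc u v huv x) := by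
  have h := hf.to_restrict.comp (LipschitzWith.projIcc huv)
  rwa [mul_one] at h

theorem continuousOn_intervalIntegral_of_continuousOn_prod {F : ℝ → ℝ → ℝ} {u v : ℝ}
    (huv : u ≤ v) (hF : ContinuousOn (uncurry F) (univ ×ˢ Icc u v)) (T : ℝ) :
    ContinuousOn (fun x => ∫ t in (0 : ℝ)..T, F t x) (Icc u v) := by
  have hc := continuous_uncurry_comp_projIcc huv hF
  have h : Continuous fun x => ∫ t in (0 : ℝ)..T, F t (projIcc u v huv x) :=
    intervalIntegral.continuous_parametric_intervalIntegral_of_continuous'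
      (f := fun x t => F t (projIcc u v huv x)) (hc.comp continuous_swap) 0 T
  refine h.continuousOn.congr fun x hx => ?_
  simp only [projIcc_of_mem huv hx]

theorem averaging_theorem (rbar ε₀ : ℝ) (hrbar : 0 < rbar) (hε₀ : 0 < ε₀)
    (F₁ : ℝ → ℝ → ℝ) (R : ℝ → ℝ → ℝ → ℝ)
    (hF₁cont : ContinuousOn (fun p : ℝ × ℝ => F₁ p.1 p.2)
      (Set.univ ×ˢ Set.Ioo 0 rbar))
    (hRcont : ContinuousOn (fun p : ℝ × ℝ × ℝ => R p.1 p.2.1 p.2.2)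
      (Set.univ ×ˢ Set.Ioo 0 rbar ×ˢ Set.Ioo (-ε₀) ε₀))
    (hF₁per : ∀ θ r, F₁ (θ + 2 * Real.pi) r = F₁ θ r)
    (hRper : ∀ θ r ε, R (θ + 2 * Real.pi) r ε = R θ r ε)
    (hF₁lip : ∀ r ∈ Set.Ioo (0:ℝ) rbar, ∃ δ > (0:ℝ), ∃ K : NNReal,
      ∀ θ, LipschitzOnWith K (F₁ θ) (Set.Ioo (r - δ) (r + δ) ∩ Set.Ioo 0 rbar))
    (hRlip : ∀ r ∈ Set.Ioo (0:ℝ) rbar, ∃ δ > (0:ℝ), ∃ K : NNReal,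
      ∀ θ, ∀ ε ∈ Set.Ioo (-ε₀) ε₀,
        LipschitzOnWith K (fun s => R θ s ε)
          (Set.Ioo (r - δ) (r + δ) ∩ Set.Ioo 0 rbar))
    (M₁ : ℝ → ℝ) (hM₁ : ∀ r, M₁ r = ∫ θ in (0:ℝ)..(2 * Real.pi), F₁ θ r)
    (ρ : ℝ) (hρ : ρ ∈ Set.Ioo 0 rbar) (hM₁ρ : M₁ ρ = 0)
    (a b : ℝ) (ha : 0 < a) (hab : a < ρ) (hbρ : ρ < b) (hb : b < rbar)
    (hne : ∀ r ∈ Set.Icc a b, r ≠ ρ → M₁ r ≠ 0)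
    (hdeg : M₁ a * M₁ b < 0) :
    ∀ η > (0:ℝ), ∃ ε₁ : ℝ, 0 < ε₁ ∧ ε₁ < ε₀ ∧
      ∀ ε : ℝ, 0 < |ε| → |ε| < ε₁ →
        ∃ φ : ℝ → ℝ,
          (∀ θ, φ θ ∈ Set.Ioo (0:ℝ) rbar) ∧
          (∀ θ, φ (θ + 2 * Real.pi) = φ θ) ∧
          (∀ θ, HasDerivAt φ (ε * F₁ θ (φ θ) + ε ^ 2 * R θ (φ θ) ε) θ) ∧
          |φ 0 - ρ| < η := by
  intro η hη
  have hT : 0 < 2 * Real.pi := Real.two_pi_pos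
  obtain ⟨δF, hδF, KF, hKF⟩ := hF₁lip ρ hρ
  obtain ⟨δR, hδR, KR, hKR⟩ := hRlip ρ hρ
  obtain ⟨d, hd, hdη, hda, hdb, hdF, hdR⟩ : ∃ d > 0, d < η ∧ 2 * d ≤ ρ - a ∧ 2 * d ≤ b - ρ ∧
      2 * d < δF ∧ 2 * d < δR := by
    have hm : 0 < min η (min (ρ - a) (min (b - ρ) (min δF δR))) := by
      simp only [lt_min_iff]
      exact ⟨hη, by linarith, by linarith, hδF, hδR⟩
    obtain ⟨d, hd, hdm⟩ := exists_between (half_pos hm)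
    have hdm' : 2 * d < min η (min (ρ - a) (min (b - ρ) (min δF δR))) := by linarith
    simp only [lt_min_iff] at hdm'
    obtain ⟨h1, h2, h3, h4, h5⟩ := hdm'
    exact ⟨d, hd, by linarith, h2.le, h3.le, h4, h5⟩
  have habI : Icc a b ⊆ Ioo 0 rbar := Icc_subset_Ioo ha hb
  have hM₁c : ContinuousOn M₁ (Icc a b) := by
    rw [show M₁ = _ from funext hM₁]
    exact continuousOn_intervalIntegral_of_continuousOn_prod (hab.trans hbρ).le
      (hF₁cont.mono (prod_mono_right habI)) _
  have hl := mul_pos_of_continuousOn_of_forall_ne_zero (f := M₁) (u := a) (v := ρ - d)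
    (by linarith) (hM₁c.mono (Icc_subset_Icc_right (by linarith)))
    fun x hx => hne x ⟨hx.1, by linarith [hx.2]⟩ (by linarith [hx.2])
  have hr := mul_pos_of_continuousOn_of_forall_ne_zero (f := M₁) (u := ρ + d) (v := b)
    (by linarith) (hM₁c.mono (Icc_subset_Icc_left (by linarith)))
    fun x hx => hne x ⟨by linarith [hx.1], hx.2⟩ (by linarith [hx.1])
  have hneg : M₁ (ρ - d) * M₁ (ρ + d) < 0 := by
    by_contra! hcon
    linarith [mul_pos hl hr, mul_nonpos_of_nonneg_of_nonpos hcon hdeg.le]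
  have hMl : 0 < |M₁ (ρ - d)| := abs_pos.2 (left_ne_zero_of_mul hneg.ne)
  have hMr : 0 < |M₁ (ρ + d)| := abs_pos.2 (right_ne_zero_of_mul hneg.ne)
  set u := ρ - 2 * d
  set v := ρ + 2 * d
  have huv : u ≤ v := by linarith
  have huvI : Icc u v ⊆ Ioo 0 rbar :=
    (Icc_subset_Icc (by linarith) (by linarith)).trans habI
  obtain ⟨CF, hCF⟩ := (isCompact_Icc.prod isCompact_Icc).exists_bound_of_continuousOn
    (hF₁cont.mono (prod_mono (subset_univ (Icc 0 (2 * Real.pi))) huvI))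
  obtain ⟨CR, hCR⟩ :=
    (isCompact_Icc.prod (isCompact_Icc.prod isCompact_Icc)).exists_bound_of_continuousOn
    (hRcont.mono (prod_mono (subset_univ (Icc 0 (2 * Real.pi))) (prod_mono huvI
      (Icc_subset_Ioo (by linarith : -ε₀ < -(ε₀ / 2)) (by linarith : ε₀ / 2 < ε₀)))))
  let C : ℝ≥0 := max CF.toNNReal CR.toNNReal
  have hCFC : CF ≤ C := (Real.le_coe_toNNReal CF).trans (NNReal.coe_le_coe.2 (le_max_left _ _))
  have hCRC : CR ≤ C := (Real.le_coe_toNNReal CR).trans (NNReal.coe_le_coe.2 (le_max_right _ _))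
  let K : ℝ≥0 := max KF KR
  set D : ℝ := (2 * K * C * (2 * Real.pi) + C) * (2 * Real.pi) with hD
  set E : ℝ := 2 * C * (2 * Real.pi) with hE
  have hD0 : 0 ≤ D := by positivity
  have hE0 : 0 ≤ E := by positivity
  obtain ⟨ε₁, hε₁, hlt⟩ := exists_between (show 0 < min 1 (min (ε₀ / 2)
      (min (|M₁ (ρ - d)| / (D + 1)) (min (|M₁ (ρ + d)| / (D + 1)) (d / (E + 1))))) by
    simp only [lt_min_iff]
    exact ⟨one_pos, by positivity, by positivity, by positivity, by positivity⟩)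
  simp only [lt_min_iff] at hlt
  obtain ⟨h1, h2, h3, h4, h5⟩ := hlt
  refine ⟨ε₁, hε₁, by linarith, fun ε hε0 hε => ?_⟩
  have hεD : |ε| * D < |ε| * (D + 1) := by linarith
  have hεE : |ε| * E < |ε| * (E + 1) := by linarith
  have h3' := (lt_div_iff₀ (by positivity)).1 (hε.trans h3)
  have h4' := (lt_div_iff₀ (by positivity)).1 (hε.trans h4)
  have h5' := (lt_div_iff₀ (by positivity)).1 (hε.trans h5)
  have hεI : ε ∈ Icc (-(ε₀ / 2)) (ε₀ / 2) := abs_le.1 (hε.trans h2).le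
  have hεI' : ε ∈ Ioo (-ε₀) ε₀ := ⟨by linarith [hεI.1], by linarith [hεI.2]⟩
  have hRεcont : ContinuousOn (uncurry fun t x => R t x ε) (univ ×ˢ Icc u v) :=
    hRcont.comp (f := fun p : ℝ × ℝ => (p.1, p.2, ε)) (by fun_prop)
      fun p hp => ⟨mem_univ _, huvI hp.2, hεI'⟩
  have hsub {δ : ℝ} (hδ : 2 * d < δ) : Icc u v ⊆ Ioo (ρ - δ) (ρ + δ) ∩ Ioo 0 rbar :=
    subset_inter (Icc_subset_Ioo (by linarith) (by linarith)) huvI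
  have hav {x : ℝ} (hx : x ∈ Icc u v) :
      ∫ t in (0 : ℝ)..(2 * Real.pi), F₁ t (projIcc u v huv x) = M₁ x := by
    rw [hM₁, projIcc_of_mem huv hx]
  have hml : ρ - d ∈ Icc u v := ⟨by linarith, by linarith⟩
  have hmr : ρ + d ∈ Icc u v := ⟨by linarith, by linarith⟩
  obtain ⟨φ, hφper, hφ, hφ0, hφd⟩ := exists_periodic_solution_of_average_mul_neg hT
    (F := fun t x => F₁ t (projIcc u v huv x)) (G := fun t x => R t (projIcc u v huv x) ε)
    (K := K) (C := C) (ε := ε) (x₀ := ρ) (r := .mk d hd.le)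
    (continuous_uncurry_comp_projIcc huv (hF₁cont.mono (prod_mono_right huvI)))
    (continuous_uncurry_comp_projIcc huv hRεcont)
    (fun x t => hF₁per _ _) (fun x t => hRper _ _ _)
    (fun t => (((hKF t).mono (hsub hdF)).comp_projIcc huv).weaken (le_max_left _ _))
    (fun t => (((hKR t ε hεI').mono (hsub hdR)).comp_projIcc huv).weaken (le_max_right _ _))
    (fun t ht x => (hCF (t, _) ⟨ht, (projIcc u v huv x).2⟩).trans hCFC)
    (fun t ht x => (hCR (t, _, ε) ⟨ht, (projIcc u v huv x).2, hεI⟩).trans hCRC)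
    hε0 (hε.trans h1).le
    (by
      simp only [NNReal.coe_mk]
      rwa [hav hml, hav hmr])
    (by
      simp only [NNReal.coe_mk]
      rw [hav hml]
      linarith)
    (by
      simp only [NNReal.coe_mk]
      rw [hav hmr]
      linarith)
  rw [NNReal.coe_mk] at hφ0
  have hφuv (t : ℝ) : φ t ∈ Icc u v := by
    have h6 := hφd t
    rw [show 2 * (C : ℝ) * |ε| * (2 * Real.pi) = |ε| * E by rw [hE]; ring, abs_le] at h6
    rw [abs_le] at hφ0
    constructor <;> linarith [h6.1, h6.2, hφ0.1, hφ0.2]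
  refine ⟨φ, fun t => huvI (hφuv t), hφper, fun t => ?_, hφ0.trans_lt hdη⟩
  have h := hφ t
  rwa [projIcc_of_mem huv (hφuv t)] at h
end
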